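/- Let R be a commutative Noetherian ring of finite Krull dimension d, B = R[X_1,…,X_m,Y_1^{±1},…,Y_n^{±1}] with m + n ≥ 1, f ∈ R[Y] any polynomial, and A = B[Y, f^{-1}]. Let I ⊆ A be a locally complete intersection ideal of height r with r ≥ max{dim A − 1, dim A − r + 2} and dim(A/I) ≤ 1. Then I is set-theoretically generated by r elements. -/

import Mathlib

open MvPolynomial

noncomputable section

/-- The height of an ideal: the infimum of the heights of the prime ideals containing it. -/
def idealHeight {A : Type*} [CommRing A] (I : Ideal A) : ℕ∞ :=
  ⨅ (p : PrimeSpectrum A) (_ : I ≤ p.asIdeal), Order.height p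

/-- `a : Fin k → A` is a regular sequence: each `a i` is a nonzerodivisor modulo the ideal
generated by the previous terms. -/
def IsRegularSeq {A : Type*} [CommRing A] {k : ℕ} (a : Fin k → A) : Prop :=
  ∀ (i : Fin k) (x : A),
    a i * x ∈ Ideal.span {y | ∃ j < i, a j = y} → x ∈ Ideal.span {y | ∃ j < i, a j = y}

/-- An ideal `I` of `A` is a locally complete intersection ideal of height `k` if
`ht I = k` and for every prime `p ⊇ I` the ideal `I A_p` is generated by a regular
sequence of length `k`. -/
def IsLocallyCompleteIntersection {A : Type*} [CommRing A] (I : Ideal A) (k : ℕ) : Prop :=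
  idealHeight I = k ∧
  ∀ p : PrimeSpectrum A, I ≤ p.asIdeal →
    ∃ a : Fin k → Localization.AtPrime p.asIdeal,
      IsRegularSeq a ∧
      Ideal.span (Set.range a)
        = I.map (algebraMap A (Localization.AtPrime p.asIdeal))

/-- The submonoid of the polynomial ring `R[X_1,…,X_m,Y_1,…,Y_n]` generated by the
`Y`-variables; inverting it produces the Laurent polynomial ring
`B = R[X_1,…,X_m,Y_1^{±1},…,Y_n^{±1}]`. -/
def Ymonoid (R : Type*) [CommRing R] (m n : ℕ) :
    Submonoid (MvPolynomial (Fin m ⊕ Fin n) R) :=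
  Submonoid.closure (Set.range fun j : Fin n => (X (Sum.inr j) : MvPolynomial (Fin m ⊕ Fin n) R))

/-- Avoidance lemma for modules, with a finite set of translates. -/
theorem zz_avoid {L M : Type*} [CommRing L] [AddCommGroup M] [Module L M]
    (W : Ideal L → Submodule L M) (M' : Submodule L M) :
    ∀ (n : ℕ) (S : Finset (Ideal L)), S.card = n → (∀ Q ∈ S, Q.IsPrime) →
    (∀ Q ∈ S, ∀ a ∈ Q, ∀ m : M, a • m ∈ W Q) →
    (∀ Q ∈ S, ∀ (a : L) (m : M), a • m ∈ W Q → a ∈ Q ∨ m ∈ W Q) →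
    ∃ F : Finset M, (∀ x ∈ F, x ∈ M') ∧
      ∀ x : M, (∀ Q ∈ S, x ∉ W Q ∨ ¬ M' ≤ W Q) → ∃ m' ∈ F, ∀ Q ∈ S, x + m' ∉ W Q := by
  classical
  intro n
  induction n with
  | zero =>
    intro S hS _ _ _
    rw [Finset.card_eq_zero] at hS
    subst hS
    exact ⟨{0}, by simp, fun x _ => ⟨0, by simp, by simp⟩⟩
  | succ n ih =>
    intro S hS hp h1 h2
    have hne : S.Nonempty := by rw [← Finset.card_pos]; omega
    obtain ⟨Q0, hQ0, hmin⟩ := S.exists_minimal hne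
    obtain ⟨F', hF', hx'⟩ := ih (S.erase Q0) (by rw [Finset.card_erase_of_mem hQ0]; omega)
      (fun Q hQ => hp Q (Finset.mem_of_mem_erase hQ)) (fun Q hQ => h1 Q (Finset.mem_of_mem_erase hQ))
      (fun Q hQ => h2 Q (Finset.mem_of_mem_erase hQ))
    have hl : ∃ l : L, (∀ Q ∈ S.erase Q0, l ∈ Q) ∧ l ∉ Q0 := by
      by_contra hcon
      push Not at hcon
      have : (S.erase Q0).inf id ≤ Q0 := by
        intro l hl
        exact hcon l (by simpa [Submodule.mem_finsetInf] using hl)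
      rw [Ideal.IsPrime.inf_le' (hp Q0 hQ0)] at this
      obtain ⟨Q, hQ, hle⟩ := this
      exact (Finset.ne_of_mem_erase hQ) (le_antisymm hle (hmin (Finset.mem_of_mem_erase hQ) hle))
    obtain ⟨l, hl, hl0⟩ := hl
    by_cases hM : M' ≤ W Q0
    · refine ⟨F', hF', fun x hx => ?_⟩
      obtain ⟨m', hm', h⟩ := hx' x (fun Q hQ => hx Q (Finset.mem_of_mem_erase hQ))
      refine ⟨m', hm', fun Q hQ => ?_⟩
      by_cases hQQ : Q = Q0
      · subst hQQ
        intro hc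
        rcases hx Q hQ with h | h
        · exact h (by simpa using (W Q).sub_mem hc (hM (hF' _ hm')))
        · exact h hM
      · exact h Q (Finset.mem_erase.2 ⟨hQQ, hQ⟩)
    · obtain ⟨m0, hm0, hm0'⟩ := SetLike.not_le_iff_exists.1 hM
      refine ⟨F' ∪ F'.image (fun m => m + l • m0), ?_, fun x hx => ?_⟩
      · intro x hx
        rw [Finset.mem_union, Finset.mem_image] at hx
        rcases hx with hx | ⟨a, ha, rfl⟩
        · exact hF' x hx
        · exact M'.add_mem (hF' a ha) (M'.smul_mem _ hm0)
      obtain ⟨m', hm', h⟩ := hx' x (fun Q hQ => hx Q (Finset.mem_of_mem_erase hQ))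
      by_cases hc : x + m' ∈ W Q0
      · refine ⟨m' + l • m0, Finset.mem_union_right _ (Finset.mem_image_of_mem _ hm'),
          fun Q hQ hc2 => ?_⟩
        rw [← add_assoc] at hc2
        by_cases hQQ : Q = Q0
        · subst hQQ
          have := ((W Q).add_mem_iff_right hc).1 hc2
          rcases h2 Q hQ _ _ this with h | h
          · exact hl0 h
          · exact hm0' h
        · have hQ' := Finset.mem_erase.2 ⟨hQQ, hQ⟩
          exact h Q hQ' (((W Q).add_mem_iff_left (h1 Q hQ _ (hl Q hQ') m0)).1 hc2)
      · refine ⟨m', Finset.mem_union_left _ hm', fun Q hQ => ?_⟩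
        by_cases hQQ : Q = Q0
        · subst hQQ; exact hc
        · exact h Q (Finset.mem_erase.2 ⟨hQQ, hQ⟩)

/-- Ideal version. -/
theorem zz_avoid_ideal {L : Type*} [CommRing L] (S : Set (Ideal L)) (hS : S.Finite)
    (hp : ∀ Q ∈ S, Q.IsPrime) (M' : Ideal L) :
    ∃ F : Finset L, (∀ x ∈ F, x ∈ M') ∧
      ∀ x : L, (∀ Q ∈ S, x ∉ Q ∨ ¬ M' ≤ Q) → ∃ m' ∈ F, ∀ Q ∈ S, x + m' ∉ Q := by
  obtain ⟨F, h1, h2⟩ := zz_avoid (fun Q : Ideal L => (Q : Submodule L L)) M' _ hS.toFinset rfl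
    (fun Q hQ => hp Q (by simpa using hQ)) (fun Q _ a ha m => Q.mul_mem_right m ha)
    (fun Q hQ a m h => (hp Q (by simpa using hQ)).mem_or_mem h)
  exact ⟨F, h1, fun x hx => by simpa using h2 x (by simpa using hx)⟩

/-- In a Noetherian ring of dimension at most one, an ideal in no minimal prime is contained
in only finitely many primes. -/
theorem zz_finite_of_dim_le_one {L : Type*} [CommRing L] [IsNoetherianRing L]
    (hd : ringKrullDim L ≤ 1) (a : Ideal L) (ha : ∀ P ∈ minimalPrimes L, ¬ a ≤ P) :
    {Q : Ideal L | Q.IsPrime ∧ a ≤ Q}.Finite := by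
  refine (Ideal.finite_minimalPrimes_of_isNoetherianRing L a).subset ?_
  rintro Q ⟨hQ, haQ⟩
  obtain ⟨P, hP, hPQ⟩ := Ideal.exists_minimalPrimes_le haQ
  have hPp : P.IsPrime := hP.1.1
  obtain ⟨P0, hP0, hP0P⟩ := Ideal.exists_minimalPrimes_le (bot_le : (⊥ : Ideal L) ≤ P)
  have hP0p : P0.IsPrime := hP0.1.1
  have hne : P0 < P := lt_of_le_of_ne hP0P (fun h => ha P0 hP0 (h ▸ hP.1.2))
  rcases hPQ.eq_or_lt with h | h
  · exact h ▸ hP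
  · exfalso
    have h1 := Ideal.height_add_one_le_of_lt_of_isPrime hne
    have h2 := Ideal.height_add_one_le_of_lt_of_isPrime h
    have h3 := Ideal.height_le_ringKrullDim_of_isPrime (I := Q)
    have h4 : ((Q.height : ℕ∞) : WithBot ℕ∞) ≤ ((1 : ℕ∞) : WithBot ℕ∞) := h3.trans hd
    rw [WithBot.coe_le_coe] at h4
    have h5 : (1 : ℕ∞) + 1 ≤ 1 := by
      calc (1 : ℕ∞) + 1 ≤ (P0.height + 1) + 1 := by gcongr; exact le_add_self
        _ ≤ P.height + 1 := by gcongr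
        _ ≤ _ := h2
        _ ≤ 1 := h4
    exact absurd h5 (by decide)

section FSmod
variable {L M : Type*} [CommRing L] [AddCommGroup M] [Module L M]

/-- `t` generates `M` locally at `Q`. -/
def ZLE (Q : Ideal L) (t : Submodule L M) : Prop := ∀ a : M, ∃ u, u ∉ Q ∧ u • a ∈ t

theorem ZLE.mono {Q : Ideal L} {t t' : Submodule L M} (h : ZLE Q t) (htt : t ≤ t') : ZLE Q t' :=
  fun a => let ⟨u, hu, h⟩ := h a; ⟨u, hu, htt h⟩

/-- The submodule of elements vanishing in `(M/t) ⊗ k(Q)`. -/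
def zW (Q : Ideal L) [hQ : Q.IsPrime] (t : Submodule L M) : Submodule L M where
  carrier := {m | ∃ u, u ∉ Q ∧ u • m ∈ (Q • (⊤ : Submodule L M)) ⊔ t}
  add_mem' := by
    rintro a b ⟨u, hu, ha⟩ ⟨v, hv, hb⟩
    refine ⟨u * v, fun h => (hQ.mem_or_mem h).elim hu hv, ?_⟩
    have e : (u * v) • (a + b) = v • (u • a) + u • (v • b) := by
      rw [smul_add, mul_comm, mul_smul, mul_comm v u, mul_smul]
    rw [e]
    exact Submodule.add_mem _ (Submodule.smul_mem _ _ ha) (Submodule.smul_mem _ _ hb)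
  zero_mem' := ⟨1, fun h => hQ.ne_top ((Ideal.eq_top_iff_one _).2 h), by simp⟩
  smul_mem' := by
    rintro c a ⟨u, hu, ha⟩
    refine ⟨u, hu, ?_⟩
    rw [smul_comm]
    exact Submodule.smul_mem _ _ ha

theorem zW_smul (Q : Ideal L) [hQ : Q.IsPrime] (t : Submodule L M) (a : L) (ha : a ∈ Q) (m : M) :
    a • m ∈ zW Q t :=
  ⟨1, fun h => hQ.ne_top ((Ideal.eq_top_iff_one _).2 h), by
    rw [one_smul]
    exact Submodule.mem_sup_left (Submodule.smul_mem_smul ha trivial)⟩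

theorem zW_prime (Q : Ideal L) [hQ : Q.IsPrime] (t : Submodule L M) (a : L) (m : M)
    (h : a • m ∈ zW Q t) : a ∈ Q ∨ m ∈ zW Q t := by
  obtain ⟨u, hu, h⟩ := h
  by_cases ha : a ∈ Q
  · exact Or.inl ha
  · exact Or.inr ⟨u * a, fun h => (hQ.mem_or_mem h).elim hu ha, by rwa [mul_smul]⟩

theorem zW_le (Q : Ideal L) [hQ : Q.IsPrime] (t : Submodule L M) : t ≤ zW Q t :=
  fun m hm => ⟨1, fun h => hQ.ne_top ((Ideal.eq_top_iff_one _).2 h), by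
    rw [one_smul]; exact Submodule.mem_sup_right hm⟩

/-- clear denominators simultaneously -/
theorem ZLE.unif [Module.Finite L M] {Q : Ideal L} [hQ : Q.IsPrime] {t : Submodule L M}
    (h : ZLE Q t) : ∃ u, u ∉ Q ∧ ∀ a : M, u • a ∈ t := by
  classical
  obtain ⟨s, hs⟩ := Module.Finite.fg_top (R := L) (M := M)
  choose u hu hut using h
  refine ⟨∏ m ∈ s, u m, ?_, ?_⟩
  · rw [Ideal.IsPrime.prod_mem_iff]
    rintro ⟨m, _, hm⟩
    exact hu m hm
  · intro a
    have ha : a ∈ Submodule.span L (s : Set M) := by rw [hs]; trivial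
    induction ha using Submodule.span_induction with
    | mem x hx =>
      rw [← Finset.prod_erase_mul _ _ hx, mul_smul]
      exact Submodule.smul_mem _ _ (hut x)
    | zero => simp
    | add x y _ _ hx hy => rw [smul_add]; exact t.add_mem hx hy
    | smul c x _ hx => rw [smul_comm]; exact t.smul_mem _ hx

/-- Nakayama -/
theorem ZLE.nak [Module.Finite L M] {Q : Ideal L} [hQ : Q.IsPrime] {t : Submodule L M}
    (h : ∀ a : M, ∃ u, u ∉ Q ∧ u • a ∈ (Q • (⊤ : Submodule L M)) ⊔ t) : ZLE Q t := by
  have h0 : ZLE Q ((Q • (⊤ : Submodule L M)) ⊔ t) := h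
  obtain ⟨u, hu, hut⟩ := h0.unif
  -- pass to the submodule u M + t mod t ; use determinant trick on M/t with ideal Q, u
  have key : ∃ v : L, v ∉ Q ∧ ∀ a : M, v • a ∈ t := by
    have : ∃ p : Polynomial L, p.Monic ∧ (∀ k, p.coeff k ∈ Q ^ (p.natDegree - k)) ∧
        Polynomial.aeval (algebraMap L (Module.End L (M ⧸ t)) u) p = 0 := by
      suffices hs : LinearMap.range (algebraMap L (Module.End L (M ⧸ t)) u) ≤
          Q • (⊤ : Submodule L (M ⧸ t)) by
        obtain ⟨p, h1, -, h2, h3⟩ :=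
          LinearMap.exists_monic_and_natDegree_eq_and_coeff_mem_pow_and_aeval_eq_zero L _ Q hs
        exact ⟨p, h1, h2, h3⟩
      rintro _ ⟨x, rfl⟩
      obtain ⟨m, rfl⟩ := Submodule.Quotient.mk_surjective _ x
      rw [Module.algebraMap_end_apply, ← Submodule.Quotient.mk_smul]
      obtain ⟨y, hy, z, hz, e⟩ := Submodule.mem_sup.1 (hut m)
      rw [← e, Submodule.Quotient.mk_add, (Submodule.Quotient.mk_eq_zero t).2 hz, add_zero]
      have : t.mkQ y ∈ Submodule.map t.mkQ (Q • (⊤ : Submodule L M)) := Submodule.mem_map_of_mem hy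
      rw [Submodule.map_smul''] at this
      exact Submodule.smul_mono le_rfl le_top this
    obtain ⟨p, hp, hc, h0⟩ := this
    refine ⟨p.eval u, ?_, ?_⟩
    · intro hmem
      rw [Polynomial.eval_eq_sum_range, Finset.sum_range_succ, hp.coeff_natDegree, one_mul] at hmem
      have : ∑ x ∈ Finset.range p.natDegree, p.coeff x * u ^ x ∈ Q := by
        refine Ideal.sum_mem _ fun i hi => Ideal.mul_mem_right _ _ ?_
        exact Ideal.pow_le_self (by have := Finset.mem_range.1 hi; omega) (hc i)
      exact hu (hQ.mem_of_pow_mem _ ((Ideal.add_mem_iff_right _ this).1 hmem))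
    · intro a
      rw [Polynomial.aeval_algebraMap_apply] at h0
      have := congrArg (fun φ : Module.End L (M ⧸ t) => φ (Submodule.Quotient.mk a)) h0
      simp only [Module.algebraMap_end_apply, LinearMap.zero_apply,
        ← Submodule.Quotient.mk_smul] at this
      simpa using (Submodule.Quotient.mk_eq_zero t).1 this
  obtain ⟨v, hv, h⟩ := key
  exact fun a => ⟨v, hv, h a⟩

theorem ZLE.drop [Module.Finite L M] {Q : Ideal L} [hQ : Q.IsPrime] {t t' : Submodule L M} {v : M}
    (hv : v ∈ zW Q t) (h : ZLE Q (t ⊔ Submodule.span L {v} ⊔ t')) : ZLE Q (t ⊔ t') := by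
  apply ZLE.nak
  obtain ⟨w, hw, hwv⟩ := hv
  intro a
  obtain ⟨u, hu, h⟩ := h a
  refine ⟨w * u, fun h => (hQ.mem_or_mem h).elim hw hu, ?_⟩
  obtain ⟨x, hx, y, hy, e⟩ := Submodule.mem_sup.1 h
  obtain ⟨x1, hx1, x2, hx2, e2⟩ := Submodule.mem_sup.1 hx
  obtain ⟨c, rfl⟩ := Submodule.mem_span_singleton.1 hx2
  rw [mul_smul, ← e, ← e2, smul_add, smul_add, smul_comm w c]
  have l1 : (Q • (⊤ : Submodule L M)) ⊔ t ≤ (Q • (⊤ : Submodule L M)) ⊔ (t ⊔ t') :=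
    sup_le_sup le_rfl le_sup_left
  refine Submodule.add_mem _ (Submodule.add_mem _ ?_ (Submodule.smul_mem _ _ (l1 hwv))) ?_
  · exact Submodule.smul_mem _ _ (Submodule.mem_sup_right (Submodule.mem_sup_left hx1))
  · exact Submodule.smul_mem _ _ (Submodule.mem_sup_right (Submodule.mem_sup_right hy))

/-- exchange -/
theorem ZLE.exch [Module.Finite L M] {Q : Ideal L} [hQ : Q.IsPrime] {t : Submodule L M} {k : ℕ}
    {Z : Fin (k + 1) → M} {v : M}
    (hv : v ∉ zW Q t) (h : ZLE Q (t ⊔ Submodule.span L (Set.range Z))) :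
    ∃ Z' : Fin k → M, ZLE Q (t ⊔ Submodule.span L {v} ⊔ Submodule.span L (Set.range Z')) := by
  obtain ⟨u, hu, huv⟩ := h v
  obtain ⟨x, hx, y, hy, e⟩ := Submodule.mem_sup.1 huv
  obtain ⟨c, rfl⟩ := (Submodule.mem_span_range_iff_exists_fun L).1 hy
  have : ∃ i, c i ∉ Q := by
    by_contra hcon
    push Not at hcon
    refine hv ⟨u, hu, ?_⟩
    rw [← e]
    refine Submodule.add_mem _ (Submodule.mem_sup_right hx) (Submodule.mem_sup_left ?_)
    exact Submodule.sum_mem _ fun i _ => Submodule.smul_mem_smul (hcon i) trivial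
  obtain ⟨i, hi⟩ := this
  refine ⟨fun j => Z (i.succAbove j), fun a => ?_⟩
  obtain ⟨w, hw, h⟩ := h a
  refine ⟨c i * w, fun h => (hQ.mem_or_mem h).elim hi hw, ?_⟩
  set T := t ⊔ Submodule.span L {v} ⊔ Submodule.span L (Set.range fun j => Z (i.succAbove j))
  have ht : t ≤ T := le_sup_left.trans le_sup_left
  have hvT : v ∈ T := Submodule.mem_sup_left (Submodule.mem_sup_right (Submodule.mem_span_singleton_self v))
  have hZ : ∀ j, Z (i.succAbove j) ∈ T := fun j =>
    Submodule.mem_sup_right (Submodule.subset_span ⟨j, rfl⟩)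
  have hci : c i • Z i ∈ T := by
    rw [Fin.sum_univ_succAbove _ i] at e
    have : c i • Z i = u • v - x - ∑ j, c (i.succAbove j) • Z (i.succAbove j) := by rw [← e]; abel
    rw [this]
    exact T.sub_mem (T.sub_mem (T.smul_mem _ hvT) (ht hx))
      (T.sum_mem fun j _ => T.smul_mem _ (hZ j))
  rw [mul_smul]
  obtain ⟨x', hx', y', hy', e'⟩ := Submodule.mem_sup.1 h
  obtain ⟨c', rfl⟩ := (Submodule.mem_span_range_iff_exists_fun L).1 hy'
  rw [← e', smul_add, Fin.sum_univ_succAbove _ i, smul_add, smul_comm (c i) (c' i)]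
  exact T.add_mem (T.smul_mem _ (ht hx')) (T.add_mem (T.smul_mem _ hci)
    (T.smul_mem _ (T.sum_mem fun j _ => T.smul_mem _ (hZ j))))

theorem zspan_snoc {j : ℕ} (v : Fin j → M) (x : M) :
    Submodule.span L (Set.range (Fin.snoc v x : Fin (j + 1) → M)) =
      Submodule.span L (Set.range v) ⊔ Submodule.span L {x} := by
  rw [← Submodule.span_union]
  congr 1
  ext z
  simp only [Set.mem_range, Set.mem_union, Set.mem_singleton_iff]
  constructor
  · rintro ⟨i, rfl⟩
    induction i using Fin.lastCases with
    | last => right; simp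
    | cast i => left; exact ⟨i, by simp⟩
  · rintro (⟨i, rfl⟩ | rfl)
    · exact ⟨i.castSucc, by simp⟩
    · exact ⟨Fin.last j, by simp⟩

theorem zspan_append {j k : ℕ} (v : Fin j → M) (x : Fin k → M) :
    Submodule.span L (Set.range (Fin.append v x)) =
      Submodule.span L (Set.range v) ⊔ Submodule.span L (Set.range x) := by
  rw [← Submodule.span_union]
  congr 1
  ext z
  simp only [Set.mem_range, Set.mem_union]
  constructor
  · rintro ⟨i, rfl⟩
    induction i using Fin.addCases with
    | left i => left; exact ⟨i, by simp⟩
    | right i => right; exact ⟨i, by simp⟩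
  · rintro (⟨i, rfl⟩ | ⟨i, rfl⟩)
    · exact ⟨Fin.castAdd k i, by simp⟩
    · exact ⟨Fin.natAdd j i, by simp⟩

/-- no fewer than `r` elements generate locally -/
def ZLow (L M : Type*) [CommRing L] [AddCommGroup M] [Module L M] (r : ℕ) : Prop :=
  ∀ Q : Ideal L, Q.IsPrime → ∀ k < r, ∀ Z : Fin k → M, ¬ ZLE Q (Submodule.span L (Set.range Z))

theorem ZLow.not_top [Module.Finite L M] {r : ℕ} (hl : ZLow L M r) (Q : Ideal L) [hQ : Q.IsPrime]
    {j : ℕ} (hj : j < r) (v : Fin j → M) :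
    ¬ (⊤ : Submodule L M) ≤ zW Q (Submodule.span L (Set.range v)) := by
  intro h
  exact hl Q hQ j hj v (ZLE.nak fun a => h (Submodule.mem_top : a ∈ _))

/-- avoidance for all W -/
theorem zexists_avoid [Module.Finite L M] (S : Set (Ideal L)) (hS : S.Finite)
    (hp : ∀ Q ∈ S, Q.IsPrime) (t : Ideal L → Submodule L M) (M' : Submodule L M) (x : M)
    (h : ∀ (Q : Ideal L) (hQ : Q.IsPrime), Q ∈ S → x ∉ zW Q (t Q) ∨ ¬ M' ≤ zW Q (t Q)) :
    ∃ m' ∈ M', ∀ (Q : Ideal L) (hQ : Q.IsPrime), Q ∈ S → x + m' ∉ zW Q (t Q) := by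
  classical
  let W : Ideal L → Submodule L M := fun Q => if hQ : Q.IsPrime then zW Q (t Q) else ⊤
  have hW : ∀ (Q : Ideal L) (hQ : Q.IsPrime), W Q = zW Q (t Q) := fun Q hQ => by simp [W, hQ]
  obtain ⟨F, h1, h2⟩ := zz_avoid W M' _ hS.toFinset rfl
    (fun Q hQ => hp Q (by simpa using hQ))
    (fun Q hQ a ha m => by
      have := hp Q (by simpa using hQ)
      rw [hW Q this]; exact zW_smul _ _ _ ha _)
    (fun Q hQ a m h => by
      have := hp Q (by simpa using hQ)
      rw [hW Q this] at h ⊢; exact zW_prime _ _ _ _ h)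
  obtain ⟨m', hm', h3⟩ := h2 x (fun Q hQ => by
    have hq : Q ∈ S := by simpa using hQ
    have := hp Q hq
    rw [hW Q this]; exact h Q this hq)
  exact ⟨m', h1 _ hm', fun Q hQ hQS => by
    rw [← hW Q hQ]; exact h3 Q (by simpa using hQS)⟩

/-- finiteness of bad locus -/
theorem zfinite_bad [IsNoetherianRing L] [Module.Finite L M] (hd : ringKrullDim L ≤ 1)
    (t : Submodule L M) (k : ℕ)
    (h : ∀ P ∈ minimalPrimes L, ∃ Z : Fin k → M, ZLE P (t ⊔ Submodule.span L (Set.range Z))) :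
    {Q : Ideal L | Q.IsPrime ∧
      ¬ ∃ Z : Fin k → M, ZLE Q (t ⊔ Submodule.span L (Set.range Z))}.Finite := by
  let a : Ideal L := Ideal.span {h | ∃ Z : Fin k → M, ∀ m : M,
    h • m ∈ t ⊔ Submodule.span L (Set.range Z)}
  refine (zz_finite_of_dim_le_one hd a ?_).subset ?_
  · intro P hP haP
    obtain ⟨Z, hZ⟩ := h P hP
    have : P.IsPrime := hP.1.1
    obtain ⟨u, hu, hu2⟩ := hZ.unif
    exact hu (haP (Ideal.subset_span ⟨Z, hu2⟩))
  · rintro Q ⟨hQ, hbad⟩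
    refine ⟨hQ, Ideal.span_le.2 ?_⟩
    rintro u ⟨Z, hZ⟩
    by_contra hu
    exact hbad ⟨Z, fun m => ⟨u, hu, hZ m⟩⟩

theorem zstepV [IsNoetherianRing L] [Module.Finite L M] (hd : ringKrullDim L ≤ 1) {r j k : ℕ}
    (hl : ZLow L M r) (hr : r = j + (k + 2)) (v : Fin j → M)
    (hg : ∀ Q : Ideal L, Q.IsPrime → ∃ Z : Fin (k + 2) → M,
      ZLE Q (Submodule.span L (Set.range v) ⊔ Submodule.span L (Set.range Z))) :
    ∃ x : M, ∀ Q : Ideal L, Q.IsPrime → ∃ Z : Fin (k + 1) → M,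
      ZLE Q (Submodule.span L (Set.range (Fin.snoc v x : Fin (j + 1) → M)) ⊔
        Submodule.span L (Set.range Z)) := by
  classical
  set t := Submodule.span L (Set.range v) with ht
  have hmf : (minimalPrimes L).Finite := minimalPrimes.finite_of_isNoetherianRing L
  have hmp : ∀ P ∈ minimalPrimes L, P.IsPrime := fun P hP => hP.1.1
  -- v0
  obtain ⟨v0, -, hv0⟩ := zexists_avoid (minimalPrimes L) hmf hmp (fun _ => t) ⊤ 0
    (fun Q hQ _ => Or.inr (hl.not_top Q (by omega) v))
  simp only [zero_add] at hv0
  have hfin0 := zfinite_bad hd (t ⊔ Submodule.span L {v0}) (k + 1) (fun P hP => by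
    have := hmp P hP
    obtain ⟨Z, hZ⟩ := hg P this
    exact ZLE.exch (hv0 P this hP) hZ)
  set D0 := {Q : Ideal L | Q.IsPrime ∧ ¬ ∃ Z : Fin (k + 1) → M,
    ZLE Q (t ⊔ Submodule.span L {v0} ⊔ Submodule.span L (Set.range Z))} with hD0
  have hD0min : ∀ Q ∈ D0, Q ∉ minimalPrimes L := by
    rintro Q ⟨hQ, hb⟩ hQm
    obtain ⟨Z, hZ⟩ := hg Q hQ
    exact hb (ZLE.exch (hv0 Q hQ hQm) hZ)
  -- v1
  obtain ⟨v1, -, hv1⟩ := zexists_avoid (D0 ∪ minimalPrimes L) (hfin0.union hmf)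
    (by rintro Q (hQ | hQ); exacts [hQ.1, hmp Q hQ])
    (fun Q => if Q ∈ D0 then t else t ⊔ Submodule.span L {v0}) ⊤ 0
    (fun Q hQ _ => by
      right
      by_cases h : Q ∈ D0
      · simp only [h, if_true]; exact hl.not_top Q (by omega) v
      · simp only [h, if_false]; rw [ht, ← zspan_snoc]; exact hl.not_top Q (by omega) _)
  simp only [zero_add] at hv1
  have hv1a : ∀ (Q : Ideal L) (hQ : Q.IsPrime), Q ∈ D0 → v1 ∉ zW Q t := by
    intro Q hQ hQD
    have := hv1 Q hQ (Or.inl hQD)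
    rwa [if_pos hQD] at this
  have hv1b : ∀ (Q : Ideal L) (hQ : Q.IsPrime), Q ∈ minimalPrimes L → v1 ∉ zW Q (t ⊔ Submodule.span L {v0}) := by
    intro Q hQ hQD
    have := hv1 Q hQ (Or.inr hQD)
    rwa [if_neg (fun h => hD0min Q h hQD)] at this
  have hfin1 := zfinite_bad hd (t ⊔ Submodule.span L {v0} ⊔ Submodule.span L {v1}) k (fun P hP => by
    have := hmp P hP
    obtain ⟨Z, hZ⟩ := hg P this
    obtain ⟨Z, hZ⟩ := ZLE.exch (hv0 P this hP) hZ
    exact ZLE.exch (hv1b P this hP) hZ)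
  obtain ⟨m', hm', hfinal⟩ := zexists_avoid _ hfin1 (fun Q hQ => hQ.1) (fun _ => t)
    (Submodule.span L {v1}) v0 (fun Q hQ hQ1 => by
      by_cases h : Q ∈ D0
      · right
        intro hle
        exact hv1a Q hQ h (hle (Submodule.mem_span_singleton_self _))
      · left
        intro hv0W
        have : ∃ Z : Fin (k + 1) → M,
            ZLE Q (t ⊔ Submodule.span L {v0} ⊔ Submodule.span L (Set.range Z)) := by
          by_contra hc
          exact h ⟨hQ, hc⟩
        obtain ⟨Z, hZ⟩ := this
        have := ZLE.drop hv0W hZ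
        rw [ht, ← zspan_append] at this
        exact hl Q hQ (j + (k + 1)) (by omega) _ this)
  obtain ⟨a, rfl⟩ := Submodule.mem_span_singleton.1 hm'
  refine ⟨v0 + a • v1, fun Q hQ => ?_⟩
  rw [zspan_snoc]
  obtain ⟨Z, hZ⟩ := hg Q hQ
  refine ZLE.exch ?_ hZ
  by_cases hQ1 : Q ∈ {Q : Ideal L | Q.IsPrime ∧ ¬ ∃ Z : Fin k → M,
    ZLE Q (t ⊔ Submodule.span L {v0} ⊔ Submodule.span L {v1} ⊔ Submodule.span L (Set.range Z))}
  · exact hfinal Q hQ hQ1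
  · intro hW
    have : ∃ Z : Fin k → M,
        ZLE Q (t ⊔ Submodule.span L {v0} ⊔ Submodule.span L {v1} ⊔
          Submodule.span L (Set.range Z)) := by
      by_contra hc
      exact hQ1 ⟨hQ, hc⟩
    obtain ⟨Z, hZ⟩ := this
    have h2 : ZLE Q (t ⊔ Submodule.span L {v0 + a • v1} ⊔
        (Submodule.span L {v1} ⊔ Submodule.span L (Set.range Z))) := by
      refine hZ.mono ?_
      refine sup_le (sup_le (sup_le ?_ ?_) ?_) ?_
      · exact le_sup_left.trans le_sup_left
      · rw [Submodule.span_singleton_le_iff_mem]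
        have e : v0 = (v0 + a • v1) - a • v1 := by abel
        refine (congrArg (fun z => z ∈ t ⊔ Submodule.span L {v0 + a • v1} ⊔
          (Submodule.span L {v1} ⊔ Submodule.span L (Set.range Z))) e).mpr ?_
        refine Submodule.sub_mem _ ?_ (Submodule.smul_mem _ _ ?_)
        · exact Submodule.mem_sup_left (Submodule.mem_sup_right (Submodule.mem_span_singleton_self _))
        · exact Submodule.mem_sup_right (Submodule.mem_sup_left (Submodule.mem_span_singleton_self _))
      · exact le_sup_left.trans le_sup_right
      · exact le_sup_right.trans le_sup_right
    have h3 := ZLE.drop hW h2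
    rw [← sup_assoc, ← zspan_snoc, ← zspan_append] at h3
    exact hl Q hQ (j + 1 + k) (by omega) _ h3

theorem zchain [IsNoetherianRing L] [Module.Finite L M] (hd : ringKrullDim L ≤ 1) {r : ℕ}
    (hl : ZLow L M r)
    (hg : ∀ Q : Ideal L, Q.IsPrime → ∃ Z : Fin r → M, ZLE Q (Submodule.span L (Set.range Z))) :
    ∀ j k : ℕ, r = j + (k + 1) → ∃ v : Fin j → M, ∀ Q : Ideal L, Q.IsPrime →
      ∃ Z : Fin (k + 1) → M,
      ZLE Q (Submodule.span L (Set.range v) ⊔ Submodule.span L (Set.range Z)) := by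
  intro j
  induction j with
  | zero =>
    intro k hr
    obtain rfl : r = k + 1 := by omega
    refine ⟨Fin.elim0, fun Q hQ => ?_⟩
    obtain ⟨Z, hZ⟩ := hg Q hQ
    exact ⟨Z, hZ.mono le_sup_right⟩
  | succ j ih =>
    intro k hr
    obtain ⟨v, hv⟩ := ih (k + 1) (by omega)
    obtain ⟨x, hx⟩ := zstepV hd hl (k := k) (by omega) v hv
    exact ⟨_, hx⟩

end FSmod

def zFF {L : Type*} [CommRing L] (e c m p y y' : L) : L :=
  (e ^ 2 * p - (e ^ 2 + c ^ 3 * m) * y') + (-(1 - e)) * p ^ 2 +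
    (m * (c ^ 2 * e + 2 * (1 - e) * c - 3 + e)) * y ^ 2

def zGG {L : Type*} [CommRing L] (e c m p y : L) : L :=
  (c ^ 2 * p - (e * c + (1 - e)) * y) + (e + (1 - e) * c ^ 2) * p ^ 2 +
    (-m * (-3 * c ^ 2 + e * c ^ 4 + 2 * e * c + 2 * (1 - e) * c ^ 3 + (1 - e))) * y ^ 2

theorem zFF_map {L L' : Type*} [CommRing L] [CommRing L'] (φ : L →+* L') (e c m p y y' : L) :
    φ (zFF e c m p y y') = zFF (φ e) (φ c) (φ m) (φ p) (φ y) (φ y') := by simp [zFF, _root_.map_ofNat]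

theorem zGG_map {L L' : Type*} [CommRing L] [CommRing L'] (φ : L →+* L') (e c m p y : L) :
    φ (zGG e c m p y) = zGG (φ e) (φ c) (φ m) (φ p) (φ y) := by simp [zGG, _root_.map_ofNat]

theorem znil {L : Type*} [CommRing L] {N : Ideal L} (hN : N ^ 3 = ⊥) {x : L} (hx : x ∈ N) :
    x ^ 3 = 0 := by
  have := Ideal.pow_mem_pow hx 3
  rwa [hN, Ideal.mem_bot] at this

theorem zsq_le {L : Type*} [CommRing L] {N I : Ideal L} {a b : L}
    (h : ∀ n ∈ N, n ∈ Ideal.span {a, b}) (ha : a ∈ I) (hb : b ^ 2 ∈ I) : N ^ 2 ≤ I := by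
  rw [pow_two, Ideal.mul_le]
  intro x hx y hy
  obtain ⟨x1, x2, rfl⟩ := Ideal.mem_span_pair.1 (h x hx)
  obtain ⟨y1, y2, rfl⟩ := Ideal.mem_span_pair.1 (h y hy)
  have : (x1 * a + x2 * b) * (y1 * a + y2 * b) =
    (x1 * y1 * a + x1 * y2 * b + x2 * b * y1) * a + (x2 * y2) * b ^ 2 := by ring
  rw [this]
  exact I.add_mem (I.mul_mem_left _ ha) (I.mul_mem_left _ hb)

theorem zcomp_e {L : Type*} [CommRing L] (N : Ideal L) (hN : N ^ 3 = ⊥) (e c m p y y' : L)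
    (hp : p ∈ N) (hy' : y' ∈ N) (h1 : e * y = c * y') (h2 : e * (1 - e) = c ^ 4 * m)
    (h3 : ∀ n ∈ N, e * n ∈ Ideal.span {p, y'}) (he : IsUnit e) :
    N ^ 2 ≤ Ideal.span {zFF e c m p y y', zGG e c m p y} := by
  obtain ⟨ei, hei⟩ := he.exists_left_inv
  obtain ⟨n, rfl⟩ : ∃ n, n * e = m := ⟨m * ei, by linear_combination m * hei⟩
  obtain ⟨z, rfl⟩ : ∃ z, e * z = y' := ⟨y' * ei, by linear_combination y' * hei⟩
  obtain rfl : e = 1 - c ^ 4 * n := by linear_combination -ei * h2 + (1 - e - c ^ 4 * n) * hei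
  obtain rfl : y = c * z := by linear_combination ei * h1 - (y - c * z) * hei
  set e := 1 - c ^ 4 * n with he
  have hz : z ∈ N := by
    have : z = ei * (e * z) := by linear_combination - z * hei
    rw [this]; exact N.mul_mem_left _ hy'
  obtain ⟨p2, rfl⟩ : ∃ p2, p2 + (e + c ^ 3 * n) * z = p := ⟨p - (e + c ^ 3 * n) * z, by ring⟩
  have hp2 : p2 ∈ N := by
    have := N.sub_mem hp (N.mul_mem_left (e + c ^ 3 * n) hz)
    rwa [add_sub_cancel_right] at this
  set F := zFF e c (n * e) (p2 + (e + c ^ 3 * n) * z) (c * z) (e * z) with hF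
  set G := zGG e c (n * e) (p2 + (e + c ^ 3 * n) * z) (c * z) with hG
  set I := Ideal.span {F, G}
  have hFI : F ∈ I := Ideal.subset_span (by simp)
  have hGI : G ∈ I := Ideal.subset_span (by simp)
  set u := e + (1 - e) * c ^ 2 with hu
  have hG2 : G = c ^ 2 * p2 + z ^ 2 + u * p2 * (p2 + 2 * (e + c ^ 3 * n) * z) := by
    rw [hG, hu, he, zGG]; ring
  have hF2 : F = e ^ 2 * p2 + (- c ^ 2 * n * (1 + e)) * z ^ 2 + (-(1 - e)) * p2 *
      (p2 + 2 * (e + c ^ 3 * n) * z) := by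
    rw [hF, he, zFF]; ring
  set ν := (-(1 - e) + c ^ 2 * n * (1 + e) * u) * (p2 + 2 * (e + c ^ 3 * n) * z) with hν
  have hνN : ν ∈ N := N.mul_mem_left _ (N.add_mem hp2 (N.mul_mem_left _ hz))
  have hcomb : p2 * (1 + ν) = F + c ^ 2 * n * (1 + e) * G := by
    rw [hF2, hG2, hν, he]; ring
  have hp2I : p2 ∈ I := by
    have : p2 = (1 - ν + ν ^ 2) * (F + c ^ 2 * n * (1 + e) * G) := by
      rw [← hcomb]; linear_combination -p2 * znil hN hνN
    rw [this]
    exact I.mul_mem_left _ (I.add_mem hFI (I.mul_mem_left _ hGI))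
  have hzI : z ^ 2 ∈ I := by
    have : z ^ 2 = G - (c ^ 2 + u * (p2 + 2 * (e + c ^ 3 * n) * z)) * p2 := by rw [hG2]; ring
    rw [this]
    exact I.sub_mem hGI (I.mul_mem_left _ hp2I)
  refine zsq_le ?_ hp2I hzI
  intro x hx
  obtain ⟨a, b, hab⟩ := Ideal.mem_span_pair.1 (h3 x hx)
  refine Ideal.mem_span_pair.2 ⟨ei * a, ei * (a * (e + c ^ 3 * n) + b * e), ?_⟩
  linear_combination ei * hab + x * hei

theorem zcomp_d {L : Type*} [CommRing L] (N : Ideal L) (hN : N ^ 3 = ⊥) (e c m p y y' : L)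
    (hp : p ∈ N) (hy : y ∈ N) (h1 : e * y = c * y') (h2 : e * (1 - e) = c ^ 4 * m)
    (h3 : ∀ n ∈ N, (1 - e) * n ∈ Ideal.span {p, y}) (he : IsUnit (1 - e)) :
    N ^ 2 ≤ Ideal.span {zFF e c m p y y', zGG e c m p y} := by
  obtain ⟨γ, hγ⟩ := he.exists_left_inv
  obtain ⟨n, rfl⟩ : ∃ n, n * (1 - e) = m := ⟨m * γ, by linear_combination m * hγ⟩
  obtain rfl : e = c ^ 4 * n := by linear_combination γ * h2 - (e - c ^ 4 * n) * hγ
  set e := c ^ 4 * n with he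
  set α := e * c + (1 - e) with hα
  set q := γ * p - c ^ 3 * n * γ * y with hq
  set p1 := c ^ 2 * p - α * y with hp1
  have hqN : q ∈ N := N.sub_mem (N.mul_mem_left _ hp) (N.mul_mem_left _ hy)
  have hp1N : p1 ∈ N := N.sub_mem (N.mul_mem_left _ hp) (N.mul_mem_left _ hy)
  have hpq : p = α * q - c ^ 3 * n * γ * p1 := by
    rw [hq, hp1, hα, he]; rw [he] at hγ; linear_combination (-p) * hγ
  have hyq : y = c ^ 2 * q - γ * p1 := by
    rw [hq, hp1, hα, he]; rw [he] at hγ; linear_combination (-y) * hγ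
  set F := zFF e c (n * (1 - e)) p y y' with hF
  set G := zGG e c (n * (1 - e)) p y with hG
  set I := Ideal.span {F, G}
  have hFI : F ∈ I := Ideal.subset_span (by simp)
  have hGI : G ∈ I := Ideal.subset_span (by simp)
  set u := e + (1 - e) * c ^ 2 with hu
  set x := -(n * (1 - e)) * (-3 * c ^ 2 + e * c ^ 4 + 2 * e * c + 2 * (1 - e) * c ^ 3 + (1 - e)) with hx
  set u2 := -(1 - e) with hu2
  set x2 := (n * (1 - e)) * (c ^ 2 * e + 2 * (1 - e) * c - 3 + e) with hx2
  have i1 : u * α ^ 2 + x * c ^ 4 = c ^ 2 := by rw [hu, hα, hx, he]; ring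
  have i2 : u2 * α ^ 2 + x2 * c ^ 4 = e ^ 2 - 1 := by rw [hu2, hα, hx2, he]; ring
  have hG1 : G = p1 + u * p ^ 2 + x * y ^ 2 := by rw [hG, hp1, zGG]
  have hf0 : e ^ 2 * p - (e ^ 2 + c ^ 3 * (n * (1 - e))) * y' = c ^ 6 * n ^ 2 * p1 := by
    rw [hp1, hα, he]; rw [he] at h1; linear_combination (c ^ 2 * n * (c ^ 5 * n + 1 - c ^ 4 * n)) * h1
  have hF1 : F = c ^ 6 * n ^ 2 * p1 + u2 * p ^ 2 + x2 * y ^ 2 := by rw [hF, zFF, hf0]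
  clear_value F G
  set ν := -2 * u * α * (c ^ 3 * n * γ) * q + u * (c ^ 3 * n * γ) ^ 2 * p1 - 2 * x * c ^ 2 * γ * q +
    x * γ ^ 2 * p1 with hν
  have hG2 : G = p1 * (1 + ν) + c ^ 2 * q ^ 2 := by
    rw [hG1, hν]
    have : u * p ^ 2 + x * y ^ 2 = u * (α * q - c ^ 3 * n * γ * p1) ^ 2 +
      x * (c ^ 2 * q - γ * p1) ^ 2 := by rw [← hpq, ← hyq]
    linear_combination this + q ^ 2 * i1
  set μ := -2 * u2 * α * (c ^ 3 * n * γ) * q + u2 * (c ^ 3 * n * γ) ^ 2 * p1 - 2 * x2 * c ^ 2 * γ * q +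
    x2 * γ ^ 2 * p1 with hμ
  have hF2 : F = c ^ 6 * n ^ 2 * p1 + (e ^ 2 - 1) * q ^ 2 + p1 * μ := by
    rw [hF1, hμ]
    have : u2 * p ^ 2 + x2 * y ^ 2 = u2 * (α * q - c ^ 3 * n * γ * p1) ^ 2 +
      x2 * (c ^ 2 * q - γ * p1) ^ 2 := by rw [← hpq, ← hyq]
    linear_combination this + q ^ 2 * i2
  have hνN : ν ∈ N := by
    rw [hν]
    exact N.add_mem (N.sub_mem (N.add_mem (N.mul_mem_left _ hqN) (N.mul_mem_left _ hp1N))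
      (N.mul_mem_left _ hqN)) (N.mul_mem_left _ hp1N)
  have hμN : μ ∈ N := by
    rw [hμ]
    exact N.add_mem (N.sub_mem (N.add_mem (N.mul_mem_left _ hqN) (N.mul_mem_left _ hp1N))
      (N.mul_mem_left _ hqN)) (N.mul_mem_left _ hp1N)
  clear_value ν μ
  -- F - κ G = -q^2 + p1 (μ - κ ν)
  have hq2 : q ^ 2 = p1 * (μ - c ^ 6 * n ^ 2 * ν) - (F - c ^ 6 * n ^ 2 * G) := by
    rw [hF2, hG2, he]; ring
  set ω := ν + c ^ 2 * (μ - c ^ 6 * n ^ 2 * ν) with hω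
  have hωN : ω ∈ N := N.add_mem hνN (N.mul_mem_left _ (N.sub_mem hμN (N.mul_mem_left _ hνN)))
  have hcomb : p1 * (1 + ω) = G + c ^ 2 * (F - c ^ 6 * n ^ 2 * G) := by
    rw [hω]; linear_combination -c ^ 2 * hq2 - hG2
  have hp1I : p1 ∈ I := by
    have : p1 = (1 - ω + ω ^ 2) * (G + c ^ 2 * (F - c ^ 6 * n ^ 2 * G)) := by
      rw [← hcomb]; linear_combination -p1 * znil hN hωN
    rw [this]
    exact I.mul_mem_left _ (I.add_mem hGI (I.mul_mem_left _ (I.sub_mem hFI (I.mul_mem_left _ hGI))))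
  have hqI : q ^ 2 ∈ I := by
    rw [hq2]
    exact I.sub_mem (I.mul_mem_right _ hp1I) (I.sub_mem hFI (I.mul_mem_left _ hGI))
  refine zsq_le ?_ hp1I hqI
  intro x hx
  obtain ⟨a, b, hab⟩ := Ideal.mem_span_pair.1 (h3 x hx)
  refine Ideal.mem_span_pair.2 ⟨γ * (- a * c ^ 3 * n * γ - b * γ), γ * (a * α + b * c ^ 2), ?_⟩
  linear_combination γ * hab + x * hγ - γ * a * hpq - γ * b * hyq

theorem zcomp {L : Type*} [CommRing L] (N : Ideal L) (hN : N ^ 3 = ⊥) (e c m p y y' : L)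
    (hp : p ∈ N) (hy : y ∈ N) (hy' : y' ∈ N) (h1 : e * y = c * y')
    (h2 : e * (1 - e) = c ^ 4 * m)
    (h3 : ∀ n ∈ N, e * n ∈ Ideal.span {p, y'})
    (h4 : ∀ n ∈ N, (1 - e) * n ∈ Ideal.span {p, y}) :
    N ^ 2 ≤ Ideal.span {zFF e c m p y y', zGG e c m p y} := by
  refine Ideal.le_of_localization_maximal fun P hP => ?_
  set φ := algebraMap L (Localization.AtPrime P) with hφ
  have hmapspan : ∀ (a : L) (T : Set L), (∀ n ∈ N, a * n ∈ Ideal.span T) →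
      ∀ n ∈ N.map φ, φ a * n ∈ Ideal.span (φ '' T) := by
    intro a T h n hn
    rw [← Ideal.map_span]
    have : Ideal.span {φ a} * N.map φ ≤ (Ideal.span T).map φ := by
      rw [← Set.image_singleton, ← Ideal.map_span, ← Ideal.map_mul]
      refine Ideal.map_mono ?_
      rw [Ideal.span_singleton_mul_le_iff]
      exact h
    exact this (Ideal.mul_mem_mul (Ideal.mem_span_singleton_self _) hn)
  have hN' : (N.map φ) ^ 3 = ⊥ := by rw [← Ideal.map_pow, hN, Ideal.map_bot]
  have e1 : φ (zFF e c m p y y') = zFF (φ e) (φ c) (φ m) (φ p) (φ y) (φ y') := zFF_map φ _ _ _ _ _ _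
  have e2 : φ (zGG e c m p y) = zGG (φ e) (φ c) (φ m) (φ p) (φ y) := zGG_map φ _ _ _ _ _
  rw [Ideal.map_pow, Ideal.map_span, Set.image_pair, e1, e2]
  have k1 : φ e * φ y = φ c * φ y' := by rw [← map_mul, h1, map_mul]
  have k2 : φ e * (1 - φ e) = φ c ^ 4 * φ m := by
    have := congrArg φ h2
    simpa using this
  have k3 := hmapspan _ _ h3
  have k4 := hmapspan _ _ h4
  rw [Set.image_pair] at k3 k4
  rw [map_sub, map_one] at k4
  rcases IsLocalRing.isUnit_or_isUnit_one_sub_self (φ e) with h | h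
  · exact zcomp_e _ hN' _ _ _ _ _ _ (Ideal.mem_map_of_mem _ hp) (Ideal.mem_map_of_mem _ hy') k1 k2 k3 h
  · exact zcomp_d _ hN' _ _ _ _ _ _ (Ideal.mem_map_of_mem _ hp) (Ideal.mem_map_of_mem _ hy) k1 k2 k4 h

theorem zfs_alg {L : Type*} [CommRing L] (N : Ideal L) (hN : N ^ 3 = ⊥) (e c m a p y y' : L)
    (hp : p ∈ N) (hy : y ∈ N) (hy' : y' ∈ N) (h1 : e * y = c * y' + a * p)
    (h2 : e * (1 - e) = c ^ 4 * m)
    (h3 : ∀ n ∈ N, e * n ∈ Ideal.span {p, y'})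
    (h4 : ∀ n ∈ N, (1 - e) * n ∈ Ideal.span {p, y}) :
    ∃ F G, F ∈ N ∧ G ∈ N ∧ N ^ 2 ≤ Ideal.span {F, G} := by
  have hys : y - a * p ∈ N := N.sub_mem hy (N.mul_mem_left _ hp)
  have hys' : (3 - 2 * e) * (e * y' + c ^ 3 * m * a * p) ∈ N :=
    N.mul_mem_left _ (N.add_mem (N.mul_mem_left _ hy') (N.mul_mem_left _ hp))
  refine ⟨_, _, ?_, ?_, zcomp N hN (e ^ 2 * (3 - 2 * e)) c (c ^ 4 * m ^ 2 * (3 - 2 * e) * (1 + 2 * e))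
    p (y - a * p) ((3 - 2 * e) * (e * y' + c ^ 3 * m * a * p)) hp hys hys' ?_ ?_ ?_ ?_⟩
  · unfold zFF
    exact N.add_mem (N.add_mem (N.sub_mem (N.mul_mem_left _ hp) (N.mul_mem_left _ hys'))
      (N.mul_mem_left _ (N.pow_mem_of_mem hp 2 (by norm_num))))
      (N.mul_mem_left _ (N.pow_mem_of_mem hys 2 (by norm_num)))
  · unfold zGG
    exact N.add_mem (N.add_mem (N.sub_mem (N.mul_mem_left _ hp) (N.mul_mem_left _ hys))
      (N.mul_mem_left _ (N.pow_mem_of_mem hp 2 (by norm_num))))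
      (N.mul_mem_left _ (N.pow_mem_of_mem hys 2 (by norm_num)))
  · linear_combination (3 - 2 * e) * e * h1 + (3 - 2 * e) * a * p * h2
  · linear_combination (3 - 2 * e) * (1 + 2 * e) * (e * (1 - e) + c ^ 4 * m) * h2
  · intro n hn
    obtain ⟨α, β, h⟩ := Ideal.mem_span_pair.1 (h3 n hn)
    refine Ideal.mem_span_pair.2 ⟨e * (3 - 2 * e) * α - β * (3 - 2 * e) * c ^ 3 * m * a, β, ?_⟩
    linear_combination e * (3 - 2 * e) * h
  · intro n hn
    obtain ⟨α, β, h⟩ := Ideal.mem_span_pair.1 (h4 n hn)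
    refine Ideal.mem_span_pair.2 ⟨(1 - e) * (1 + 2 * e) * (α + β * a), (1 - e) * (1 + 2 * e) * β, ?_⟩
    linear_combination (1 - e) * (1 + 2 * e) * h

def zAnn {L M : Type*} [CommRing L] [AddCommGroup M] [Module L M] (t : Submodule L M) : Ideal L where
  carrier := {h | ∀ m : M, h • m ∈ t}
  add_mem' := fun ha hb m => by rw [add_smul]; exact t.add_mem (ha m) (hb m)
  zero_mem' := fun m => by simp
  smul_mem' := fun c a ha m => by rw [smul_eq_mul, mul_smul]; exact t.smul_mem _ (ha m)

theorem ZLE.not_ann {L M : Type*} [CommRing L] [AddCommGroup M] [Module L M] [Module.Finite L M]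
    {Q : Ideal L} [Q.IsPrime] {t : Submodule L M} (h : ZLE Q t) : ¬ zAnn t ≤ Q := by
  intro hle
  obtain ⟨u, hu, h⟩ := h.unif
  exact hu (hle h)

theorem zfs_mod {L M : Type*} [CommRing L] [IsNoetherianRing L] [AddCommGroup M] [Module L M]
    [Module.Finite L M] (hd : ringKrullDim L ≤ 1) (s : ℕ) (hl : ZLow L M (s + 2))
    (hg : ∀ Q : Ideal L, Q.IsPrime → ∃ Z : Fin (s + 2) → M, ZLE Q (Submodule.span L (Set.range Z))) :
    ∃ (w : Fin s → M) (p y y' : M) (e c m a : L) (ω : M), ω ∈ Submodule.span L (Set.range w) ∧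
      e • y = c • y' + a • p + ω ∧ e * (1 - e) = c ^ 4 * m ∧
      (∀ n : M, e • n ∈ Submodule.span L (Set.range w) ⊔ Submodule.span L {p} ⊔ Submodule.span L {y'}) ∧
      (∀ n : M, (1 - e) • n ∈
        Submodule.span L (Set.range w) ⊔ Submodule.span L {p} ⊔ Submodule.span L {y}) := by
  classical
  obtain ⟨v, hv⟩ := zchain hd hl hg (s + 1) 0 (by omega)
  set t := Submodule.span L (Set.range v) with ht
  have hmf : (minimalPrimes L).Finite := minimalPrimes.finite_of_isNoetherianRing L
  have hmp : ∀ P ∈ minimalPrimes L, P.IsPrime := fun P hP => hP.1.1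
  have hex : ∀ (Q : Ideal L) (hQ : Q.IsPrime) (x : M), x ∉ zW Q t →
      ZLE Q (t ⊔ Submodule.span L {x}) := by
    intro Q hQ x hx
    obtain ⟨Z, hZ⟩ := hv Q hQ
    obtain ⟨Z', hZ'⟩ := ZLE.exch hx hZ
    refine hZ'.mono (sup_le le_rfl ?_)
    rw [Submodule.span_le]
    rintro _ ⟨i, _⟩
    exact i.elim0
  obtain ⟨y, -, hy⟩ := zexists_avoid (minimalPrimes L) hmf hmp (fun _ => t) ⊤ 0
    (fun Q hQ _ => Or.inr (hl.not_top Q (by omega) v))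
  simp only [zero_add] at hy
  have hfin := zz_finite_of_dim_le_one hd (zAnn (t ⊔ Submodule.span L {y})) (fun P hP => by
    have := hmp P hP
    exact (hex P this y (hy P this hP)).not_ann)
  obtain ⟨y', -, hy'⟩ := zexists_avoid _ hfin (fun Q hQ => hQ.1) (fun _ => t) ⊤ 0
    (fun Q hQ _ => Or.inr (hl.not_top Q (by omega) v))
  simp only [zero_add] at hy'
  have htop : zAnn (t ⊔ Submodule.span L {y}) ⊔ zAnn (t ⊔ Submodule.span L {y'}) = ⊤ := by
    by_contra hne
    obtain ⟨Q, hQ, hle⟩ := Ideal.exists_le_maximal _ hne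
    have hQp := hQ.isPrime
    exact (hex Q hQp y' (hy' Q hQp ⟨hQp, le_sup_left.trans hle⟩)).not_ann (le_sup_right.trans hle)
  obtain ⟨δ, hδ, e, he, hδe⟩ := Submodule.mem_sup.1 ((Ideal.eq_top_iff_one _).1 htop)
  obtain ⟨τ, hτ, z, hz, hey⟩ := Submodule.mem_sup.1 (he y)
  obtain ⟨c, rfl⟩ := Submodule.mem_span_singleton.1 hz
  have hrad : e * δ ∈ (Ideal.span {c}).radical := by
    rw [Ideal.radical_eq_sInf, Ideal.mem_sInf]
    rintro Q ⟨hcQ, hQ⟩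
    by_contra hed
    have hc : c ∈ Q := hcQ (Ideal.mem_span_singleton_self c)
    have heQ : e ∉ Q := fun h => hed (Q.mul_mem_right _ h)
    have hδQ : δ ∉ Q := fun h => hed (Q.mul_mem_left _ h)
    have h1 : ZLE Q (t ⊔ Submodule.span L {y} ⊔ ⊥) := fun n => ⟨δ, hδQ, by simpa using hδ n⟩
    have h2 : y ∈ zW Q t := ⟨e, heQ, by
      rw [← hey]
      exact Submodule.add_mem _ (Submodule.mem_sup_right hτ)
        (Submodule.mem_sup_left (Submodule.smul_mem_smul hc trivial))⟩
    have h3 := ZLE.drop h2 h1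
    rw [sup_bot_eq] at h3
    exact hl Q hQ (s + 1) (by omega) v h3
  obtain ⟨k, hk⟩ := hrad
  obtain ⟨m0, hm0⟩ := Ideal.mem_span_singleton'.1 hk
  obtain ⟨σ', σ, hσ⟩ : IsCoprime (δ ^ (4 * (k + 1))) (e ^ (4 * (k + 1))) :=
    IsCoprime.pow ⟨1, 1, by simpa using hδe⟩
  have hv' : v = Fin.snoc (Fin.init v) (v (Fin.last s)) := (Fin.snoc_init_self v).symm
  have htt : t = Submodule.span L (Set.range (Fin.init v : Fin s → M)) ⊔
      Submodule.span L {v (Fin.last s)} := by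
    rw [ht]
    conv_lhs => rw [hv']
    exact zspan_snoc _ _
  set K := 4 * k + 3 with hK
  have hK1 : 4 * (k + 1) = K + 1 := by omega
  have hτ' : (e ^ K * σ) • τ ∈ t := t.smul_mem _ hτ
  rw [htt] at hτ'
  obtain ⟨ω, hω, ap, hap, e1⟩ := Submodule.mem_sup.1 hτ'
  obtain ⟨a, rfl⟩ := Submodule.mem_span_singleton.1 hap
  have h1e : 1 - e ^ (K + 1) * σ = δ ^ (K + 1) * σ' := by
    rw [hK1] at hσ; linear_combination -hσ
  refine ⟨Fin.init v, v (Fin.last s), y, (e ^ K * σ) • y', e ^ (K + 1) * σ, c,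
    m0 ^ 4 * (e * δ) ^ 4 * (σ * σ'), a, ω, hω, ?_, ?_, ?_, ?_⟩
  · have : (e ^ (K + 1) * σ) • y = (e ^ K * σ) • (e • y) := by rw [smul_smul]; congr 1; ring
    rw [this, ← hey, smul_add, ← e1, smul_comm c]
    abel
  · rw [h1e]
    have : (e * δ) ^ (K + 1) = c ^ 4 * (m0 ^ 4 * (e * δ) ^ 4) := by
      have h : (e * δ) ^ (K + 1) = ((e * δ) ^ k) ^ 4 * (e * δ) ^ 4 := by
        rw [← pow_mul, ← pow_add]; congr 1; omega
      rw [h, ← hm0]; ring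
    calc _ = (e * δ) ^ (K + 1) * (σ * σ') := by rw [mul_pow]; ring
      _ = _ := by rw [this]; ring
  · intro n
    rw [← htt]
    have : (e ^ (K + 1) * σ) • n = (e ^ K * σ) • (e • n) := by rw [smul_smul]; congr 1; ring
    rw [this]
    obtain ⟨x, hx, z, hz, e2⟩ := Submodule.mem_sup.1 (he n)
    obtain ⟨b, rfl⟩ := Submodule.mem_span_singleton.1 hz
    rw [← e2, smul_add, smul_comm _ b]
    exact Submodule.add_mem _ (Submodule.mem_sup_left (t.smul_mem _ hx))
      (Submodule.mem_sup_right (Submodule.smul_mem _ _ (Submodule.mem_span_singleton_self _)))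
  · intro n
    rw [← htt, h1e]
    have : (δ ^ (K + 1) * σ') • n = (δ ^ K * σ') • (δ • n) := by rw [smul_smul]; congr 1; ring
    rw [this]
    exact Submodule.smul_mem _ _ (hδ n)

/-- Ferrand–Szpiro step in `Λ = A / I ^ 3`. -/
theorem zFS {L : Type*} [CommRing L] [IsNoetherianRing L] (hd : ringKrullDim L ≤ 1) (N : Ideal L)
    (hN : N ^ 3 = ⊥) (s : ℕ) (hl : ZLow L N (s + 2))
    (hg : ∀ Q : Ideal L, Q.IsPrime → ∃ Z : Fin (s + 2) → N, ZLE Q (Submodule.span L (Set.range Z))) :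
    ∃ g : Fin (s + 2) → L, (∀ i, g i ∈ N) ∧ N ^ 2 ≤ Ideal.span (Set.range g) := by
  have : Module.Finite L N := Module.Finite.of_fg (IsNoetherian.noetherian N)
  obtain ⟨w, p, y, y', e, c, m, a, ω, hω, h1, h2, h3, h4⟩ := zfs_mod hd s hl hg
  set Wd : Ideal L := Ideal.span (Set.range fun i => (w i : L)) with hWd
  set φ := Ideal.Quotient.mk Wd with hφ
  have hsub : ∀ x ∈ Submodule.span L (Set.range w), φ (x : L) = 0 := by
    intro x hx
    rw [hφ, Ideal.Quotient.eq_zero_iff_mem, hWd]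
    have := Submodule.mem_map_of_mem (f := N.subtype) hx
    rw [Submodule.map_span, ← Set.range_comp] at this
    exact this
  have hspan : ∀ (b : L) (z : N), (∀ n : N, b • n ∈ Submodule.span L (Set.range w) ⊔
      Submodule.span L {p} ⊔ Submodule.span L {z}) →
      ∀ n ∈ N.map φ, φ b * n ∈ Ideal.span {φ p, φ z} := by
    intro b z h n hn
    obtain ⟨n, hn0, rfl⟩ := (Ideal.mem_map_iff_of_surjective φ Ideal.Quotient.mk_surjective).1 hn
    obtain ⟨x, hx, z1, hz1, e1⟩ := Submodule.mem_sup.1 (h ⟨n, hn0⟩)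
    obtain ⟨x1, hx1, x2, hx2, e2⟩ := Submodule.mem_sup.1 hx
    obtain ⟨b1, rfl⟩ := Submodule.mem_span_singleton.1 hz1
    obtain ⟨b2, rfl⟩ := Submodule.mem_span_singleton.1 hx2
    rw [← e2] at e1
    have e3 := congrArg (fun x : N => φ (x : L)) e1
    simp only [Submodule.coe_add, Submodule.coe_smul, smul_eq_mul, map_add, map_mul,
      hsub x1 hx1, zero_add] at e3
    rw [← e3]
    exact Ideal.mem_span_pair.2 ⟨_, _, rfl⟩
  have k1 : φ e * φ y = φ c * φ y' + φ a * φ p := by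
    have e3 := congrArg (fun x : N => φ (x : L)) h1
    simpa only [Submodule.coe_add, Submodule.coe_smul, smul_eq_mul, map_add, map_mul,
      hsub ω hω, add_zero] using e3
  have k2 : φ e * (1 - φ e) = φ c ^ 4 * φ m := by
    have := congrArg φ h2
    simpa using this
  have hN' : (N.map φ) ^ 3 = ⊥ := by rw [← Ideal.map_pow, hN, Ideal.map_bot]
  have k4 := hspan _ _ h4
  rw [map_sub, map_one] at k4
  obtain ⟨F', G', hF', hG', hle⟩ := zfs_alg (N.map φ) hN' (φ e) (φ c) (φ m) (φ a) (φ p) (φ y) (φ y')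
    (Ideal.mem_map_of_mem _ p.2) (Ideal.mem_map_of_mem _ y.2) (Ideal.mem_map_of_mem _ y'.2)
    k1 k2 (hspan _ _ h3) k4
  obtain ⟨F, hF, rfl⟩ := (Ideal.mem_map_iff_of_surjective φ Ideal.Quotient.mk_surjective).1 hF'
  obtain ⟨G, hG, rfl⟩ := (Ideal.mem_map_iff_of_surjective φ Ideal.Quotient.mk_surjective).1 hG'
  refine ⟨Fin.snoc (Fin.snoc (fun i => (w i : L)) F : Fin (s + 1) → L) G, ?_, ?_⟩
  · intro i
    induction i using Fin.lastCases with
    | last => simpa using hG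
    | cast i =>
      induction i using Fin.lastCases with
      | last => simpa using hF
      | cast i => simp
  · rw [Ideal.span, zspan_snoc, zspan_snoc]
    rw [← Set.image_pair, ← Ideal.map_span, ← Ideal.map_pow, Ideal.map_le_iff_le_comap,
      Ideal.comap_map_of_surjective φ Ideal.Quotient.mk_surjective] at hle
    intro x hx
    have hx2 := hle hx
    rw [← RingHom.ker_eq_comap_bot, hφ, Ideal.mk_ker] at hx2
    have : Ideal.span {F, G} ⊔ Wd = Wd ⊔ Ideal.span {F} ⊔ Ideal.span {G} := by
      rw [Ideal.span_insert, sup_comm, sup_assoc]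
    rw [this] at hx2
    exact hx2

theorem zFS_A {A : Type*} [CommRing A] [IsNoetherianRing A] (I : Ideal A) (s : ℕ)
    (hgen : ∀ (Q : Ideal A) (hQ : Q.IsPrime), I ≤ Q → ∃ a : Fin (s + 2) → Localization.AtPrime Q,
      Ideal.span (Set.range a) = I.map (algebraMap A (Localization.AtPrime Q)))
    (hht : ∀ (Q : Ideal A), Q.IsPrime → I ≤ Q → ((s + 2 : ℕ) : ℕ∞) ≤ Q.height)
    (hd : ringKrullDim (A ⧸ I) ≤ 1) :
    ∃ g : Fin (s + 2) → A, (∀ i, g i ∈ I) ∧ ∃ u ∈ I, ∀ x ∈ I ^ 2,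
      (1 - u) * x ∈ Ideal.span (Set.range g) := by
  set φ := Ideal.Quotient.mk (I ^ 3) with hφ
  have hφs : Function.Surjective φ := Ideal.Quotient.mk_surjective
  set N := I.map φ with hNdef
  have hN : N ^ 3 = ⊥ := by rw [hNdef, ← Ideal.map_pow, hφ, Ideal.map_quotient_self]
  have hdL : ringKrullDim (A ⧸ I ^ 3) ≤ 1 := by
    rw [ringKrullDim_quotient] at hd ⊢
    rwa [PrimeSpectrum.zeroLocus_pow _ (by norm_num : (3 : ℕ) ≠ 0)]
  have hq : ∀ Q : Ideal (A ⧸ I ^ 3), Q.IsPrime → I ≤ Q.comap φ := by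
    intro Q hQ x hx
    refine hQ.mem_of_pow_mem 3 ?_
    rw [← map_pow, (Ideal.Quotient.eq_zero_iff_mem).2 (Ideal.pow_mem_pow hx 3)]
    exact Q.zero_mem
  have hlow : ZLow (A ⧸ I ^ 3) N (s + 2) := by
    intro Q hQ k hk Z hZ
    have hqp : (Q.comap φ).IsPrime := Ideal.IsPrime.comap φ
    obtain ⟨P, hP, hPq⟩ := Ideal.exists_minimalPrimes_le (hq Q hQ)
    have hPp : P.IsPrime := hP.1.1
    have hIP : I ≤ P := hP.1.2
    have hz : ∀ i, ∃ z ∈ I, φ z = Z i := fun i =>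
      (Ideal.mem_map_iff_of_surjective φ hφs).1 (Z i).2
    choose z hzI hz using hz
    have : Module.Finite A I := Module.Finite.of_fg (IsNoetherian.noetherian I)
    have hle : ZLE P (Submodule.span A (Set.range fun i => (⟨z i, hzI i⟩ : I))) := by
      refine ZLE.nak fun a => ?_
      obtain ⟨u', hu', hua⟩ := hZ ⟨φ a, Ideal.mem_map_of_mem _ a.2⟩
      obtain ⟨u, rfl⟩ := hφs u'
      refine ⟨u, fun h => hu' (hPq h), ?_⟩
      obtain ⟨c', hc'⟩ := (Submodule.mem_span_range_iff_exists_fun _).1 hua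
      choose c hc using fun i => hφs (c' i)
      have e1 := congrArg (fun x : N => (x : A ⧸ I ^ 3)) hc'
      simp only [Submodule.coe_sum, Submodule.coe_smul, smul_eq_mul, ← hz, ← hc,
        ← map_mul, ← map_sum] at e1
      rw [hφ, Ideal.Quotient.eq] at e1
      have e2 : (u • a : I) = ∑ i, c i • (⟨z i, hzI i⟩ : I) + (u • a - ∑ i, c i • (⟨z i, hzI i⟩ : I)) := by
        abel
      rw [e2]
      refine Submodule.add_mem _ (Submodule.mem_sup_right ?_) (Submodule.mem_sup_left ?_)
      · exact (Submodule.mem_span_range_iff_exists_fun _).2 ⟨c, rfl⟩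
      · have e3 : ((u • a - ∑ i, c i • (⟨z i, hzI i⟩ : I) : I) : A) ∈ P • I := by
          have h3 : I ^ 3 ≤ P • I := by
            rw [pow_succ, smul_eq_mul]
            exact Ideal.mul_mono ((Ideal.pow_le_self (by norm_num)).trans hIP) le_rfl
          apply h3
          have := (I ^ 3).neg_mem e1
          rw [neg_sub] at this
          simpa using this
        have e4 : P • I = (P • (⊤ : Submodule A I)).map I.subtype := by
          rw [Submodule.map_smul'']; simp
        rw [e4] at e3
        obtain ⟨x, hx, hxe⟩ := e3
        rwa [← Subtype.ext_iff.2 hxe]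
    have hmin : P ∈ (Ideal.span (Set.range z)).minimalPrimes := by
      refine ⟨⟨hPp, ?_⟩, ?_⟩
      · rw [Ideal.span_le]; rintro _ ⟨i, rfl⟩; exact hIP (hzI i)
      · rintro P' ⟨hP', hzP'⟩ hP'P
        refine hP.2 ⟨hP', ?_⟩ hP'P
        intro a ha
        obtain ⟨u, hu, hua⟩ := hle ⟨a, ha⟩
        have h2 := Submodule.mem_map_of_mem (f := I.subtype) hua
        rw [Submodule.map_span, ← Set.range_comp] at h2
        have h3 : u * a ∈ P' := hzP' h2
        exact (hP'.mem_or_mem h3).resolve_left fun h => hu (hP'P h)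
    have h1 := hht P hPp hIP
    have h2 := Ideal.height_le_spanRank_toENat_of_mem_minimalPrimes _ _ hmin
    have h3 : Submodule.spanRank (Ideal.span (Set.range z)) ≤ (k : Cardinal) := by
      refine (Submodule.spanRank_span_le_card _).trans ?_
      have := Cardinal.mk_range_le_lift (f := z)
      simpa using this
    have h4 := Cardinal.toENat.monotone' h3
    have h5 : ((s + 2 : ℕ) : ℕ∞) ≤ (k : ℕ∞) := h1.trans (h2.trans (by simpa using h4))
    have := Nat.cast_le.1 h5
    omega
  have hgenL : ∀ Q : Ideal (A ⧸ I ^ 3), Q.IsPrime → ∃ Z : Fin (s + 2) → N,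
      ZLE Q (Submodule.span (A ⧸ I ^ 3) (Set.range Z)) := by
    intro Q hQ
    have hqp : (Q.comap φ).IsPrime := Ideal.IsPrime.comap φ
    obtain ⟨a, ha⟩ := hgen (Q.comap φ) hqp (hq Q hQ)
    have hx : ∀ i, ∃ x ∈ I, ∃ w : (Q.comap φ).primeCompl, a i * algebraMap A (Localization.AtPrime (Q.comap φ)) w =
        algebraMap A (Localization.AtPrime (Q.comap φ)) x := by
      intro i
      have : a i ∈ I.map (algebraMap A (Localization.AtPrime (Q.comap φ))) := by
        rw [← ha]; exact Ideal.subset_span ⟨i, rfl⟩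
      obtain ⟨⟨x, w⟩, h⟩ := (IsLocalization.mem_map_algebraMap_iff (Q.comap φ).primeCompl _).1 this
      exact ⟨x, x.2, w, h⟩
    choose x hxI w hw using hx
    refine ⟨fun i => ⟨φ (x i), Ideal.mem_map_of_mem _ (hxI i)⟩, fun n => ?_⟩
    obtain ⟨b, hb, hbn⟩ := (Ideal.mem_map_iff_of_surjective φ hφs).1 n.2
    have h1 : algebraMap A (Localization.AtPrime (Q.comap φ)) b ∈
        (Ideal.span (Set.range x)).map (algebraMap A (Localization.AtPrime (Q.comap φ))) := by
      have : algebraMap A (Localization.AtPrime (Q.comap φ)) b ∈ Ideal.span (Set.range a) := by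
        rw [ha]; exact Ideal.mem_map_of_mem _ hb
      refine (Ideal.span_le.2 ?_) this
      rintro _ ⟨i, rfl⟩
      have hu := IsLocalization.map_units (Localization.AtPrime (Q.comap φ)) (w i)
      have h2 : a i * algebraMap A (Localization.AtPrime (Q.comap φ)) (w i) ∈
        (Ideal.span (Set.range x)).map (algebraMap A (Localization.AtPrime (Q.comap φ))) := by
        rw [hw]; exact Ideal.mem_map_of_mem _ (Ideal.subset_span ⟨i, rfl⟩)
      exact (Ideal.mul_unit_mem_iff_mem _ hu).1 h2
    rw [IsLocalization.algebraMap_mem_map_algebraMap_iff (Q.comap φ).primeCompl] at h1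
    obtain ⟨u, hu, hub⟩ := h1
    obtain ⟨c, hc⟩ := (Submodule.mem_span_range_iff_exists_fun _).1 hub
    refine ⟨φ u, hu, (Submodule.mem_span_range_iff_exists_fun _).2 ⟨fun i => φ (c i), ?_⟩⟩
    apply Subtype.ext
    simp only [Submodule.coe_sum, Submodule.coe_smul, smul_eq_mul, ← hbn, ← map_mul, ← map_sum]
    rw [← hc]
    rfl
  obtain ⟨g', hg', hle⟩ := zFS hdL N hN s hlow hgenL
  have hz : ∀ i, ∃ z ∈ I, φ z = g' i := fun i =>
      (Ideal.mem_map_iff_of_surjective φ hφs).1 (hg' i)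
  choose g hg hgg using hz
  refine ⟨g, hg, ?_⟩
  have hle2 : I ^ 2 ≤ Ideal.span (Set.range g) ⊔ I ^ 3 := by
    intro x hx
    have h1 : φ x ∈ N ^ 2 := by rw [hNdef, ← Ideal.map_pow]; exact Ideal.mem_map_of_mem _ hx
    have h2 := hle h1
    have h3 : Set.range g' = φ '' Set.range g := by
      rw [← Set.range_comp]; congr 1; ext i; simp [hgg]
    rw [h3, ← Ideal.map_span] at h2
    have h4 : x ∈ ((Ideal.span (Set.range g)).map φ).comap φ := h2
    rwa [Ideal.comap_map_of_surjective φ hφs, ← RingHom.ker_eq_comap_bot, hφ, Ideal.mk_ker] at h4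
  set J := Ideal.span (Set.range g) with hJ
  have hnak := Submodule.exists_sub_one_mem_and_smul_eq_zero_of_fg_of_le_smul I
    (Submodule.map J.mkQ (I ^ 2)) ((IsNoetherian.noetherian _).map _) (by
      rw [← Submodule.map_smul'', smul_eq_mul, ← pow_succ']
      rintro _ ⟨x, hx, rfl⟩
      obtain ⟨j, hj, y, hy, rfl⟩ := Submodule.mem_sup.1 (hle2 hx)
      refine ⟨y, hy, ?_⟩
      rw [map_add, (Submodule.Quotient.mk_eq_zero J).2 hj |> fun h => (show J.mkQ j = 0 from h), zero_add])
  obtain ⟨v, hv, hv0⟩ := hnak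
  refine ⟨1 - v, by have := I.neg_mem hv; rwa [neg_sub] at this, fun x hx => ?_⟩
  have := hv0 (J.mkQ x) ⟨x, hx, rfl⟩
  rw [← map_smul] at this
  rw [sub_sub_cancel]
  exact (Submodule.Quotient.mk_eq_zero J).1 this

section pathrel
variable {ι : Type*} [Fintype ι] [DecidableEq ι] {C : Type*} [CommRing C]

/-- Two rows are connected by a path in the special linear group. -/
def ZP (u v : ι → C) : Prop :=
  ∃ M : Matrix ι ι (Polynomial C), M.det = 1 ∧ M.map (Polynomial.evalRingHom 0) = 1 ∧
    v = Matrix.vecMul u (M.map (Polynomial.evalRingHom 1))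

theorem ZP.refl (u : ι → C) : ZP u u :=
  ⟨1, by simp, Matrix.map_one _ (map_zero _) (map_one _), by
    rw [Matrix.map_one _ (map_zero _) (map_one _), Matrix.vecMul_one]⟩

theorem ZP.symm {u v : ι → C} (h : ZP u v) : ZP v u := by
  obtain ⟨M, h1, h2, h3⟩ := h
  refine ⟨M.adjugate, ?_, ?_, ?_⟩
  · rw [Matrix.det_adjugate, h1, one_pow]
  · have := RingHom.map_adjugate (Polynomial.evalRingHom (0 : C)) M
    simp only [RingHom.mapMatrix_apply] at this
    rw [this, h2, Matrix.adjugate_one]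
  · rw [h3, Matrix.vecMul_vecMul, ← Matrix.map_mul, Matrix.mul_adjugate, h1, one_smul,
      Matrix.map_one _ (map_zero _) (map_one _), Matrix.vecMul_one]

theorem ZP.trans {u v w : ι → C} (h : ZP u v) (h' : ZP v w) : ZP u w := by
  obtain ⟨M, h1, h2, h3⟩ := h
  obtain ⟨M', h1', h2', h3'⟩ := h'
  refine ⟨M * M', ?_, ?_, ?_⟩
  · rw [Matrix.det_mul, h1, h1', one_mul]
  · rw [Matrix.map_mul, h2, h2', one_mul]
  · rw [h3', h3, Matrix.vecMul_vecMul, ← Matrix.map_mul]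

theorem ZP.elem (u : ι → C) (j : ι) (α : ι → C) (hα : α j = 0) :
    ZP u (u + Pi.single j (∑ k, α k * u k)) := by
  refine ⟨1 + Matrix.vecMulVec (fun k => Polynomial.C (α k) * Polynomial.X) (Pi.single j 1), ?_, ?_, ?_⟩
  · rw [Matrix.vecMulVec_eq Unit, Matrix.det_one_add_replicateCol_mul_replicateRow]
    simp [hα]
  · ext a b
    by_cases hab : a = b <;> simp [Matrix.one_apply, Matrix.vecMulVec_apply, hab]
  · have : (1 + Matrix.vecMulVec (fun k => Polynomial.C (α k) * Polynomial.X) (Pi.single j 1) :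
        Matrix ι ι (Polynomial C)).map (Polynomial.evalRingHom 1) =
        1 + Matrix.vecMulVec α (Pi.single j 1) := by
      ext a b
      by_cases hab : a = b <;> by_cases hbj : b = j <;>
        simp [Matrix.one_apply, Matrix.vecMulVec_apply, hab, hbj, apply_ite (Polynomial.eval (1 : C))]
    rw [this, Matrix.vecMul_add, Matrix.vecMul_one]
    congr 1
    ext l
    by_cases hl : l = j
    · subst hl
      simp [Matrix.vecMul, dotProduct, Matrix.vecMulVec_apply, mul_comm]
    · simp [Matrix.vecMul, dotProduct, Matrix.vecMulVec_apply, hl]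

theorem zsuslin_core (f : ι → Polynomial C) (i j : ι) (hij : i ≠ j) (p q : Polynomial C) (c : C)
    (h : p * f i + q * f j = Polynomial.C c) (b β : C) :
    ZP (fun k => (f k).eval b) (fun k => (f k).eval (b + c * β)) := by
  -- polynomial difference quotients
  let D : Polynomial C → Polynomial C := fun g => (Polynomial.taylor b g).divX
  have hD : ∀ g, Polynomial.taylor b g = D g * Polynomial.X + Polynomial.C (g.eval b) := by
    intro g
    conv_lhs => rw [← Polynomial.divX_mul_X_add (Polynomial.taylor b g)]
    simp [D, Polynomial.taylor_coeff_zero]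
  have hc : p.eval b * (f i).eval b + q.eval b * (f j).eval b = c := by
    have := congrArg (Polynomial.eval b) h
    simpa using this
  have hbr : D p * Polynomial.C ((f i).eval b) + D q * Polynomial.C ((f j).eval b) +
      Polynomial.C (p.eval b) * D (f i) + Polynomial.C (q.eval b) * D (f j) +
      Polynomial.X * (D p * D (f i) + D q * D (f j)) = 0 := by
    have h1 := congrArg (Polynomial.taylor b) h
    rw [map_add, Polynomial.taylor_mul, Polynomial.taylor_mul, hD, hD, hD, hD,
      Polynomial.taylor_C] at h1
    have h2 := congrArg (Polynomial.C : C → Polynomial C) hc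
    simp only [map_add, map_mul] at h2
    have h3 : Polynomial.X * (D p * Polynomial.C ((f i).eval b) + D q * Polynomial.C ((f j).eval b) +
      Polynomial.C (p.eval b) * D (f i) + Polynomial.C (q.eval b) * D (f j) +
      Polynomial.X * (D p * D (f i) + D q * D (f j))) = 0 := by
      linear_combination h1 - h2
    exact (Polynomial.isRegular_X.left.mul_left_eq_zero_iff).1 h3
  let ρ : Polynomial C →+* Polynomial C := Polynomial.compRingHom (Polynomial.C (c * β) * Polynomial.X)
  have hρC : ∀ x, ρ (Polynomial.C x) = Polynomial.C x := fun x => by simp [ρ]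
  have hρX : ρ Polynomial.X = Polynomial.C (c * β) * Polynomial.X := by simp [ρ]
  have hbr2 := congrArg ρ hbr
  simp only [map_add, map_mul, hρC, hρX, map_zero] at hbr2
  let pb := Polynomial.C (p.eval b)
  let qb := Polynomial.C (q.eval b)
  let a : ι → Polynomial C := Pi.single i pb + Pi.single j qb
  let a' : ι → Polynomial C := Pi.single i (-Polynomial.C ((f j).eval b)) + Pi.single j (Polynomial.C ((f i).eval b))
  let w : ι → Polynomial C := Pi.single i (-ρ (D q)) + Pi.single j (ρ (D p))
  let w' : ι → Polynomial C := fun k => ρ (D (f k))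
  let s : Polynomial C := Polynomial.C β * Polynomial.X
  let U : Matrix ι (Fin 2) (Polynomial C) := Matrix.of fun k l => ![a k, a' k] l
  let V : Matrix (Fin 2) ι (Polynomial C) := Matrix.of fun l k => s * ![w' k, w k] l
  have hM : ∀ k l, (1 + U * V : Matrix ι ι (Polynomial C)) k l = (1 : Matrix ι ι (Polynomial C)) k l + s * (a k * w' l + a' k * w l) := by
    intro k l
    simp only [Matrix.add_apply, Matrix.mul_apply, Fin.sum_univ_two, U, V, Matrix.of_apply]
    simp
    ring
  have hji : j ≠ i := hij.symm
  have hdot : ∀ (x y : Polynomial C) (z : ι → Polynomial C),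
      ∑ k, z k * (Pi.single i x + Pi.single j y : ι → Polynomial C) k = z i * x + z j * y := by
    intro x y z
    simp [mul_add, Finset.sum_add_distrib, Pi.single_apply]
  refine ⟨1 + U * V, ?_, ?_, ?_⟩
  · rw [Matrix.det_one_add_mul_comm, Matrix.det_fin_two]
    have e : ∀ l m, (V * U) l m = s * ∑ k, ![w' k, w k] l * ![a k, a' k] m := by
      intro l m
      rw [Matrix.mul_apply, Finset.mul_sum]
      refine Finset.sum_congr rfl fun k _ => ?_
      simp only [V, U, Matrix.of_apply]; ring
    simp only [Matrix.add_apply, e, Matrix.one_apply, Matrix.cons_val_zero, Matrix.cons_val_one,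
      a, a', hdot]
    have wi : w i = -ρ (D q) := by simp [w, hij]
    have wj : w j = ρ (D p) := by simp [w, hji]
    simp only [wi, wj, w', pb, qb]
    have h2 := congrArg (Polynomial.C : C → Polynomial C) hc
    simp only [map_add, map_mul] at h2 hbr2
    simp only [s]
    norm_num
    linear_combination (Polynomial.C β * Polynomial.X) * hbr2 + (Polynomial.C β * Polynomial.X) ^ 2 *
      (ρ (D p) * ρ (D (f i)) + ρ (D q) * ρ (D (f j))) * h2
  · ext1 k l
    rw [Matrix.map_apply, hM, map_add, map_mul]
    by_cases hkl : k = l <;> simp [s, Matrix.one_apply, hkl]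
  · ext1 l
    have hM1 : ∀ k, Polynomial.evalRingHom 1 ((1 + U * V : Matrix ι ι (Polynomial C)) k l) =
        (1 : Matrix ι ι C) k l + β * (Polynomial.evalRingHom 1 (a k) * (D (f l)).eval (c * β) +
          Polynomial.evalRingHom 1 (a' k) * Polynomial.evalRingHom 1 (w l)) := by
      intro k
      rw [hM, map_add, map_mul _ s, map_add, map_mul _ (a k), map_mul _ (a' k)]
      have e1 : Polynomial.evalRingHom 1 s = β := by simp [s]
      have e2 : Polynomial.evalRingHom 1 (w' l) = (D (f l)).eval (c * β) := by
        simp [w', ρ, Polynomial.eval_comp]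
      have e3 : Polynomial.evalRingHom 1 ((1 : Matrix ι ι (Polynomial C)) k l) = (1 : Matrix ι ι C) k l := by
        by_cases hkl : k = l <;> simp [Matrix.one_apply, hkl]
      rw [e1, e2, e3]
    simp only [Matrix.vecMul, dotProduct, Matrix.map_apply, hM1]
    have ea : ∀ k, Polynomial.evalRingHom 1 (a k) =
        (Pi.single i (p.eval b) + Pi.single j (q.eval b) : ι → C) k := by
      intro k
      simp only [a, pb, qb, Pi.add_apply, map_add, Pi.single_apply, apply_ite (Polynomial.evalRingHom (1 : C))]
      simp
    have ea' : ∀ k, Polynomial.evalRingHom 1 (a' k) =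
        (Pi.single i (-(f j).eval b) + Pi.single j ((f i).eval b) : ι → C) k := by
      intro k
      simp only [a', Pi.add_apply, map_add, Pi.single_apply, apply_ite (Polynomial.evalRingHom (1 : C))]
      simp
    have hdot' : ∀ (x y : C) (z : ι → C),
      ∑ k, z k * (Pi.single i x + Pi.single j y : ι → C) k = z i * x + z j * y := by
      intro x y z
      simp [mul_add, Finset.sum_add_distrib, Pi.single_apply]
    simp only [ea, ea']
    have e5 : ∑ k, (f k).eval b * ((1 : Matrix ι ι C) k l + β * ((Pi.single i (p.eval b) + Pi.single j (q.eval b) : ι → C) k * (D (f l)).eval (c * β) +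
          (Pi.single i (-(f j).eval b) + Pi.single j ((f i).eval b) : ι → C) k * Polynomial.evalRingHom 1 (w l))) =
        ∑ k, (f k).eval b * (1 : Matrix ι ι C) k l +
        β * (D (f l)).eval (c * β) * ∑ k, (f k).eval b * (Pi.single i (p.eval b) + Pi.single j (q.eval b) : ι → C) k +
        β * Polynomial.evalRingHom 1 (w l) * ∑ k, (f k).eval b * (Pi.single i (-(f j).eval b) + Pi.single j ((f i).eval b) : ι → C) k := by
      rw [Finset.mul_sum, Finset.mul_sum, ← Finset.sum_add_distrib, ← Finset.sum_add_distrib]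
      refine Finset.sum_congr rfl fun k _ => by ring
    rw [e5, hdot', hdot']
    have e6 : ∑ k, (f k).eval b * (1 : Matrix ι ι C) k l = (f l).eval b := by
      simp [Matrix.one_apply]
    have e7 : (f l).eval (b + c * β) = (f l).eval b + c * β * (D (f l)).eval (c * β) := by
      have := congrArg (Polynomial.eval (c * β)) (hD (f l))
      rw [Polynomial.taylor_eval] at this
      rw [add_comm b, this]
      simp; ring
    rw [e6, e7]
    linear_combination (-β * (D (f l)).eval (c * β)) * hc

end pathrel

/-- Localization away from `F`, in elementary terms. -/
def ZA {P A : Type*} [CommRing P] [CommRing A] (ι : P →+* A) (F : P) : Prop :=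
  IsUnit (ι F) ∧ (∀ a, ∃ (n : ℕ) (p : P), ι F ^ n * a = ι p) ∧ (∀ p, ι p = 0 → ∃ n : ℕ, F ^ n * p = 0)

theorem ZA.of_away {P : Type*} (A : Type*) [CommRing P] [CommRing A] [Algebra P A] (F : P)
    [IsLocalization.Away F A] : ZA (algebraMap P A) F := by
  refine ⟨IsLocalization.Away.algebraMap_isUnit F, fun a => ?_, fun p hp => ?_⟩
  · obtain ⟨n, p, h⟩ := IsLocalization.Away.surj F a
    exact ⟨n, p, by rw [mul_comm, h]⟩
  · have : algebraMap P A p = algebraMap P A 0 := by simpa using hp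
    obtain ⟨⟨c, k, hk⟩, hc⟩ := (IsLocalization.eq_iff_exists (Submonoid.powers F) A).1 this
    refine ⟨k, ?_⟩
    have hk' : F ^ k = c := hk
    rw [hk']
    simpa using hc

theorem ZA.toAway {P A : Type*} [CommRing P] [CommRing A] {ι : P →+* A} {F : P} (h : ZA ι F) :
    letI := ι.toAlgebra
    IsLocalization.Away F A := by
  letI := ι.toAlgebra
  obtain ⟨h1, h2, h3⟩ := h
  refine ⟨?_, ?_, ?_⟩
  · rintro ⟨_, n, rfl⟩
    change IsUnit (ι (F ^ n))
    rw [map_pow]; exact h1.pow n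
  · intro z
    obtain ⟨n, p, hp⟩ := h2 z
    refine ⟨⟨p, ⟨F ^ n, n, rfl⟩⟩, ?_⟩
    change z * ι (F ^ n) = ι p
    rw [map_pow, mul_comm, hp]
  · intro x y hxy
    change ι x = ι y at hxy
    obtain ⟨n, hn⟩ := h3 (x - y) (by rw [map_sub, hxy, sub_self])
    exact ⟨⟨F ^ n, n, rfl⟩, by simpa [mul_sub, sub_eq_zero] using hn⟩

theorem ZA.step {A D C : Type*} [CommRing A] [CommRing D] [CommRing C] {ι : A →+* D} {j : A →+* C}
    {s κ : A} (h1 : ZA ι κ) (h2 : ZA j (s * κ)) (ρ : D →+* C) (hρ : ρ.comp ι = j) :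
    (∀ x, ∃ (n : ℕ) (y : D), ρ (ι s) ^ n * x = ρ y) ∧ (∀ y, ρ y = 0 → ∃ n : ℕ, ι s ^ n * y = 0) := by
  have hj : ∀ x, ρ (ι x) = j x := fun x => by rw [← hρ]; rfl
  obtain ⟨w, hw⟩ := h1.1.exists_right_inv
  constructor
  · intro x
    obtain ⟨n, p, hp⟩ := h2.2.1 x
    refine ⟨n, w ^ n * ι p, ?_⟩
    have : ρ w ^ n * ρ (ι κ) ^ n = 1 := by
      rw [← mul_pow, ← map_mul, mul_comm w, hw, map_one, one_pow]
    rw [map_mul, map_pow, hj p, ← hp, ← hj, map_mul, map_mul, mul_pow]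
    linear_combination (-(ρ (ι s) ^ n) * x) * this
  · intro y hy
    obtain ⟨n, p, hp⟩ := h1.2.1 y
    have : j p = 0 := by rw [← hj, ← hp, map_mul, hy, mul_zero]
    obtain ⟨k, hk⟩ := h2.2.2 p this
    refine ⟨k, ?_⟩
    have h3 : ι s ^ k * ι κ ^ k * (ι κ ^ n * y) = 0 := by
      rw [hp, ← mul_pow, ← map_mul, ← map_pow, ← map_mul, hk, map_zero]
    have hu : IsUnit (ι κ ^ (k + n)) := h1.1.pow _
    rw [← hu.mul_right_eq_zero]
    rw [← h3]; ring

theorem ZA.clear {A D : Type*} [CommRing A] [CommRing D] {ι : A →+* D}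
    {κ : A} (h1 : ZA ι κ) (I : Ideal A) (x : A) (hx : ι x ∈ I.map ι) : ∃ n : ℕ, κ ^ n * x ∈ I := by
  letI := ι.toAlgebra
  haveI := h1.toAway
  have := (IsLocalization.algebraMap_mem_map_algebraMap_iff (Submonoid.powers κ) D I x).1 hx
  obtain ⟨_, ⟨n, rfl⟩, h⟩ := this
  exact ⟨n, h⟩

section liftQ
variable {D D' : Type*} [CommRing D] [CommRing D'] (ρ : D →+* D') (s : D)

theorem zlift_poly (hs : ∀ x, ∃ (n : ℕ) (y : D), ρ s ^ n * x = ρ y) (p : Polynomial D') :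
    ∃ (n : ℕ) (q : Polynomial D), q.map ρ = Polynomial.C (ρ s ^ n) * p := by
  induction p using Polynomial.induction_on' with
  | add p q hp hq =>
    obtain ⟨n, p', hp⟩ := hp
    obtain ⟨m, q', hq⟩ := hq
    refine ⟨n + m, Polynomial.C (s ^ m) * p' + Polynomial.C (s ^ n) * q', ?_⟩
    simp only [Polynomial.map_add, Polynomial.map_mul, Polynomial.map_pow, Polynomial.map_C, hp, hq, map_pow, pow_add, map_mul]
    ring
  | monomial k a =>
    obtain ⟨n, y, h⟩ := hs a
    exact ⟨n, Polynomial.monomial k y, by rw [Polynomial.map_monomial, ← h, Polynomial.C_mul_monomial]⟩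

theorem zkill_poly (hi : ∀ y, ρ y = 0 → ∃ n : ℕ, s ^ n * y = 0) (p : Polynomial D) (hp : p.map ρ = 0) :
    ∃ n : ℕ, Polynomial.C (s ^ n) * p = 0 := by
  have : ∀ k, ∃ n : ℕ, s ^ n * p.coeff k = 0 := fun k => hi _ (by rw [← Polynomial.coeff_map, hp, Polynomial.coeff_zero])
  choose n hn using this
  refine ⟨∑ k ∈ p.support, n k, ?_⟩
  ext k
  rw [Polynomial.coeff_C_mul, Polynomial.coeff_zero]
  by_cases hk : k ∈ p.support
  · rw [← Finset.sum_erase_add _ _ hk, pow_add, mul_assoc, hn, mul_zero]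
  · rw [Polynomial.notMem_support_iff.1 hk, mul_zero]

theorem zlemmaQ {ι : Type*} [Fintype ι] [DecidableEq ι]
    (hs : ∀ x, ∃ (n : ℕ) (y : D), ρ s ^ n * x = ρ y) (hi : ∀ y, ρ y = 0 → ∃ n : ℕ, s ^ n * y = 0)
    (M : Matrix ι ι (Polynomial D')) (hM : M.det = 1) (hM0 : M.map (Polynomial.evalRingHom 0) = 1) :
    ∃ (K : ℕ) (N : Matrix ι ι (Polynomial D)), N.det = 1 ∧
      ∀ x : D, (N.map (Polynomial.evalRingHom x)).map ρ = M.map (Polynomial.evalRingHom (ρ (s ^ K * x))) := by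
  have h1 : ∀ k l, ∃ (n : ℕ) (q : Polynomial D), q.map ρ = Polynomial.C (ρ s ^ n) * (M k l).divX :=
    fun k l => zlift_poly ρ s hs _
  choose n q hq using h1
  let K1 := ∑ k, ∑ l, n k l
  have hK : ∀ k l, ∃ q : Polynomial D, q.map ρ = Polynomial.C (ρ s ^ K1) * (M k l).divX := by
    intro k l
    have : n k l ≤ K1 := by
      refine le_trans ?_ (Finset.single_le_sum (f := fun k => ∑ l, n k l) (fun _ _ => Nat.zero_le _) (Finset.mem_univ k))
      exact Finset.single_le_sum (f := fun l => n k l) (fun _ _ => Nat.zero_le _) (Finset.mem_univ l)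
    refine ⟨Polynomial.C (s ^ (K1 - n k l)) * q k l, ?_⟩
    rw [Polynomial.map_mul, Polynomial.map_C, hq, ← mul_assoc, ← Polynomial.C_mul, map_pow, ← pow_add,
      Nat.sub_add_cancel this]
  choose q' hq' using hK
  have hM0' : ∀ k l, (M k l).coeff 0 = (1 : Matrix ι ι D') k l := by
    intro k l
    rw [← hM0, Matrix.map_apply, Polynomial.coe_evalRingHom, Polynomial.coeff_zero_eq_eval_zero]
  let cm : D → Polynomial D →+* Polynomial D := fun a => Polynomial.compRingHom (Polynomial.C a * Polynomial.X)
  let cm' : D' → Polynomial D' →+* Polynomial D' := fun a => Polynomial.compRingHom (Polynomial.C a * Polynomial.X)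
  have hcm : ∀ a p, (cm a p).map ρ = cm' (ρ a) (p.map ρ) := by
    intro a p
    simp [cm, cm', Polynomial.map_comp]
  let N1 : Matrix ι ι (Polynomial D) := Matrix.of fun k l =>
    (1 : Matrix ι ι (Polynomial D)) k l + Polynomial.X * cm (s ^ K1) (q' k l)
  have hN1 : N1.map (Polynomial.mapRingHom ρ) = M.map (cm' (ρ (s ^ K1))) := by
    ext1 k l
    have e := Polynomial.divX_mul_X_add (M k l)
    rw [hM0'] at e
    rw [Matrix.map_apply, Matrix.map_apply]
    conv_rhs => rw [← e]
    have e1 : Polynomial.mapRingHom ρ ((1 : Matrix ι ι (Polynomial D)) k l) = cm' (ρ (s ^ K1)) (Polynomial.C ((1 : Matrix ι ι D') k l)) := by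
      by_cases hkl : k = l <;> simp [Matrix.one_apply, hkl, cm']
    have e2 : Polynomial.mapRingHom ρ (cm (s ^ K1) (q' k l)) = Polynomial.C (ρ s ^ K1) * cm' (ρ (s ^ K1)) (M k l).divX := by
      rw [Polynomial.coe_mapRingHom, hcm, hq', map_mul]
      simp [cm']
    have e3 : cm' (ρ (s ^ K1)) Polynomial.X = Polynomial.C (ρ s ^ K1) * Polynomial.X := by simp [cm']
    simp only [N1, Matrix.of_apply]
    rw [map_add, map_mul, e1, e2, map_add, map_mul, e3]
    simp only [Polynomial.coe_mapRingHom, Polynomial.map_X]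
    ring
  have hd1 : N1.det.map ρ = 1 := by
    have := RingHom.map_det (Polynomial.mapRingHom ρ) N1
    rw [RingHom.mapMatrix_apply, hN1, ← RingHom.mapMatrix_apply, ← RingHom.map_det, hM, map_one] at this
    exact this
  have hd0 : N1.det.coeff 0 = 1 := by
    have := RingHom.map_det (Polynomial.evalRingHom (0 : D)) N1
    rw [Polynomial.coeff_zero_eq_eval_zero]
    refine this.trans ?_
    have : (Polynomial.evalRingHom (0 : D)).mapMatrix N1 = 1 := by
      ext1 k l
      by_cases hkl : k = l <;> simp [N1, Matrix.one_apply, hkl]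
    rw [this, Matrix.det_one]
  have hdX := Polynomial.divX_mul_X_add N1.det
  rw [hd0] at hdX
  have he : N1.det.divX.map ρ = 0 := by
    have := congrArg (Polynomial.map ρ) hdX
    rw [hd1] at this
    simp only [Polynomial.map_add, Polynomial.map_mul, Polynomial.map_X, map_one, Polynomial.map_one, add_eq_right] at this
    exact (Polynomial.isRegular_X.right.mul_right_eq_zero_iff).1 this
  obtain ⟨K2, hK2⟩ := zkill_poly ρ s hi _ he
  refine ⟨K1 + K2, N1.map (cm (s ^ K2)), ?_, ?_⟩
  · rw [← RingHom.mapMatrix_apply, ← RingHom.map_det, ← hdX]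
    have h5 := congrArg (cm (s ^ K2)) hK2
    have h6 : cm (s ^ K2) (Polynomial.C (s ^ K2)) = Polynomial.C (s ^ K2) := by simp [cm]
    have h7 : cm (s ^ K2) Polynomial.X = Polynomial.C (s ^ K2) * Polynomial.X := by simp [cm]
    rw [map_mul, h6, map_zero] at h5
    rw [map_add, map_mul, h7, Polynomial.C_1, map_one]
    linear_combination Polynomial.X * h5
  · intro x
    ext1 k l
    simp only [Matrix.map_apply]
    have h8 : ∀ p : Polynomial D, ρ (Polynomial.evalRingHom x p) = (p.map ρ).eval (ρ x) := by
      intro p; simp [Polynomial.eval_map, Polynomial.eval₂_hom]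
    rw [h8, hcm]
    have h9 := congrFun (congrFun hN1 k) l
    rw [Matrix.map_apply, Matrix.map_apply, Polynomial.coe_mapRingHom] at h9
    rw [h9]
    simp only [cm', Polynomial.coe_compRingHom_apply, Polynomial.eval_comp, Polynomial.coe_evalRingHom]
    simp [pow_add, mul_assoc]
end liftQ

section glue
variable {ι : Type*} [Fintype ι] [DecidableEq ι]

theorem zvecMul_mem {D : Type*} [CommRing D] (v : ι → D) (N : Matrix ι ι D) (i : ι) :
    Matrix.vecMul v N i ∈ Ideal.span (Set.range v) := by
  simp only [Matrix.vecMul, dotProduct]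
  exact Ideal.sum_mem _ fun k _ => Ideal.mul_mem_right _ _ (Ideal.subset_span ⟨k, rfl⟩)

theorem zside {A D : Type*} [CommRing A] [CommRing D] {j : A →+* D} {κ : A} (h1 : ZA j κ)
    (g α : ι → A) (a : ι → D) (N : Matrix ι ι D) (hN : N.det = 1)
    (ha : a = Matrix.vecMul (fun i => j (g i)) N) (n : ℕ) (hα : ∀ i, j κ ^ n * a i = j (α i))
    (Q : Ideal A) (hQ : Q.IsPrime) (hκ : κ ∉ Q) : (∀ i, α i ∈ Q) ↔ ∀ i, g i ∈ Q := by
  have key : ∀ (v w : ι → A), (∀ i, j (w i) ∈ Ideal.span (Set.range fun i => j (v i))) → (∀ i, v i ∈ Q) → ∀ i, w i ∈ Q := by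
    intro v w h hv i
    have h2 : j (w i) ∈ (Ideal.span (Set.range v)).map j := by
      rw [Ideal.map_span, ← Set.range_comp]; exact h i
    obtain ⟨k, hk⟩ := h1.clear _ _ h2
    have : κ ^ k * w i ∈ Q := (Ideal.span_le.2 (by rintro _ ⟨i, rfl⟩; exact hv i)) hk
    exact (hQ.mem_or_mem this).resolve_left fun h => hκ (hQ.mem_of_pow_mem _ h)
  have hb : (fun i => j (g i)) = Matrix.vecMul a N.adjugate := by
    rw [ha, Matrix.vecMul_vecMul, Matrix.mul_adjugate, hN, one_smul, Matrix.vecMul_one]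
  constructor
  · refine key α g fun i => ?_
    have h3 : j (g i) = Matrix.vecMul a N.adjugate i := congrFun hb i
    obtain ⟨w, hw⟩ := (h1.1.pow n).exists_left_inv
    have h4 : a = fun i => w * j (α i) := by
      ext i; rw [← hα, ← mul_assoc, hw, one_mul]
    rw [h3]
    refine (Ideal.span_le.2 ?_) (zvecMul_mem a _ i)
    rintro _ ⟨k, rfl⟩
    rw [h4]
    exact Ideal.mul_mem_left _ _ (Ideal.subset_span ⟨k, rfl⟩)
  · refine key g α fun i => ?_
    rw [← hα, ha]
    exact Ideal.mul_mem_left _ _ (zvecMul_mem _ _ i)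

theorem zunif {A D : Type*} [CommRing A] [CommRing D] {j : A →+* D} {κ : A} (h1 : ZA j κ)
    (a : ι → D) : ∃ (n : ℕ) (α : ι → A), ∀ i, j κ ^ n * a i = j (α i) := by
  have := fun i => h1.2.1 (a i)
  choose n p hp using this
  refine ⟨∑ i, n i, fun i => κ ^ (∑ i, n i - n i) * p i, fun i => ?_⟩
  have : n i ≤ ∑ i, n i := Finset.single_le_sum (f := n) (fun _ _ => Nat.zero_le _) (Finset.mem_univ i)
  rw [map_mul, ← hp, map_pow, ← mul_assoc, ← pow_add, Nat.sub_add_cancel this]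

theorem zunif0 {A D : Type*} [CommRing A] [CommRing D] {j : A →+* D} {κ : A} (h1 : ZA j κ)
    (p : ι → A) (hp : ∀ i, j (p i) = 0) : ∃ (n : ℕ), ∀ i, κ ^ n * p i = 0 := by
  have := fun i => h1.2.2 (p i) (hp i)
  choose n hn using this
  refine ⟨∑ i, n i, fun i => ?_⟩
  have : n i ≤ ∑ i, n i := Finset.single_le_sum (f := n) (fun _ _ => Nat.zero_le _) (Finset.mem_univ i)
  rw [← Nat.sub_add_cancel this, pow_add, mul_assoc, hn, mul_zero]

theorem zglue {A C : Type*} [CommRing A] [CommRing C] (j : A →+* C) (s κ : A) (hsk : s + κ = 1)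
    (hj : ZA j (s * κ)) (g u : ι → A) (hp : ZP (fun i => j (g i)) (fun i => j (u i))) :
    ∃ G : ι → A, ∀ (Q : Ideal A) (_ : Q.IsPrime),
      (κ ∉ Q → ((∀ i, G i ∈ Q) ↔ ∀ i, g i ∈ Q)) ∧ (s ∉ Q → ((∀ i, G i ∈ Q) ↔ ∀ i, u i ∈ Q)) := by
  obtain ⟨M, hM1, hM0, hu⟩ := hp
  let D1 := Localization.Away κ
  let D2 := Localization.Away s
  have z1 : ZA (algebraMap A D1) κ := ZA.of_away D1 κ
  have z2 : ZA (algebraMap A D2) s := ZA.of_away D2 s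
  have hjs : IsUnit (j s) := by
    have := hj.1; rw [map_mul] at this; exact isUnit_of_mul_isUnit_left this
  have hjk : IsUnit (j κ) := by
    have := hj.1; rw [map_mul] at this; exact isUnit_of_mul_isUnit_right this
  let ρ1 : D1 →+* C := IsLocalization.Away.lift κ hjk
  let ρ2 : D2 →+* C := IsLocalization.Away.lift s hjs
  have e1 : ρ1.comp (algebraMap A D1) = j := IsLocalization.Away.lift_comp κ hjk
  have e2 : ρ2.comp (algebraMap A D2) = j := IsLocalization.Away.lift_comp s hjs
  have e1' : ∀ x, ρ1 (algebraMap A D1 x) = j x := fun x => by rw [← e1]; rfl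
  have e2' : ∀ x, ρ2 (algebraMap A D2 x) = j x := fun x => by rw [← e2]; rfl
  obtain ⟨s1, i1⟩ := ZA.step z1 hj ρ1 e1
  obtain ⟨s2, i2⟩ := ZA.step z2 (by rwa [mul_comm] at hj) ρ2 e2
  let cm : Polynomial C →+* Polynomial C := Polynomial.compRingHom (1 - Polynomial.X)
  let Ms : Matrix ι ι (Polynomial C) :=
    ((M.map (Polynomial.evalRingHom 1)).map Polynomial.C).adjugate * M.map cm
  have hM1' : (M.map (Polynomial.evalRingHom (1 : C))).det = 1 := by
    rw [← RingHom.mapMatrix_apply, ← RingHom.map_det, hM1, map_one]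
  have hMs1 : Ms.det = 1 := by
    have a1 : (M.map cm).det = 1 := by
      rw [← RingHom.mapMatrix_apply, ← RingHom.map_det, hM1, map_one]
    have a2 : ((M.map (Polynomial.evalRingHom 1)).map Polynomial.C).det = 1 := by
      rw [← RingHom.mapMatrix_apply, ← RingHom.map_det, hM1', map_one]
    rw [Matrix.det_mul, Matrix.det_adjugate, a1, a2, one_pow, one_mul]
  have hMse : ∀ x : C, Ms.map (Polynomial.evalRingHom x) =
      (M.map (Polynomial.evalRingHom 1)).adjugate * M.map (Polynomial.evalRingHom (1 - x)) := by
    intro x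
    rw [Matrix.map_mul]
    have b1 := RingHom.map_adjugate (Polynomial.evalRingHom x) ((M.map (Polynomial.evalRingHom 1)).map Polynomial.C)
    rw [RingHom.mapMatrix_apply, RingHom.mapMatrix_apply] at b1
    rw [b1]
    have b2 : ((M.map (Polynomial.evalRingHom 1)).map Polynomial.C).map (Polynomial.evalRingHom x) = M.map (Polynomial.evalRingHom 1) := by
      ext1 k l; simp
    have b3 : (M.map cm).map (Polynomial.evalRingHom x) = M.map (Polynomial.evalRingHom (1 - x)) := by
      ext1 k l; simp [cm, Polynomial.eval_comp]
    rw [b2, b3]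
  have hMs0 : Ms.map (Polynomial.evalRingHom 0) = 1 := by
    rw [hMse, sub_zero, Matrix.adjugate_mul, hM1', one_smul]
  obtain ⟨K1, N1, hN1, hN1e⟩ := zlemmaQ ρ1 _ s1 i1 M hM1 hM0
  obtain ⟨K2, N2, hN2, hN2e⟩ := zlemmaQ ρ2 _ s2 i2 Ms hMs1 hMs0
  have hcop : IsCoprime (s ^ K1) (κ ^ K2) := IsCoprime.pow ⟨1, 1, by rw [one_mul, one_mul, hsk]⟩
  obtain ⟨l1, l2, hl⟩ := hcop
  let a : ι → D1 := Matrix.vecMul (fun i => algebraMap A D1 (g i)) (N1.map (Polynomial.evalRingHom (algebraMap A D1 l1)))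
  let b : ι → D2 := Matrix.vecMul (fun i => algebraMap A D2 (u i)) (N2.map (Polynomial.evalRingHom (algebraMap A D2 l2)))
  have hab : ∀ i, ρ1 (a i) = ρ2 (b i) := by
    have c1 : (fun i => ρ1 (a i)) = Matrix.vecMul (fun i => j (g i)) (M.map (Polynomial.evalRingHom (j (s ^ K1 * l1)))) := by
      have : ρ1 ((algebraMap A D1) s ^ K1 * (algebraMap A D1 l1)) = j (s ^ K1 * l1) := by
        rw [← map_pow, ← map_mul, e1']
      rw [← this, ← hN1e]
      ext i
      simp only [a, Matrix.vecMul, dotProduct, map_sum, map_mul, e1', Matrix.map_apply]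
    have c2 : (fun i => ρ2 (b i)) = Matrix.vecMul (fun i => j (u i)) (Ms.map (Polynomial.evalRingHom (j (κ ^ K2 * l2)))) := by
      have : ρ2 ((algebraMap A D2) κ ^ K2 * (algebraMap A D2 l2)) = j (κ ^ K2 * l2) := by
        rw [← map_pow, ← map_mul, e2']
      rw [← this, ← hN2e]
      ext i
      simp only [b, Matrix.vecMul, dotProduct, map_sum, map_mul, e2', Matrix.map_apply]
    have c3 : 1 - j (κ ^ K2 * l2) = j (s ^ K1 * l1) := by
      rw [← map_one j, ← map_sub, ← hl]; congr 1; ring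
    intro i
    refine congrFun (c1.trans (Eq.trans ?_ c2.symm)) i
    rw [hMse, c3, hu, ← Matrix.vecMul_vecMul, Matrix.vecMul_vecMul _ _ (Matrix.adjugate _), Matrix.mul_adjugate, hM1', one_smul,
      Matrix.vecMul_one]
  obtain ⟨n, α, hα⟩ := zunif z1 a
  obtain ⟨m, β, hβ⟩ := zunif z2 b
  obtain ⟨l, hl0⟩ := zunif0 hj (fun i => s ^ m * α i - κ ^ n * β i) (by
    intro i
    have q1 := congrArg ρ1 (hα i)
    have q2 := congrArg ρ2 (hβ i)
    rw [map_mul, map_pow, e1', e1'] at q1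
    rw [map_mul, map_pow, e2', e2'] at q2
    rw [map_sub, map_mul, map_mul, ← q1, ← q2, hab, map_pow, map_pow]
    ring)
  obtain ⟨x, y, hxy⟩ : IsCoprime (s ^ (m + l)) (κ ^ (n + l)) := IsCoprime.pow ⟨1, 1, by rw [one_mul, one_mul, hsk]⟩
  have f1 : ∀ (Q : Ideal A) (_ : Q.IsPrime) (v w : ι → A) (t : A) (k k' : ℕ), (∀ i, t ^ k * v i = t ^ k' * w i) → t ∉ Q →
      ((∀ i, v i ∈ Q) ↔ ∀ i, w i ∈ Q) := by
    intro Q hQ v w t k k' h ht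
    have : ∀ (v w : ι → A) (k k' : ℕ), (∀ i, t ^ k * v i = t ^ k' * w i) → (∀ i, v i ∈ Q) → ∀ i, w i ∈ Q := by
      intro v w k k' h hv i
      have : t ^ k' * w i ∈ Q := by rw [← h]; exact Q.mul_mem_left _ (hv i)
      exact (hQ.mem_or_mem this).resolve_left fun h => ht (hQ.mem_of_pow_mem _ h)
    exact ⟨this v w k k' h, this w v k' k fun i => (h i).symm⟩
  have hl1 : ∀ i, s ^ (m + l) * (κ ^ l * α i) = κ ^ (n + l) * (s ^ l * β i) := by
    intro i
    have := hl0 i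
    simp only [pow_add]
    rw [mul_pow] at this
    linear_combination this
  refine ⟨fun i => x * (s ^ l * β i) + y * (κ ^ l * α i), fun Q hQ => ⟨fun hk => ?_, fun hs => ?_⟩⟩
  · rw [← zside z1 g α a _ (by rw [← RingHom.mapMatrix_apply, ← RingHom.map_det, hN1, map_one]) rfl n hα Q hQ hk]
    refine f1 Q hQ _ _ κ (n + l) l (fun i => ?_) hk
    linear_combination (κ ^ l * α i) * hxy - x * hl1 i
  · rw [← zside z2 u β b _ (by rw [← RingHom.mapMatrix_apply, ← RingHom.map_det, hN2, map_one]) rfl m hβ Q hQ hs]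
    refine f1 Q hQ _ _ s (m + l) l (fun i => ?_) hs
    linear_combination (s ^ l * β i) * hxy + y * hl1 i
end glue

section heights
variable {K : Type*} [CommRing K]

theorem zcomap_map_C (p : Ideal K) : (p.map (Polynomial.C : K →+* Polynomial K)).comap Polynomial.C = p := by
  refine le_antisymm (fun x hx => ?_) Ideal.le_comap_map
  have := (Ideal.mem_map_C_iff.1 (Ideal.mem_comap.1 hx)) 0
  simpa using this

theorem zht_map_C [IsNoetherianRing K] (p : Ideal K) [p.IsPrime] :
    (p.map (Polynomial.C : K →+* Polynomial K)).height = p.height := by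
  have : (p.map (Polynomial.C : K →+* Polynomial K)).LiesOver p := ⟨(zcomap_map_C p).symm⟩
  simp [Ideal.height_eq_height_add_of_liesOver_of_hasGoingDown p (p.map (Polynomial.C : K →+* Polynomial K))]

theorem zht_comap_le [IsNoetherianRing K] (P : Ideal (Polynomial K)) [P.IsPrime] :
    (P.comap Polynomial.C).height ≤ P.height := by
  rw [← zht_map_C (P.comap Polynomial.C)]
  exact Ideal.height_mono Ideal.map_comap_le

attribute [local instance] Polynomial.algebra Polynomial.isLocalization in
theorem zht_le_add_one [IsNoetherianRing K] (P : Ideal (Polynomial K)) [hP : P.IsPrime] :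
    P.height ≤ (P.comap Polynomial.C).height + 1 := by
  set p := P.comap Polynomial.C with hp
  have : P.LiesOver p := ⟨rfl⟩
  let Rₚ := Localization.AtPrime p
  set p' : Ideal Rₚ := p.map (algebraMap K Rₚ) with p'_def
  have : p'.IsMaximal := by
    rw [p'_def, Localization.AtPrime.map_eq_maximalIdeal]
    exact IsLocalRing.maximalIdeal.isMaximal Rₚ
  let P' : Ideal (Polynomial Rₚ) := P.map (algebraMap (Polynomial K) (Polynomial Rₚ))
  have disj : Disjoint (p.primeCompl.map Polynomial.C : Set (Polynomial K)) P := by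
    refine Set.disjoint_left.mpr fun a ⟨b, hb⟩ ha ↦ hb.1 ?_
    have : Polynomial.C b = a := hb.2
    rw [hp]
    change Polynomial.C b ∈ P
    rw [this]; exact ha
  have hP'p : P'.IsPrime := IsLocalization.isPrime_of_isPrime_disjoint (p.primeCompl.map Polynomial.C) _ _ hP disj
  obtain ⟨Mx, hMx, hle⟩ := P'.exists_le_maximal hP'p.ne_top
  have h1 : P'.LiesOver p' := IsLocalization.liesOver_of_isPrime_of_disjoint p.primeCompl _ _ disj
  have : Mx.LiesOver p' := by
    refine ⟨?_⟩
    refine Ideal.IsMaximal.eq_of_le inferInstance (Ideal.IsPrime.ne_top inferInstance) ?_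
    rw [h1.over (p := p')]
    exact Ideal.comap_mono hle
  have eq1 : p.height = p'.height := by
    rw [IsLocalization.height_map_of_disjoint p.primeCompl]
    exact Disjoint.symm <| Set.disjoint_left.mpr fun _ a b ↦ b a
  have eq2 : P.height = P'.height := by
    rw [IsLocalization.height_map_of_disjoint (Submonoid.map Polynomial.C <| p.primeCompl) _ disj]
  rw [eq1, eq2, ← Polynomial.height_eq_height_add_one p' Mx]
  exact Ideal.height_mono hle

theorem zHL [IsNoetherianRing K] (J0 : Ideal (Polynomial K)) (Qk : Ideal K) [hQk : Qk.IsPrime]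
    (h : J0.leadingCoeff ≤ Qk) :
    ∃ P ∈ J0.minimalPrimes, P.comap Polynomial.C ≤ Qk ∧ P.height ≤ Qk.height := by
  have h1 : ∃ P ∈ J0.minimalPrimes, P.leadingCoeff ≤ Qk := by
    by_contra hcon
    push Not at hcon
    have h2 : ∀ P : J0.minimalPrimes, ∃ q ∈ P.1, q.leadingCoeff ∉ Qk := by
      intro P
      obtain ⟨x, hx, hx'⟩ := SetLike.not_le_iff_exists.1 (hcon P.1 P.2)
      obtain ⟨q, hq, rfl⟩ := (Ideal.mem_leadingCoeff _ _).1 hx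
      exact ⟨q, hq, hx'⟩
    choose q hq hq' using h2
    have hfin : Finite J0.minimalPrimes := (Ideal.finite_minimalPrimes_of_isNoetherianRing _ J0).to_subtype
    have := Fintype.ofFinite J0.minimalPrimes
    have hlc : ∀ s : Finset J0.minimalPrimes, (∏ P ∈ s, q P).leadingCoeff ∉ Qk := by
      intro s
      classical
      induction s using Finset.induction_on with
      | empty =>
        by_cases hn : Nontrivial K
        · simpa using (Ideal.ne_top_iff_one _).1 hQk.ne_top
        · rw [not_nontrivial_iff_subsingleton] at hn
          exact absurd (Subsingleton.elim _ _) hQk.ne_top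
      | insert a s ha ih =>
        rw [Finset.prod_insert ha]
        have : (q a).leadingCoeff * (∏ P ∈ s, q P).leadingCoeff ∉ Qk := fun h => (hQk.mem_or_mem h).elim (hq' a) ih
        rw [Polynomial.leadingCoeff_mul' (fun h0 => this (by rw [h0]; exact Qk.zero_mem))]
        exact this
    have hrad : (∏ P, q P) ∈ J0.radical := by
      rw [← Ideal.sInf_minimalPrimes, Submodule.mem_sInf]
      intro P hP
      exact Ideal.mem_of_dvd P (Finset.dvd_prod_of_mem q (Finset.mem_univ ⟨P, hP⟩)) (hq ⟨P, hP⟩)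
    obtain ⟨n, hn⟩ := hrad
    have h3 : (∏ P, q P).leadingCoeff ^ n ∉ Qk := fun h => hlc _ (hQk.mem_of_pow_mem _ h)
    refine h3 (h ((Ideal.mem_leadingCoeff _ _).2 ⟨_, hn, ?_⟩))
    rw [Polynomial.leadingCoeff_pow' (fun h0 => h3 (by rw [h0]; exact Qk.zero_mem))]
  obtain ⟨P, hP, hle⟩ := h1
  have hPp : P.IsPrime := hP.1.1
  have h4 : P.comap Polynomial.C ≤ P.leadingCoeff := fun x hx =>
    (Ideal.mem_leadingCoeff _ _).2 ⟨Polynomial.C x, hx, Polynomial.leadingCoeff_C x⟩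
  refine ⟨P, hP, h4.trans hle, ?_⟩
  by_cases heq : P.comap Polynomial.C = P.leadingCoeff
  · rw [← Ideal.map_C_comap_of_comap_eq_leadingCoeff P heq, zht_map_C]
    exact Ideal.height_mono (h4.trans hle)
  · refine (zht_le_add_one P).trans ?_
    exact Ideal.height_add_one_le_of_lt_of_isPrime ((lt_of_le_of_ne h4 heq).trans_le hle)
end heights

section finlemma
variable {S : Type*} [CommRing S]

theorem zfin_reduce (t : Ideal S) (KK : Ideal (Polynomial S)) (g : Polynomial S) (hg : g ∈ KK) (n : ℕ)
    (hn : g.natDegree ≤ n) (d : ℕ) : ∀ p : Polynomial S, p.natDegree ≤ n + d → (∀ i, p.coeff i ∈ t) →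
      ∃ p' : Polynomial S, p'.natDegree ≤ n ∧ (∀ i, p'.coeff i ∈ t) ∧
        Polynomial.C (g.coeff n ^ d) * p - p' ∈ KK := by
  induction d with
  | zero =>
    intro p hp hpt
    exact ⟨p, hp, hpt, by simp⟩
  | succ d ih =>
    intro p hp hpt
    let p1 := Polynomial.C (g.coeff n) * p - Polynomial.C (p.coeff (n + (d + 1))) * (g * Polynomial.X ^ (d + 1))
    have hg' : (g * Polynomial.X ^ (d + 1)).natDegree ≤ n + (d + 1) :=
      Polynomial.natDegree_mul_le_of_le hn (Polynomial.natDegree_X_pow_le _)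
    have h1 : p1.natDegree ≤ n + d := by
      rw [Polynomial.natDegree_le_iff_coeff_eq_zero]
      intro N hN
      rcases Nat.lt_or_ge (n + (d + 1)) N with h | h
      · simp only [p1, Polynomial.coeff_sub, Polynomial.coeff_C_mul]
        rw [Polynomial.coeff_eq_zero_of_natDegree_lt (hp.trans_lt h),
          Polynomial.coeff_eq_zero_of_natDegree_lt (hg'.trans_lt h)]
        simp
      · have : N = n + (d + 1) := by omega
        subst this
        simp only [p1, Polynomial.coeff_sub, Polynomial.coeff_C_mul, Polynomial.coeff_mul_X_pow]
        ring
    have h2 : ∀ i, p1.coeff i ∈ t := by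
      intro i
      simp only [p1, Polynomial.coeff_sub, Polynomial.coeff_C_mul]
      exact t.sub_mem (t.mul_mem_left _ (hpt _)) (t.mul_mem_right _ (hpt _))
    obtain ⟨p', h3, h4, h5⟩ := ih p1 h1 h2
    refine ⟨p', h3, h4, ?_⟩
    have : Polynomial.C (g.coeff n ^ (d + 1)) * p - p' = (Polynomial.C (g.coeff n ^ d) * p1 - p') +
        Polynomial.C (g.coeff n ^ d) * Polynomial.C (p.coeff (n + (d + 1))) * Polynomial.X ^ (d + 1) * g := by
      simp only [p1, pow_succ, map_mul, map_pow]; ring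
    rw [this]
    exact KK.add_mem h5 (KK.mul_mem_left _ hg)

theorem zfin (t : Ideal S) [ht : t.IsPrime] (KK : Ideal (Polynomial S)) (g : Polynomial S) (hg : g ∈ KK) (n : ℕ)
    (hn : g.natDegree ≤ n) (hc : g.coeff n ∉ t) (hK : KK.comap Polynomial.C ≤ t) :
    ∃ Q : Ideal (Polynomial S), Q.IsPrime ∧ KK ≤ Q ∧ Q.comap Polynomial.C = t := by
  have key : Disjoint ((KK ⊔ t.map Polynomial.C : Ideal (Polynomial S)) : Set (Polynomial S))
      (t.primeCompl.map (Polynomial.C : S →+* Polynomial S) : Submonoid (Polynomial S)) := by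
    rw [Set.disjoint_left]
    rintro _ hx ⟨b, hb, rfl⟩
    have hb' : b ∉ t := hb
    obtain ⟨k, hk, τ, hτ, hkt⟩ := Submodule.mem_sup.1 hx
    have hτ' : ∀ i, τ.coeff i ∈ t := Ideal.mem_map_C_iff.1 hτ
    have hkt' : k + τ = Polynomial.C b := hkt
    -- the finite module
    let N : Submodule S (Polynomial S ⧸ KK) := (Polynomial.degreeLT S (n + 1)).map (Ideal.Quotient.mkₐ S KK).toLinearMap
    have hfin0 : (Polynomial.degreeLT S (n + 1)).FG := by
      classical
      rw [Polynomial.degreeLT_eq_span_X_pow]; exact ⟨_, rfl⟩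
    have hfin : Module.Finite S N := Module.Finite.iff_fg.2 (hfin0.map _)
    let D := τ.natDegree
    let a := g.coeff n ^ D * b
    have ha : a ∉ t := fun h => (ht.mem_or_mem h).elim (fun h => hc (ht.mem_of_pow_mem _ h)) hb'
    have hmemN : ∀ p : Polynomial S, p.natDegree ≤ n → Ideal.Quotient.mk KK p ∈ N := by
      intro p hp
      refine ⟨p, ?_, rfl⟩
      rw [SetLike.mem_coe, Polynomial.mem_degreeLT]
      exact lt_of_le_of_lt Polynomial.degree_le_natDegree (by exact_mod_cast Nat.lt_succ_of_le hp)
    have hrange : LinearMap.range (a • (LinearMap.id : N →ₗ[S] N)) ≤ t • (⊤ : Submodule S N) := by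
      rintro _ ⟨⟨y, q, hq, rfl⟩, rfl⟩
      have hq' : q.natDegree ≤ n := by
        rw [SetLike.mem_coe, Polynomial.mem_degreeLT] at hq
        by_cases h0 : q = 0
        · simp [h0]
        · have := (Polynomial.natDegree_lt_iff_degree_lt h0).2 hq
          omega
      have hd : (τ * q).natDegree ≤ n + D := by
        rw [add_comm]; exact Polynomial.natDegree_mul_le_of_le le_rfl hq'
      obtain ⟨p', h1, h2, h3⟩ := zfin_reduce t KK g hg n hn D (τ * q) hd (fun i => by
        have : τ * q ∈ t.map Polynomial.C := Ideal.mul_mem_right _ _ hτ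
        exact Ideal.mem_map_C_iff.1 this i)
      have h4 : a • Ideal.Quotient.mk KK q = Ideal.Quotient.mk KK p' := by
        have : a • Ideal.Quotient.mk KK q = Ideal.Quotient.mk KK (Polynomial.C a * q) := by
          rw [← Polynomial.smul_eq_C_mul]; rfl
        rw [this, Ideal.Quotient.eq]
        have : Polynomial.C a * q - p' = (Polynomial.C (g.coeff n ^ D) * (τ * q) - p') + Polynomial.C (g.coeff n ^ D) * q * k := by
          simp only [a, map_mul, ← hkt']; ring
        rw [this]
        exact KK.add_mem h3 (KK.mul_mem_left _ hk)
      let ev : Fin (n + 1) → N := fun i => ⟨Ideal.Quotient.mk KK (Polynomial.X ^ (i : ℕ)),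
        hmemN _ ((Polynomial.natDegree_X_pow_le _).trans (by omega))⟩
      have h5 : (a • (LinearMap.id : N →ₗ[S] N)) ⟨Ideal.Quotient.mk KK q, q, hq, rfl⟩ = ∑ i : Fin (n + 1), p'.coeff i • ev i := by
        apply Subtype.ext
        rw [Submodule.coe_sum]
        simp only [LinearMap.smul_apply, LinearMap.id_apply, Submodule.coe_smul, ev]
        rw [h4]
        have h6 := Polynomial.as_sum_range' p' (n + 1) (by omega)
        conv_lhs => rw [h6]
        rw [map_sum, Finset.sum_range]
        refine Finset.sum_congr rfl fun i _ => ?_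
        rw [← Polynomial.C_mul_X_pow_eq_monomial, ← Polynomial.smul_eq_C_mul]; rfl
      refine (congrArg (· ∈ t • (⊤ : Submodule S N)) h5).mpr ?_
      exact Submodule.sum_mem _ fun i _ => Submodule.smul_mem_smul (h2 i) trivial
    obtain ⟨p, hp1, -, hp2, hp3⟩ := LinearMap.exists_monic_and_natDegree_eq_and_coeff_mem_pow_and_aeval_eq_zero S
      (a • (LinearMap.id : N →ₗ[S] N)) t hrange
    have h7 : (a • (LinearMap.id : N →ₗ[S] N)) = algebraMap S (Module.End S N) a := by
      rw [Algebra.algebraMap_eq_smul_one]; rfl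
    rw [h7, Polynomial.aeval_algebraMap_apply] at hp3
    have h8 : p.eval a ∈ t := by
      apply hK
      rw [Ideal.mem_comap, ← Ideal.Quotient.eq_zero_iff_mem]
      have := LinearMap.congr_fun hp3 ⟨Ideal.Quotient.mk KK 1, hmemN 1 (by simp)⟩
      have := congrArg Subtype.val this
      rw [Module.algebraMap_end_apply] at this
      have h9 : (Polynomial.aeval a p) • (Ideal.Quotient.mk KK 1) = 0 := this
      rw [Polynomial.coe_aeval_eq_eval] at h9
      have h10 : (Polynomial.eval a p) • (Ideal.Quotient.mk KK 1) = Ideal.Quotient.mk KK (Polynomial.C (p.eval a)) := by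
        conv_rhs => rw [← mul_one (Polynomial.C _), ← Polynomial.smul_eq_C_mul]
        rfl
      rw [← h10, h9]
    have h11 : p.eval a - a ^ p.natDegree ∈ t := by
      rw [Polynomial.eval_eq_sum_range, Finset.sum_range_succ, hp1.coeff_natDegree, one_mul, add_sub_cancel_right]
      refine t.sum_mem fun i hi => t.mul_mem_right _ ?_
      rw [Finset.mem_range] at hi
      exact Ideal.pow_le_self (by omega) (hp2 i)
    have := t.sub_mem h8 h11
    rw [sub_sub_cancel] at this
    exact ha (ht.mem_of_pow_mem _ this)
  obtain ⟨Q, hQ, hle, hdis⟩ := Ideal.exists_le_prime_disjoint _ _ key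
  refine ⟨Q, hQ, le_sup_left.trans hle, le_antisymm (fun x hx => ?_) (Ideal.map_le_iff_le_comap.1 (le_sup_right.trans hle))⟩
  by_contra h
  exact Set.disjoint_left.1 hdis hx ⟨x, h, rfl⟩
end finlemma

theorem zidnak {L : Type*} [CommRing L] [IsNoetherianRing L] (J G Q : Ideal L) [hQ : Q.IsPrime] (hJQ : J ≤ Q)
    (hG : G ≤ J) (h : ∀ a ∈ J, ∃ u, u ∉ Q ∧ u * a ∈ G ⊔ J * J) : ∃ u, u ∉ Q ∧ ∀ a ∈ J, u * a ∈ G := by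
  have h1 : ZLE Q (Submodule.comap J.subtype G : Submodule L J) := by
    apply ZLE.nak
    rintro ⟨a, ha⟩
    obtain ⟨u, hu, hua⟩ := h a ha
    refine ⟨u, hu, ?_⟩
    obtain ⟨x, hx, y, hy, e⟩ := Submodule.mem_sup.1 hua
    have hyJ : y ∈ J := Ideal.mul_le_right hy
    have : u • (⟨a, ha⟩ : J) = ⟨y, hyJ⟩ + ⟨x, hG hx⟩ := Subtype.ext (by
      change u * a = y + x
      rw [← e, add_comm])
    rw [this]
    refine Submodule.add_mem_sup ?_ ?_
    · have h2 : J.subtype ⟨y, hyJ⟩ ∈ Submodule.map J.subtype (Q • (⊤ : Submodule L J)) := by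
        rw [Submodule.map_smul'', Submodule.map_top, Submodule.range_subtype]
        exact Submodule.smul_mono_left hJQ hy
      obtain ⟨z, hz, hzy⟩ := h2
      have : z = ⟨y, hyJ⟩ := Subtype.ext hzy
      rwa [← this]
    · exact hx
  obtain ⟨u, hu, h2⟩ := h1.unif
  exact ⟨u, hu, fun a ha => h2 ⟨a, ha⟩⟩

section sigma
variable {S : Type*} [CommRing S]

theorem zno_chain [IsNoetherianRing S] (t : Ideal S) [t.IsPrime] (Q1 Q : Ideal (Polynomial S)) [Q1.IsPrime] [Q.IsPrime]
    (h0 : t.map Polynomial.C < Q1) (hQ : Q.comap Polynomial.C = t) (h1 : Q1 ≤ Q) : Q1 = Q := by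
  by_contra hne
  have hlt : Q1 < Q := lt_of_le_of_ne h1 hne
  have a1 := Ideal.height_add_one_le_of_lt_of_isPrime h0
  have a2 := Ideal.height_add_one_le_of_lt_of_isPrime hlt
  have a3 := zht_le_add_one Q
  rw [hQ] at a3
  rw [zht_map_C] at a1
  have a4 : t.height + 1 + 1 ≤ t.height + 1 := (add_le_add_left a1 1).trans (a2.trans a3)
  have a5 : t.height ≠ ⊤ := Ideal.height_ne_top (Ideal.IsPrime.ne_top inferInstance)
  lift t.height to ℕ using a5 with m
  norm_cast at a4
  omega

theorem zsigma [IsNoetherianRing S] {ι : Type*} [Fintype ι] [DecidableEq ι] (hι : ∀ i : ι, ∃ j, j ≠ i)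
    (f : ι → Polynomial S) (t : Ideal S) [ht : t.IsPrime]
    (hno : ∀ Q : Ideal (Polynomial S), Q.IsPrime → Q.comap Polynomial.C = t → ∃ k, f k ∉ Q)
    (i : ι) (N : ℕ) (hN : (f i).natDegree ≤ N) (hc : (f i).coeff N ∉ t) :
    ∃ c, c ∉ t ∧ ∀ {C : Type*} [CommRing C] (ψ : S →+* C) (b β : C),
      ZP (fun k => (f k).eval₂ ψ b) (fun k => (f k).eval₂ ψ (b + ψ c * β)) := by
  obtain ⟨j, hji⟩ := hι i
  let T : Set (Ideal (Polynomial S)) :=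
    {Q ∈ (Ideal.span {f i} ⊔ t.map Polynomial.C).minimalPrimes | Q.comap Polynomial.C = t}
  have hT : T.Finite := (Ideal.finite_minimalPrimes_of_isNoetherianRing _ _).subset fun Q hQ => hQ.1
  have hTp : ∀ Q ∈ T, Q.IsPrime := fun Q hQ => hQ.1.1.1
  let f0 : ι → Polynomial S := fun k => if k = i ∨ k = j then 0 else f k
  let M' : Ideal (Polynomial S) := Ideal.span (Set.range f0)
  obtain ⟨F, hF, hF2⟩ := zz_avoid_ideal T hT hTp M'
  have hfiT : ∀ Q ∈ T, f i ∈ Q := fun Q hQ => hQ.1.1.2 (Ideal.mem_sup_left (Ideal.subset_span rfl))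
  obtain ⟨m', hm', hm2⟩ := hF2 (f j) (by
    intro Q hQ
    by_contra hcon
    push Not at hcon
    obtain ⟨k, hk⟩ := hno Q (hTp Q hQ) hQ.2
    by_cases hki : k = i
    · exact hk (hki ▸ hfiT Q hQ)
    by_cases hkj : k = j
    · exact hk (hkj ▸ hcon.1)
    · have : f0 k ∈ Q := hcon.2 (Ideal.subset_span ⟨k, rfl⟩)
      simp only [f0, hki, hkj, or_self, if_false] at this
      exact hk this)
  obtain ⟨α, hα⟩ := Ideal.mem_span_range_iff_exists_fun.1 (hF m' hm')
  let α' : ι → Polynomial S := fun k => if k = i ∨ k = j then 0 else α k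
  have hα' : ∑ k, α' k * f k = m' := by
    rw [← hα]
    refine Finset.sum_congr rfl fun k _ => ?_
    simp only [α', f0]; split_ifs <;> simp
  let γ := f j + m'
  have hfit : f i ∉ t.map Polynomial.C := fun h => hc (Ideal.mem_map_C_iff.1 h N)
  have hKK : ¬ (Ideal.span {f i, γ}).comap Polynomial.C ≤ t := by
    intro hle
    obtain ⟨Q, hQp, hQ, hQt⟩ := zfin t (Ideal.span {f i, γ}) (f i) (Ideal.subset_span (by simp)) N hN hc hle
    have hfQ : f i ∈ Q := hQ (Ideal.subset_span (by simp))
    have hγQ : γ ∈ Q := hQ (Ideal.subset_span (by simp))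
    have htQ : t.map Polynomial.C ≤ Q := Ideal.map_le_iff_le_comap.2 hQt.ge
    obtain ⟨Q1, hQ1, hQ1Q⟩ := Ideal.exists_minimalPrimes_le (J := Q) (I := Ideal.span {f i} ⊔ t.map Polynomial.C)
      (sup_le ((Ideal.span_singleton_le_iff_mem _).2 hfQ) htQ)
    have hQ1p : Q1.IsPrime := hQ1.1.1
    have hQ1lt : t.map Polynomial.C < Q1 := by
      refine lt_of_le_of_ne (le_sup_right.trans hQ1.1.2) fun h => hfit ?_
      rw [h]
      exact hQ1.1.2 (Ideal.mem_sup_left (Ideal.subset_span rfl))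
    have heq := zno_chain t Q1 Q hQ1lt hQt hQ1Q
    subst heq
    exact hm2 Q1 ⟨hQ1, hQt⟩ hγQ
  obtain ⟨c, hcK, hct⟩ := SetLike.not_le_iff_exists.1 hKK
  refine ⟨c, hct, ?_⟩
  intro C _ ψ b β
  obtain ⟨p, q, hpq⟩ := Ideal.mem_span_pair.1 (Ideal.mem_comap.1 hcK)
  let f' : ι → Polynomial C := fun k => if k = j then γ.map ψ else (f k).map ψ
  have hel : ∀ b : C, ZP (fun k => (f k).eval₂ ψ b) (fun k => (f' k).eval b) := by
    intro b
    have := ZP.elem (fun k => (f k).eval₂ ψ b) j (fun k => (α' k).eval₂ ψ b) (by simp [α'])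
    convert this using 1
    ext k
    have h1 : ∑ k, (α' k).eval₂ ψ b * (f k).eval₂ ψ b = m'.eval₂ ψ b := by
      rw [← hα', Polynomial.eval₂_finsetSum]
      simp [Polynomial.eval₂_mul]
    rw [h1]
    by_cases hk : k = j
    · subst hk
      simp [f', γ, Polynomial.eval₂_add, Polynomial.eval_map]
    · simp [f', hk, Polynomial.eval_map]
  refine (hel b).trans (ZP.trans ?_ (hel _).symm)
  refine zsuslin_core f' i j hji.symm (p.map ψ) (q.map ψ) (ψ c) ?_ b β
  have h2 := congrArg (Polynomial.map ψ) hpq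
  simp only [Polynomial.map_add, Polynomial.map_mul, Polynomial.map_C] at h2
  simpa [f', hji.symm] using h2
end sigma

section suslin
variable {S : Type*} [CommRing S]

theorem zsuslin [IsNoetherianRing S] {ι : Type*} [Fintype ι] [DecidableEq ι] (hι : ∀ i : ι, ∃ j, j ≠ i)
    (f : ι → Polynomial S) {C : Type*} [CommRing C] (ψ : S →+* C)
    (h : ∀ (M : Ideal C) (_ : M.IsPrime),
      (∀ Q : Ideal (Polynomial S), Q.IsPrime → Q.comap Polynomial.C = M.comap ψ → ∃ k, f k ∉ Q) ∧
      ∃ i N, (f i).natDegree ≤ N ∧ (f i).coeff N ∉ M.comap ψ) (b β : C) :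
    ZP (fun k => (f k).eval₂ ψ b) (fun k => (f k).eval₂ ψ (b + β)) := by
  let I : Ideal C :=
    { carrier := {x | ∀ b y : C, ZP (fun k => (f k).eval₂ ψ b) (fun k => (f k).eval₂ ψ (b + x * y))}
      add_mem' := by
        intro x y hx hy b z
        have h1 := hx b z
        have h2 := hy (b + x * z) z
        have := h1.trans h2
        rwa [add_assoc, ← add_mul] at this
      zero_mem' := by
        intro b y
        rw [zero_mul, add_zero]; exact ZP.refl _
      smul_mem' := by
        intro c x hx b y
        have := hx b (c * y)
        rwa [show x * (c * y) = c • x * y by rw [smul_eq_mul]; ring] at this }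
  have hI : I = ⊤ := by
    by_contra hne
    obtain ⟨M, hM, hle⟩ := I.exists_le_maximal hne
    obtain ⟨h1, i, N, h2, h3⟩ := h M hM.isPrime
    have hMp := hM.isPrime
    obtain ⟨c, hc, h4⟩ := zsigma hι f (M.comap ψ) h1 i N h2 h3
    exact hc (hle (fun b y => h4 ψ b y : ψ c ∈ I))
  have : (1 : C) ∈ I := by rw [hI]; trivial
  have := this b β
  rwa [one_mul] at this

/-- from values at `y` to the vector of top coefficients -/
theorem zto_top [IsNoetherianRing S] {ι : Type*} [Fintype ι] [DecidableEq ι] (hι : ∀ i : ι, ∃ j, j ≠ i)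
    (g : ι → Polynomial S) (N : ι → ℕ) (hN : ∀ i, (g i).natDegree ≤ N i)
    {C : Type*} [CommRing C] (ψ : S →+* C)
    (h : ∀ (M : Ideal C) (_ : M.IsPrime),
      (∀ Q : Ideal (Polynomial S), Q.IsPrime → Q.comap Polynomial.C = M.comap ψ → ∃ k, g k ∉ Q) ∧
      ∃ i, (g i).coeff (N i) ∉ M.comap ψ) (y : C) :
    ZP (fun k => (g k).eval₂ ψ y) (fun k => ψ ((g k).coeff (N k))) := by
  let hh : ι → Polynomial S := fun k => Polynomial.reflect (N k) (g k)
  have e1 : ZP (fun k => (g k).eval₂ ψ 1) (fun k => (g k).eval₂ ψ (1 + (y - 1))) :=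
    zsuslin hι g ψ (fun M hM => ⟨(h M hM).1, by
      obtain ⟨i, hi⟩ := (h M hM).2
      exact ⟨i, N i, hN i, hi⟩⟩) 1 (y - 1)
  rw [add_sub_cancel] at e1
  have e2 : ZP (fun k => (hh k).eval₂ ψ 0) (fun k => (hh k).eval₂ ψ (0 + 1)) := by
    refine zsuslin hι hh ψ (fun M hM => ?_) 0 1
    obtain ⟨h1, i0, hi0⟩ := h M hM
    have htp : (M.comap ψ).IsPrime := inferInstance
    set t := M.comap ψ with htdef
    constructor
    · intro Q hQ hQt
      by_contra hcon
      push Not at hcon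
      by_cases hX : (Polynomial.X : Polynomial S) ∈ Q
      · apply hi0
        rw [← hQt, Ideal.mem_comap]
        have h5 := Polynomial.divX_mul_X_add (hh i0)
        have h6 : Polynomial.C ((hh i0).coeff 0) = hh i0 - (hh i0).divX * Polynomial.X :=
          eq_sub_of_add_eq' h5
        have h7 : (hh i0).coeff 0 = (g i0).coeff (N i0) := by
          simp [hh, Polynomial.coeff_reflect]
        rw [← h7, h6]
        exact Q.sub_mem (hcon i0) (Q.mul_mem_left _ hX)
      · let L := FractionRing (Polynomial S ⧸ Q)
        let φ : Polynomial S →+* L := (algebraMap (Polynomial S ⧸ Q) L).comp (Ideal.Quotient.mk Q)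
        have hφ : ∀ x, φ x = 0 ↔ x ∈ Q := by
          intro x
          simp only [φ, RingHom.comp_apply]
          rw [IsFractionRing.to_map_eq_zero_iff, Ideal.Quotient.eq_zero_iff_mem]
        let x0 : L := φ Polynomial.X
        have hx0 : x0 ≠ 0 := fun h => hX ((hφ _).1 h)
        let iS : S →+* L := φ.comp Polynomial.C
        letI : Invertible (x0⁻¹) := invertibleOfNonzero (inv_ne_zero hx0)
        have hinv : ⅟(x0⁻¹) = x0 := by rw [invOf_eq_inv, inv_inv]
        let θ : Polynomial S →+* L := Polynomial.eval₂RingHom iS x0⁻¹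
        have hθp : (RingHom.ker θ).IsPrime := RingHom.ker_isPrime θ
        have hc : (RingHom.ker θ).comap Polynomial.C = t := by
          ext z
          rw [Ideal.mem_comap, RingHom.mem_ker, ← hQt, Ideal.mem_comap, ← hφ]
          simp [θ, iS]
        obtain ⟨k, hk⟩ := h1 _ hθp hc
        apply hk
        rw [RingHom.mem_ker]
        change (g k).eval₂ iS x0⁻¹ = 0
        rw [← Polynomial.eval₂_reflect_eq_zero_iff iS (x0⁻¹) (N k) (g k) (hN k), hinv]
        have h8 : ∀ p : Polynomial S, p.eval₂ iS x0 = φ p := by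
          intro p
          have : Polynomial.eval₂RingHom iS x0 = φ := by
            ext z
            · simp [iS]
            · simp [x0]
          rw [← this]; rfl
        rw [h8, hφ]
        exact hcon k
    · let Q0 : Ideal (Polynomial S) := t.comap (Polynomial.evalRingHom 0)
      have hQ0 : Q0.comap Polynomial.C = t := by
        ext z; simp [Q0]
      obtain ⟨k, hk⟩ := h1 Q0 inferInstance hQ0
      refine ⟨k, N k, ?_, ?_⟩
      · rw [Polynomial.natDegree_le_iff_coeff_eq_zero]
        intro m hm
        simp only [hh, Polynomial.coeff_reflect]
        rw [Polynomial.revAt_eq_self_of_lt hm]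
        exact Polynomial.coeff_eq_zero_of_natDegree_lt ((hN k).trans_lt hm)
      · intro hmem
        apply hk
        simp only [hh, Polynomial.coeff_reflect, Polynomial.revAt_le le_rfl, Nat.sub_self] at hmem
        change Polynomial.eval 0 (g k) ∈ t
        rwa [← Polynomial.coeff_zero_eq_eval_zero]
  have e3 : (fun k => (hh k).eval₂ ψ 0) = (fun k => ψ ((g k).coeff (N k))) := by
    ext k
    rw [Polynomial.eval₂_at_zero]
    simp [hh, Polynomial.coeff_reflect]
  have e4 : (fun k => (hh k).eval₂ ψ (0 + 1)) = (fun k => (g k).eval₂ ψ 1) := by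
    ext k
    letI : Invertible (1 : C) := invertibleOne
    have := Polynomial.eval₂_reflect_mul_pow ψ (1 : C) (N k) (g k) (hN k)
    rw [invOf_one, one_pow, mul_one] at this
    rw [zero_add]; exact this
  rw [e3, e4] at e2
  exact (e2.trans e1).symm
end suslin

section mp
variable {S : Type*} [CommRing S]

/-- pick one modified generator avoiding finitely many primes -/
theorem zpick (J0 : Ideal (Polynomial S)) (x φ : Polynomial S) (hφ : φ ∈ J0) (T : Set (Ideal (Polynomial S)))
    (hT : T.Finite) (hTp : ∀ Q ∈ T, Q.IsPrime ∧ ¬ J0 ≤ Q) :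
    ∃ (g : Polynomial S) (N : ℕ), g - x ∈ J0 * J0 ∧ g.natDegree ≤ N ∧ g.coeff N = φ.leadingCoeff ^ 2 ∧
      ∀ Q ∈ T, g ∉ Q := by
  obtain ⟨F, hF, hF2⟩ := zz_avoid_ideal T hT (fun Q hQ => (hTp Q hQ).1) (J0 * J0)
  let M := x.natDegree + F.sup Polynomial.natDegree + 1
  obtain ⟨m', hm', hm2⟩ := hF2 (x + φ ^ 2 * Polynomial.X ^ M) (by
    intro Q hQ
    right
    intro hle
    have := (hTp Q hQ).1
    exact (hTp Q hQ).2 ((Ideal.IsPrime.mul_le (hTp Q hQ).1).1 hle |>.elim id id))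
  have hm3 : m'.natDegree ≤ F.sup Polynomial.natDegree := Finset.le_sup (f := Polynomial.natDegree) hm'
  have hd1 : (φ ^ 2).natDegree ≤ 2 * φ.natDegree := Polynomial.natDegree_pow_le
  have hd : (φ ^ 2 * Polynomial.X ^ M).natDegree ≤ 2 * φ.natDegree + M :=
    Polynomial.natDegree_mul_le_of_le hd1 (Polynomial.natDegree_X_pow_le _)
  refine ⟨x + φ ^ 2 * Polynomial.X ^ M + m', 2 * φ.natDegree + M, ?_, ?_, ?_, hm2⟩
  · have : x + φ ^ 2 * Polynomial.X ^ M + m' - x = φ * φ * Polynomial.X ^ M + m' := by ring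
    rw [this]
    exact Ideal.add_mem _ (Ideal.mul_mem_right _ _ (Ideal.mul_mem_mul hφ hφ)) (hF _ hm')
  · refine Polynomial.natDegree_add_le_of_degree_le (Polynomial.natDegree_add_le_of_degree_le ?_ hd) ?_ <;> omega
  · rw [Polynomial.coeff_add, Polynomial.coeff_add, Polynomial.coeff_mul_X_pow,
      Polynomial.coeff_eq_zero_of_natDegree_lt (p := x) (by omega),
      Polynomial.coeff_eq_zero_of_natDegree_lt (p := m') (by omega), zero_add, add_zero,
      Polynomial.coeff_pow_of_natDegree_le le_rfl]
    rfl

theorem zmp_height [IsNoetherianRing S] (c : Ideal S) (r : ℕ) (J0 : Ideal (Polynomial S))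
    (k1 : ∀ t : Ideal S, t.IsPrime → ¬ c ≤ t → t.height ≤ r)
    (k2 : ∀ Q : Ideal (Polynomial S), Q.IsPrime → J0 ≤ Q → ¬ c ≤ Q.comap Polynomial.C → (r : ℕ∞) ≤ Q.height)
    (k4 : ∀ t : Ideal S, t.IsPrime → ¬ c ≤ t → ∃ φ ∈ J0, φ.leadingCoeff ∉ t)
    (g1 g2 g3 : Polynomial S)
    (h1 : ∀ Q ∈ {Q ∈ ((J0.comap Polynomial.C).map Polynomial.C).minimalPrimes | ¬ J0 ≤ Q}, g1 ∉ Q)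
    (h2 : ∀ Q ∈ {Q ∈ ((J0.comap Polynomial.C).map Polynomial.C ⊔ Ideal.span {g1}).minimalPrimes | ¬ J0 ≤ Q}, g2 ∉ Q)
    (h3 : ∀ Q ∈ {Q ∈ ((J0.comap Polynomial.C).map Polynomial.C ⊔ Ideal.span {g1} ⊔ Ideal.span {g2}).minimalPrimes | ¬ J0 ≤ Q}, g3 ∉ Q)
    (Q : Ideal (Polynomial S)) [hQ : Q.IsPrime] (hJ : (J0.comap Polynomial.C).map Polynomial.C ≤ Q)
    (hc : ¬ c ≤ Q.comap Polynomial.C) (hg1 : g1 ∈ Q) (hg2 : g2 ∈ Q) (hg3 : g3 ∈ Q) : J0 ≤ Q := by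
  by_contra hJ0
  have s1 : Ideal.span {g1} ≤ Q := (Ideal.span_singleton_le_iff_mem _).2 hg1
  have s2 : Ideal.span {g2} ≤ Q := (Ideal.span_singleton_le_iff_mem _).2 hg2
  obtain ⟨Q3, hQ3, hQ3Q⟩ := Ideal.exists_minimalPrimes_le (sup_le (sup_le hJ s1) s2)
  have p3 : Q3.IsPrime := hQ3.1.1
  obtain ⟨Q2, hQ2, hQ23⟩ := Ideal.exists_minimalPrimes_le (le_sup_left.trans hQ3.1.2)
  have p2 : Q2.IsPrime := hQ2.1.1
  obtain ⟨Q1, hQ1, hQ12⟩ := Ideal.exists_minimalPrimes_le (le_sup_left.trans hQ2.1.2)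
  have p1 : Q1.IsPrime := hQ1.1.1
  have n3 := h3 Q3 ⟨hQ3, fun h => hJ0 (h.trans hQ3Q)⟩
  have n2 := h2 Q2 ⟨hQ2, fun h => hJ0 (h.trans (hQ23.trans hQ3Q))⟩
  have n1 := h1 Q1 ⟨hQ1, fun h => hJ0 (h.trans (hQ12.trans (hQ23.trans hQ3Q)))⟩
  have l3 : Q3 < Q := lt_of_le_of_ne hQ3Q fun h => n3 (h ▸ hg3)
  have l2 : Q2 < Q3 := lt_of_le_of_ne hQ23 fun h => n2 (by
    rw [h]; exact hQ3.1.2 (Ideal.mem_sup_right (Ideal.subset_span rfl)))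
  have l1 : Q1 < Q2 := lt_of_le_of_ne hQ12 fun h => n1 (by
    rw [h]; exact hQ2.1.2 (Ideal.mem_sup_right (Ideal.subset_span rfl)))
  have c1 : ¬ c ≤ Q1.comap Polynomial.C := fun h => hc (h.trans (Ideal.comap_mono (hQ12.trans (hQ23.trans hQ3Q))))
  have a1 := Ideal.height_add_one_le_of_lt_of_isPrime l1
  have a2 := Ideal.height_add_one_le_of_lt_of_isPrime l2
  have a3 := Ideal.height_add_one_le_of_lt_of_isPrime l3
  have a4 := zht_le_add_one Q
  have a5 := k1 _ inferInstance hc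
  -- lower bound
  have tp : (Q1.comap (Polynomial.C : S →+* Polynomial S)).IsPrime := inferInstance
  obtain ⟨φ, hφ, hφt⟩ := k4 _ tp c1
  obtain ⟨Q', hQ'p, hJQ', hQ't⟩ := zfin (Q1.comap Polynomial.C) J0 φ hφ φ.natDegree le_rfl hφt
    (Ideal.map_le_iff_le_comap.1 hQ1.1.2)
  have a6 := k2 Q' hQ'p hJQ' (by rwa [hQ't])
  have a7 := zht_le_add_one Q'
  rw [hQ't] at a7
  have a8 := zht_comap_le Q1
  have a9 : (r : ℕ∞) + 1 + 1 ≤ (r : ℕ∞) + 1 := by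
    calc (r : ℕ∞) + 1 + 1 ≤ Q1.height + 1 + 1 + 1 := by
          gcongr; exact a6.trans (a7.trans (add_le_add_left a8 1))
      _ ≤ Q2.height + 1 + 1 := by gcongr
      _ ≤ Q3.height + 1 := by gcongr
      _ ≤ Q.height := a3
      _ ≤ _ := a4
      _ ≤ _ := by gcongr
  norm_cast at a9
  omega

theorem zMP [IsNoetherianRing S] {A : Type*} [CommRing A] (c : Ideal S) (r : ℕ) (hr : 3 ≤ r) (J0 : Ideal (Polynomial S))
    (k1 : ∀ t : Ideal S, t.IsPrime → ¬ c ≤ t → t.height ≤ r)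
    (k2 : ∀ Q : Ideal (Polynomial S), Q.IsPrime → J0 ≤ Q → ¬ c ≤ Q.comap Polynomial.C → (r : ℕ∞) ≤ Q.height)
    (g0 : Fin r → Polynomial S) (hg0 : ∀ i, g0 i ∈ J0)
    (k5 : ∀ Q : Ideal (Polynomial S), Q.IsPrime → J0 ≤ Q → ¬ c ≤ Q.comap Polynomial.C →
      ∀ a ∈ J0, ∃ u, u ∉ Q ∧ u * a ∈ Ideal.span (Set.range g0))
    (φ : Fin r → Polynomial S) (hφ : ∀ i, φ i ∈ J0)
    (k6 : ∀ t : Ideal S, t.IsPrime → ¬ c ≤ t → ∃ i, (φ i).leadingCoeff ∉ t)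
    (j : Polynomial S →+* A) (hj : (c.map Polynomial.C).map j = ⊤) :
    ∃ G : Fin r → A, (J0.map j).radical = (Ideal.span (Set.range G)).radical := by
  have k4 : ∀ t : Ideal S, t.IsPrime → ¬ c ≤ t → ∃ φ ∈ J0, φ.leadingCoeff ∉ t := fun t ht hc =>
    let ⟨i, hi⟩ := k6 t ht hc
    ⟨φ i, hφ i, hi⟩
  -- choose g
  have pick : ∀ (i : Fin r) (I : Ideal (Polynomial S)), ∃ (g : Polynomial S) (N : ℕ), g - g0 i ∈ J0 * J0 ∧ g.natDegree ≤ N ∧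
      g.coeff N = (φ i).leadingCoeff ^ 2 ∧ ∀ Q ∈ {Q ∈ I.minimalPrimes | ¬ J0 ≤ Q}, g ∉ Q := fun i I =>
    zpick J0 (g0 i) (φ i) (hφ i) _ ((Ideal.finite_minimalPrimes_of_isNoetherianRing _ _).subset fun Q hQ => hQ.1)
      fun Q hQ => ⟨hQ.1.1.1, hQ.2⟩
  choose pk pN pk1 pk2 pk3 pk4 using pick
  let J1 := (J0.comap (Polynomial.C : S →+* Polynomial S)).map (Polynomial.C : S →+* Polynomial S)
  let i0 : Fin r := ⟨0, by omega⟩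
  let i1 : Fin r := ⟨1, by omega⟩
  let i2 : Fin r := ⟨2, by omega⟩
  let J2 := J1 ⊔ Ideal.span {pk i0 J1}
  let J3 := J2 ⊔ Ideal.span {pk i1 J2}
  let IX : Fin r → Ideal (Polynomial S) := fun i => if i = i0 then J1 else if i = i1 then J2 else J3
  let g : Fin r → Polynomial S := fun i => pk i (IX i)
  let N : Fin r → ℕ := fun i => pN i (IX i)
  have gi0 : g i0 = pk i0 J1 := by simp [g, IX]
  have gi1 : g i1 = pk i1 J2 := by
    have : i1 ≠ i0 := by simp [i1, i0]
    simp [g, IX, this]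
  have gi2 : g i2 = pk i2 J3 := by
    have h1 : i2 ≠ i0 := by simp [i2, i0]
    have h2 : i2 ≠ i1 := by simp [i2, i1]
    simp [g, IX, h1, h2]
  have hgJ : ∀ i, g i ∈ J0 := fun i => by
    have := Ideal.add_mem _ (Ideal.mul_le_right (pk1 i (IX i))) (hg0 i)
    rwa [sub_add_cancel] at this
  have hH : ∀ Q : Ideal (Polynomial S), Q.IsPrime → J1 ≤ Q → ¬ c ≤ Q.comap Polynomial.C → (∀ i, g i ∈ Q) → J0 ≤ Q := by
    intro Q hQ hJQ hcQ hgQ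
    refine zmp_height c r J0 k1 k2 k4 (pk i0 J1) (pk i1 J2) (pk i2 J3) (pk4 i0 J1) (pk4 i1 J2) (pk4 i2 J3) Q hJQ hcQ ?_ ?_ ?_
    · rw [← gi0]; exact hgQ _
    · rw [← gi1]; exact hgQ _
    · rw [← gi2]; exact hgQ _
  let Ig := Ideal.span (Set.range g)
  have hIgJ : Ig ≤ J0 := Ideal.span_le.2 (by rintro _ ⟨i, rfl⟩; exact hgJ i)
  let K0 : Ideal (Polynomial S) := Submodule.colon Ig (J0 : Set (Polynomial S))
  have hK0 : ∀ u, u ∈ K0 ↔ ∀ a ∈ J0, u * a ∈ Ig := fun u => Submodule.mem_colon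
  have hK0J : ∀ Q : Ideal (Polynomial S), Q.IsPrime → ¬ c ≤ Q.comap Polynomial.C → J0 ≤ Q → K0 ≤ Q → False := by
    intro Q hQ hcQ hJQ hKQ
    obtain ⟨u, hu, hua⟩ := zidnak J0 Ig Q hJQ hIgJ (by
      intro a ha
      obtain ⟨u, hu, hua⟩ := k5 Q hQ hJQ hcQ a ha
      refine ⟨u, hu, (Ideal.span_le.2 ?_) hua⟩
      rintro _ ⟨i, rfl⟩
      have : g0 i = g i + (- (g i - g0 i)) := by ring
      rw [SetLike.mem_coe, this]
      exact Submodule.add_mem_sup (Ideal.subset_span ⟨i, rfl⟩) (neg_mem (pk1 i (IX i))))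
    exact hu (hKQ ((hK0 u).2 hua))
  have hgK : ∀ i, g i ∈ K0 := fun i => (hK0 _).2 fun a _ => Ideal.mul_mem_right _ _ (Ideal.subset_span ⟨i, rfl⟩)
  have hlcnot : ∀ t : Ideal S, t.IsPrime → ¬ c ≤ t → ∃ i, (g i).coeff (N i) ∉ t := by
    intro t ht hct
    obtain ⟨i, hi⟩ := k6 t ht hct
    refine ⟨i, ?_⟩
    change (pk i (IX i)).coeff (pN i (IX i)) ∉ t
    rw [pk3]
    exact fun h => hi (ht.mem_of_pow_mem _ h)
  have hNd : ∀ i, (g i).natDegree ≤ N i := fun i => pk2 i (IX i)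
  have hkt : ∀ t : Ideal S, t.IsPrime → ¬ c ≤ t → K0.comap Polynomial.C ≤ t → J0.comap Polynomial.C ≤ t → False := by
    intro t ht hct hK hJ
    obtain ⟨i, hi⟩ := hlcnot t ht hct
    obtain ⟨Q, hQp, hQ, hQt⟩ := zfin t K0 (g i) (hgK i) (N i) (hNd i) hi hK
    have hcQ : ¬ c ≤ Q.comap Polynomial.C := by rwa [hQt]
    have hJQ : J0 ≤ Q := hH Q hQp (Ideal.map_le_iff_le_comap.2 (by rwa [hQt])) hcQ (fun i => hQ (hgK i))
    exact hK0J Q hQp hcQ hJQ hQ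
  -- pass to A
  have hcA : ∀ M : Ideal A, M.IsPrime → ¬ c ≤ M.comap (j.comp Polynomial.C) := by
    intro M hM hle
    apply hM.ne_top
    rw [eq_top_iff, ← hj, Ideal.map_map]
    exact Ideal.map_le_iff_le_comap.2 hle
  let jS : S →+* A := j.comp Polynomial.C
  have htop : (K0.comap Polynomial.C).map jS ⊔ (J0.comap Polynomial.C).map jS = ⊤ := by
    by_contra hne
    obtain ⟨M, hM, hle⟩ := Ideal.exists_le_maximal _ hne
    have hMp := hM.isPrime
    exact hkt (M.comap jS) inferInstance (hcA M hMp) (Ideal.map_le_iff_le_comap.1 (le_sup_left.trans hle))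
      (Ideal.map_le_iff_le_comap.1 (le_sup_right.trans hle))
  obtain ⟨κ, hκ, s, hs, hsk⟩ := Submodule.mem_sup.1 ((Ideal.eq_top_iff_one _).1 htop)
  let C := Localization.Away (s * κ)
  let ρ : A →+* C := algebraMap A C
  have hρ : ZA ρ (s * κ) := ZA.of_away C (s * κ)
  have hι : ∀ i : Fin r, ∃ j, j ≠ i := by
    intro i
    by_cases h : i = i0
    · exact ⟨i1, by rw [h]; simp [i1, i0]⟩
    · exact ⟨i0, fun h' => h h'.symm⟩
  let ψ : S →+* C := ρ.comp jS
  have hpath : ZP (fun i => ρ (j (g i))) (fun i => ρ (jS ((g i).coeff (N i)))) := by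
    have e := zto_top hι g N hNd ψ (by
      intro M hM
      have hcM : ¬ c ≤ M.comap ψ := hcA (M.comap ρ) inferInstance
      have hskM : s ∉ M.comap ρ ∧ κ ∉ M.comap ρ := by
        constructor
        · intro h
          exact hM.ne_top (Ideal.eq_top_of_isUnit_mem _ (by rw [map_mul]; exact M.mul_mem_right _ h) hρ.1)
        · intro h
          exact hM.ne_top (Ideal.eq_top_of_isUnit_mem _ (by rw [map_mul]; exact M.mul_mem_left _ h) hρ.1)
      refine ⟨?_, hlcnot _ inferInstance hcM⟩
      intro Q hQ hQt
      by_contra hcon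
      push Not at hcon
      have hprod : K0 * J0 ≤ Q := by
        rw [Ideal.mul_le]
        intro u hu a ha
        have := (hK0 u).1 hu a ha
        exact (Ideal.span_le.2 (by rintro _ ⟨i, rfl⟩; exact hcon i)) this
      rcases (Ideal.IsPrime.mul_le hQ).1 hprod with h | h
      · apply hskM.2
        have : K0.comap Polynomial.C ≤ M.comap ψ := by rw [← hQt]; exact Ideal.comap_mono h
        exact (Ideal.map_le_iff_le_comap.2 this : (K0.comap Polynomial.C).map jS ≤ M.comap ρ) hκ
      · apply hskM.1
        have : J0.comap Polynomial.C ≤ M.comap ψ := by rw [← hQt]; exact Ideal.comap_mono h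
        exact (Ideal.map_le_iff_le_comap.2 this : (J0.comap Polynomial.C).map jS ≤ M.comap ρ) hs) (ρ (j Polynomial.X))
    have e2 : (fun i => ρ (j (g i))) = fun k => (g k).eval₂ ψ (ρ (j Polynomial.X)) := by
     ext i
     have : ρ.comp j = Polynomial.eval₂RingHom ψ (ρ (j Polynomial.X)) := by
      ext z <;> simp [ψ, jS]
     exact RingHom.congr_fun this (g i)
    rw [e2]
    exact e
  obtain ⟨G, hG⟩ := zglue ρ s κ (by rw [add_comm]; exact hsk) hρ _ _ hpath
  refine ⟨G, ?_⟩
  have hone : ∀ Q : Ideal A, Q.IsPrime → s ∈ Q → κ ∉ Q := by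
    intro Q hQ h1 h2
    exact hQ.ne_top ((Ideal.eq_top_iff_one _).2 (hsk ▸ Q.add_mem h2 h1))
  have hmain : ∀ Q : Ideal A, Q.IsPrime → (J0.map j ≤ Q ↔ Ideal.span (Set.range G) ≤ Q) := by
    intro Q hQ
    have hGQ : Ideal.span (Set.range G) ≤ Q ↔ ∀ i, G i ∈ Q := by
      rw [Ideal.span_le]
      exact ⟨fun h i => h ⟨i, rfl⟩, by rintro h _ ⟨i, rfl⟩; exact h i⟩
    rw [hGQ]
    constructor
    · intro h
      have hsQ : s ∈ Q := by
        refine (Ideal.map_le_iff_le_comap.2 ?_ : (J0.comap Polynomial.C).map jS ≤ Q) hs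
        intro x hx
        exact h (Ideal.mem_map_of_mem j hx)
      exact ((hG Q hQ).1 (hone Q hQ hsQ)).2 fun i => h (Ideal.mem_map_of_mem j (hgJ i))
    · intro h
      have hsQ : s ∈ Q := by
        by_contra hsQ
        have h2 := ((hG Q hQ).2 hsQ).1 h
        obtain ⟨i, hi⟩ := hlcnot (Q.comap jS) inferInstance (hcA Q hQ)
        exact hi (h2 i)
      have hκQ := hone Q hQ hsQ
      have hgQ := ((hG Q hQ).1 hκQ).1 h
      have : ¬ K0.comap Polynomial.C ≤ Q.comap jS := fun hle =>
        hκQ ((Ideal.map_le_iff_le_comap.2 hle : (K0.comap Polynomial.C).map jS ≤ Q) hκ)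
      obtain ⟨k, hk, hk'⟩ := SetLike.not_le_iff_exists.1 this
      rw [Ideal.map_le_iff_le_comap]
      intro a ha
      have h3 := (hK0 _).1 hk a ha
      have h4 : Polynomial.C k * a ∈ Q.comap j :=
        (Ideal.span_le.2 (by rintro _ ⟨i, rfl⟩; exact hgQ i)) h3
      rw [Ideal.mem_comap, map_mul] at h4
      exact (hQ.mem_or_mem h4).resolve_left hk'
  rw [Ideal.radical_eq_sInf, Ideal.radical_eq_sInf]
  congr 1
  ext Q
  simp only [Set.mem_setOf_eq]
  exact ⟨fun h => ⟨(hmain Q h.2).1 h.1, h.2⟩, fun h => ⟨(hmain Q h.2).2 h.1, h.2⟩⟩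
end mp

theorem ZA.prime {P A : Type*} [CommRing P] [CommRing A] {ι : P →+* A} {F : P} (h : ZA ι F)
    (Q : Ideal P) (hQ : Q.IsPrime) (hF : F ∉ Q) :
    (Q.map ι).IsPrime ∧ (Q.map ι).comap ι = Q ∧ (Q.map ι).height = Q.height := by
  letI := ι.toAlgebra
  haveI := h.toAway
  have hd : Disjoint (Submonoid.powers F : Set P) (Q : Set P) := by
    rw [Set.disjoint_left]
    rintro _ ⟨n, rfl⟩ hx
    exact hF (hQ.mem_of_pow_mem _ hx)
  refine ⟨IsLocalization.isPrime_of_isPrime_disjoint (Submonoid.powers F) A Q hQ hd, ?_, ?_⟩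
  · exact IsLocalization.under_map_of_isPrime_disjoint (Submonoid.powers F) A hQ hd
  · exact IsLocalization.height_map_of_disjoint (Submonoid.powers F) Q hd

theorem ZA.height_comap {P A : Type*} [CommRing P] [CommRing A] {ι : P →+* A} {F : P} (h : ZA ι F)
    (Q : Ideal A) : (Q.comap ι).height = Q.height := by
  letI := ι.toAlgebra
  haveI := h.toAway
  exact IsLocalization.height_under (Submonoid.powers F) Q

theorem ZA.map_comap {P A : Type*} [CommRing P] [CommRing A] {ι : P →+* A} {F : P} (h : ZA ι F)
    (J : Ideal A) : (J.comap ι).map ι = J := by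
  letI := ι.toAlgebra
  haveI := h.toAway
  exact IsLocalization.map_comap (Submonoid.powers F) A J

theorem ZA.unit_mem {P A : Type*} [CommRing P] [CommRing A] {ι : P →+* A} {F : P} (h : ZA ι F)
    (J : Ideal A) (n : ℕ) (x : A) : ι F ^ n * x ∈ J ↔ x ∈ J :=
  Ideal.unit_mul_mem_iff_mem J (h.1.pow n)

theorem ZA.sat {P A : Type*} [CommRing P] [CommRing A] {ι : P →+* A} {F : P} (h : ZA ι F)
    (J : Ideal A) (x : P) (hx : F * x ∈ J.comap ι) : x ∈ J.comap ι := by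
  rw [Ideal.mem_comap, map_mul] at hx
  exact (Ideal.unit_mul_mem_iff_mem J h.1).1 hx

theorem zsat_prime {P : Type*} [CommRing P] (J : Ideal P) (F : P) (hs : ∀ x, F * x ∈ J → x ∈ J)
    (Q : Ideal P) [hQ : Q.IsPrime] (hJ : J ≤ Q) : ∃ Q' : Ideal P, Q'.IsPrime ∧ J ≤ Q' ∧ Q' ≤ Q ∧ F ∉ Q' := by
  have hs' : ∀ (n : ℕ) x, F ^ n * x ∈ J → x ∈ J := by
    intro n
    induction n with
    | zero => intro x hx; simpa using hx
    | succ n ih => intro x hx; exact hs _ (ih _ (by rw [← mul_assoc, ← pow_succ]; exact hx))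
  obtain ⟨Q', h1, h2, h3⟩ := Ideal.exists_le_prime_disjoint J (Submonoid.powers F ⊔ Q.primeCompl) (by
    rw [Set.disjoint_left]
    intro x hx hx2
    obtain ⟨_, ⟨n, rfl⟩, u, hu, rfl⟩ := Submonoid.mem_sup.1 hx2
    exact hu (hJ (hs' n _ hx)))
  rw [Set.disjoint_left] at h3
  refine ⟨Q', h1, h2, ?_, fun h => h3 h ((le_sup_left : Submonoid.powers F ≤ _) (Submonoid.mem_powers F))⟩
  intro x hx
  by_contra hn
  exact h3 hx ((le_sup_right : Q.primeCompl ≤ Submonoid.powers F ⊔ Q.primeCompl) hn)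

theorem ZA.minimal {P A : Type*} [CommRing P] [CommRing A] {ι : P →+* A} {F : P} (h : ZA ι F)
    (J : Ideal A) (Q : Ideal P) (hQ : Q ∈ (J.comap ι).minimalPrimes) : F ∉ Q := by
  have := hQ.1.1
  obtain ⟨Q', h1, h2, h3, h4⟩ := zsat_prime (J.comap ι) F (h.sat J) Q hQ.1.2
  exact fun hF => h4 (hQ.2 ⟨h1, h2⟩ h3 hF)

def ZGood {A' : Type*} [CommRing A'] (c : Ideal A') (r : ℕ) (J : Ideal A') : Prop :=
  (∀ Q : Ideal A', Q.IsPrime → J ≤ Q → ¬ c ≤ Q → (r : ℕ∞) ≤ Q.height) ∧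
  ∃ g : Fin r → A', (∀ i, g i ∈ J) ∧ ∀ Q : Ideal A', Q.IsPrime → J ≤ Q → ¬ c ≤ Q →
    ∀ a ∈ J, ∃ u, u ∉ Q ∧ u * a ∈ Ideal.span (Set.range g)

def ZSG (A : Type*) [CommRing A] {A' : Type*} [CommRing A'] (c : Ideal A') (r : ℕ) (J : Ideal A') : Prop :=
  ∀ j : A' →+* A, c.map j = ⊤ → ∃ G : Fin r → A, (J.map j).radical = (Ideal.span (Set.range G)).radical

theorem zdescent {A A' A'' : Type*} [CommRing A] [CommRing A'] [CommRing A''] {ι : A' →+* A''} {F : A'} (h : ZA ι F)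
    (c : Ideal A') (r : ℕ) (J : Ideal A'')
    (h6 : ∀ Q : Ideal A', Q.IsPrime → J.comap ι ≤ Q → F ∈ Q → c ≤ Q)
    (hG : ZGood (c.map ι) r J) (H : ZGood c r (J.comap ι) → ZSG A c r (J.comap ι)) : ZSG A (c.map ι) r J := by
  have hgood : ZGood c r (J.comap ι) := by
    obtain ⟨hG1, g, hgJ, hG2⟩ := hG
    have key : ∀ Q : Ideal A', Q.IsPrime → J.comap ι ≤ Q → ¬ c ≤ Q → F ∉ Q ∧ J ≤ Q.map ι ∧ ¬ c.map ι ≤ Q.map ι := by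
      intro Q hQ hJQ hcQ
      have hF : F ∉ Q := fun hF => hcQ (h6 Q hQ hJQ hF)
      refine ⟨hF, ?_, ?_⟩
      · rw [← h.map_comap J]; exact Ideal.map_mono hJQ
      · intro hle
        rw [Ideal.map_le_iff_le_comap, (h.prime Q hQ hF).2.1] at hle
        exact hcQ hle
    refine ⟨?_, ?_⟩
    · intro Q hQ hJQ hcQ
      obtain ⟨hF, h1, h2⟩ := key Q hQ hJQ hcQ
      obtain ⟨p1, p2, p3⟩ := h.prime Q hQ hF
      rw [← p3]
      exact hG1 _ p1 h1 h2
    · have : ∀ i, ∃ (n : ℕ) (p : A'), ι F ^ n * g i = ι p := fun i => h.2.1 _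
      choose n p hp using this
      have hspan : Ideal.span (Set.range g) ≤ (Ideal.span (Set.range p)).map ι := by
        rw [Ideal.span_le]
        rintro _ ⟨i, rfl⟩
        rw [SetLike.mem_coe, ← h.unit_mem _ (n i), hp]
        exact Ideal.mem_map_of_mem _ (Ideal.subset_span ⟨i, rfl⟩)
      refine ⟨p, fun i => ?_, ?_⟩
      · rw [Ideal.mem_comap, ← hp]; exact J.mul_mem_left _ (hgJ i)
      · intro Q hQ hJQ hcQ a ha
        obtain ⟨hF, h1, h2⟩ := key Q hQ hJQ hcQ
        obtain ⟨p1, p2, p3⟩ := h.prime Q hQ hF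
        obtain ⟨u, hu, hua⟩ := hG2 _ p1 h1 h2 (ι a) ha
        obtain ⟨k, v, hv⟩ := h.2.1 u
        have hvQ : v ∉ Q := by
          intro hvQ
          exact hu ((h.unit_mem _ k _).1 (hv ▸ Ideal.mem_map_of_mem ι hvQ))
        have : ι (v * a) ∈ (Ideal.span (Set.range p)).map ι := by
          rw [map_mul, ← hv, mul_assoc]
          exact Ideal.mul_mem_left _ _ (hspan hua)
        obtain ⟨k', hk'⟩ := h.clear _ _ this
        refine ⟨F ^ k' * v, ?_, by rw [mul_assoc]; exact hk'⟩
        intro hcon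
        exact (hQ.mem_or_mem hcon).elim (fun h' => hF (hQ.mem_of_pow_mem _ h')) hvQ
  intro j hj
  rw [Ideal.map_map] at hj
  obtain ⟨G, hGr⟩ := H hgood (j.comp ι) hj
  refine ⟨G, ?_⟩
  rw [← hGr, ← Ideal.map_map, h.map_comap]

theorem zgood_equiv {A' A'' : Type*} [CommRing A'] [CommRing A''] (σ : A' ≃+* A'')
    (c : Ideal A') (r : ℕ) (J : Ideal A') (hG : ZGood c r J) : ZGood (c.map (σ : A' →+* A'')) r (J.map (σ : A' →+* A'')) := by
  obtain ⟨hG1, g, hgJ, hG2⟩ := hG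
  refine ⟨?_, fun i => σ (g i), fun i => Ideal.mem_map_of_mem (σ : A' →+* A'') (hgJ i), ?_⟩
  · intro Q hQ hJ hc
    rw [Ideal.map_le_iff_le_comap] at hJ hc
    rw [← RingEquiv.height_comap σ]
    exact hG1 _ inferInstance hJ hc
  · intro Q hQ hJ hc a ha
    rw [Ideal.map_le_iff_le_comap] at hJ hc
    obtain ⟨b, hb, rfl⟩ := (Ideal.mem_map_of_equiv σ a).1 ha
    obtain ⟨u, hu, hub⟩ := hG2 _ inferInstance hJ hc b hb
    refine ⟨σ u, hu, ?_⟩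
    have := Ideal.mem_map_of_mem (σ : A' →+* A'') hub
    rw [Ideal.map_span, ← Set.range_comp] at this
    rw [← map_mul]
    exact this

theorem zSG_equiv {A A' A'' : Type*} [CommRing A] [CommRing A'] [CommRing A''] (σ : A' ≃+* A'')
    (c : Ideal A') (r : ℕ) (J : Ideal A')
    (H : ZSG A (c.map (σ : A' →+* A'')) r (J.map (σ : A' →+* A''))) : ZSG A c r J := by
  intro j hj
  have e : (j.comp (σ.symm : A'' →+* A')).comp (σ : A' →+* A'') = j := by ext x; simp
  obtain ⟨G, hG⟩ := H (j.comp (σ.symm : A'' →+* A')) (by rw [Ideal.map_map, e, hj])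
  exact ⟨G, by rw [← hG, Ideal.map_map, e]⟩

/-- Core lemma. -/
theorem zcore {K : Type*} [CommRing K] [IsNoetherianRing K] (c : Ideal K) (r : ℕ) (f : K) (J0 : Ideal (Polynomial K))
    (hK : ∀ P : Ideal K, P.IsPrime → ¬ c ≤ P → P.height ≤ r)
    (hmin : ∀ P ∈ J0.minimalPrimes, ¬ c ≤ P.comap Polynomial.C → (r : ℕ∞) ≤ P.height) (x : K) (hx : x ∈ c) :
    ∃ (k : ℕ) (l b : K) (j : ℕ) (ψ : Polynomial K), ψ ∈ J0 ∧ x ^ k = l + f * b ∧ ψ.leadingCoeff = f ^ j * l := by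
  let L : Ideal K :=
    { carrier := {l | ∃ j : ℕ, f ^ j * l ∈ J0.leadingCoeff}
      zero_mem' := ⟨0, by simp⟩
      add_mem' := by
        rintro a b ⟨i, hi⟩ ⟨j, hj⟩
        refine ⟨i + j, ?_⟩
        have : f ^ (i + j) * (a + b) = f ^ j * (f ^ i * a) + f ^ i * (f ^ j * b) := by ring
        rw [this]
        exact Ideal.add_mem _ (Ideal.mul_mem_left _ _ hi) (Ideal.mul_mem_left _ _ hj)
      smul_mem' := by
        rintro s a ⟨i, hi⟩
        refine ⟨i, ?_⟩
        rw [smul_eq_mul, mul_left_comm]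
        exact Ideal.mul_mem_left _ _ hi }
  have hL : ∀ l, l ∈ L ↔ ∃ j : ℕ, f ^ j * l ∈ J0.leadingCoeff := fun l => Iff.rfl
  have hcl : c ≤ (L ⊔ Ideal.span {f}).radical := by
    rw [Ideal.radical_eq_sInf]
    refine le_sInf ?_
    rintro P ⟨hP, hPp⟩
    by_contra hcP
    have hLP : L ≤ P := le_sup_left.trans hP
    have hfP : f ∈ P := hP (Ideal.mem_sup_right (Ideal.subset_span rfl))
    obtain ⟨P0, p0, h1, h2, h3⟩ := zsat_prime L f (by
      rintro y ⟨j, hj⟩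
      exact ⟨j + 1, by rw [pow_succ, mul_assoc]; exact hj⟩) P hLP
    obtain ⟨PP, hPP, hPPc, hPPh⟩ := zHL J0 P0 (fun l hl => h1 ⟨0, by simpa using hl⟩)
    have a1 := hmin PP hPP (fun hle => hcP (hle.trans (hPPc.trans h2)))
    have lt : P0 < P := lt_of_le_of_ne h2 fun h => h3 (h ▸ hfP)
    have a2 := Ideal.height_add_one_le_of_lt_of_isPrime lt
    have a3 := hK P hPp hcP
    have : (r : ℕ∞) + 1 ≤ r := (add_le_add_left (a1.trans hPPh) 1).trans (a2.trans a3)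
    norm_cast at this
    omega
  obtain ⟨k, hk⟩ := hcl hx
  obtain ⟨l, hl, y, hy, hly⟩ := Submodule.mem_sup.1 hk
  obtain ⟨b, rfl⟩ := Ideal.mem_span_singleton'.1 hy
  obtain ⟨j, hj⟩ := (hL l).1 hl
  obtain ⟨ψ, hψ, hψl⟩ := (Ideal.mem_leadingCoeff _ _).1 hj
  exact ⟨k, l, b, j, ψ, hψ, by rw [← hly, mul_comm f], hψl⟩

theorem ZA.lift {P A D : Type*} [CommRing P] [CommRing A] [CommRing D] {ι : P →+* A} {F : P} (h : ZA ι F)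
    (τ : P →+* D) (hτ : IsUnit (τ F)) : ∃ σ : A →+* D, σ.comp ι = τ := by
  letI := ι.toAlgebra
  haveI := h.toAway
  exact ⟨IsLocalization.Away.lift F hτ, IsLocalization.Away.lift_comp F hτ⟩

theorem ZA.ext {P A D : Type*} [CommRing P] [CommRing A] [CommRing D] {ι : P →+* A} {F : P} (h : ZA ι F)
    (σ τ : A →+* D) (hh : σ.comp ι = τ.comp ι) : σ = τ := by
  letI := ι.toAlgebra
  haveI := h.toAway
  exact IsLocalization.ringHom_ext (Submonoid.powers F) hh

theorem ZA.equiv {P A D : Type*} [CommRing P] [CommRing A] [CommRing D] {ι : P →+* A} {F : P} (h : ZA ι F)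
    (σ : A ≃+* D) : ZA ((σ : A →+* D).comp ι) F := by
  refine ⟨h.1.map (σ : A →+* D), ?_, ?_⟩
  · intro a
    obtain ⟨n, p, hp⟩ := h.2.1 (σ.symm a)
    refine ⟨n, p, ?_⟩
    have := congrArg σ hp
    simpa using this
  · intro p hp
    exact h.2.2 p (by simpa using hp)

theorem ZA.equiv_left {P P' A : Type*} [CommRing P] [CommRing A] [CommRing P'] {ι : P →+* A} {F : P} (h : ZA ι F)
    (σ : P' ≃+* P) : ZA (ι.comp (σ : P' →+* P)) (σ.symm F) := by
  refine ⟨by simpa using h.1, ?_, ?_⟩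
  · intro a
    obtain ⟨n, p, hp⟩ := h.2.1 a
    exact ⟨n, σ.symm p, by simpa using hp⟩
  · intro p hp
    obtain ⟨n, hn⟩ := h.2.2 (σ p) (by simpa using hp)
    refine ⟨n, ?_⟩
    have := congrArg σ.symm hn
    simpa using this

/-- twisting by two mutually inverse substitutions -/
theorem ZA.twist {P A : Type*} [CommRing P] [CommRing A] {ι : P →+* A} {F : P} (h : ZA ι F)
    (σ τ : A →+* A) (h1 : (σ.comp τ).comp ι = ι) (h2 : (τ.comp σ).comp ι = ι) : ZA (σ.comp ι) F := by
  have e1 : σ.comp τ = RingHom.id A := h.ext _ _ (by rw [h1, RingHom.id_comp])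
  have e2 : τ.comp σ = RingHom.id A := h.ext _ _ (by rw [h2, RingHom.id_comp])
  exact h.equiv (RingEquiv.ofRingHom σ τ e1 e2)

section lemP
variable {K : Type*} [CommRing K]

theorem ztwist_add {A : Type*} [CommRing A] {ι : Polynomial K →+* A} {f : K}
    (h : ZA ι (Polynomial.C f)) (v : A) (w : K) (hv : v * ι (Polynomial.C w) = 1) :
    ZA (Polynomial.eval₂RingHom (ι.comp Polynomial.C) (ι Polynomial.X + v)) (Polynomial.C f) := by
  have hu : ∀ y, IsUnit (Polynomial.eval₂RingHom (ι.comp Polynomial.C) y (Polynomial.C f)) := fun y => by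
    simpa using h.1
  obtain ⟨σ, hσ⟩ := h.lift _ (hu (ι Polynomial.X + v))
  obtain ⟨τ, hτ⟩ := h.lift _ (hu (ι Polynomial.X - v))
  have hσC : ∀ k, σ (ι (Polynomial.C k)) = ι (Polynomial.C k) := fun k => by
    have := RingHom.congr_fun hσ (Polynomial.C k); simpa using this
  have hτC : ∀ k, τ (ι (Polynomial.C k)) = ι (Polynomial.C k) := fun k => by
    have := RingHom.congr_fun hτ (Polynomial.C k); simpa using this
  have hσX : σ (ι Polynomial.X) = ι Polynomial.X + v := by
    have := RingHom.congr_fun hσ Polynomial.X; simpa using this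
  have hτX : τ (ι Polynomial.X) = ι Polynomial.X - v := by
    have := RingHom.congr_fun hτ Polynomial.X; simpa using this
  have fixv : ∀ ρ : A →+* A, ρ (ι (Polynomial.C w)) = ι (Polynomial.C w) → ρ v = v := by
    intro ρ hρ
    have := congrArg ρ hv
    rw [map_mul, hρ, map_one] at this
    linear_combination v * this - ρ v * hv
  rw [← hσ]
  refine h.twist σ τ ?_ ?_
  · apply Polynomial.ringHom_ext
    · intro a; simp [hσC, hτC]
    · simp [hσX, hτX, fixv σ (hσC w)]
  · apply Polynomial.ringHom_ext
    · intro a; simp [hσC, hτC]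
    · simp [hσX, hτX, fixv τ (hτC w)]

theorem ztwist_mul {A : Type*} [CommRing A] {ι : Polynomial K →+* A} {f : K}
    (h : ZA ι (Polynomial.X * Polynomial.C f)) (v : A) (w : K) (hv : v * ι (Polynomial.C w) = 1) :
    ZA (Polynomial.eval₂RingHom (ι.comp Polynomial.C) (ι Polynomial.X * ι (Polynomial.C w))) (Polynomial.X * Polynomial.C f) := by
  have h1 := h.1
  rw [map_mul, IsUnit.mul_iff] at h1
  have hwu : IsUnit (ι (Polynomial.C w)) := IsUnit.of_mul_eq_one _ (by rw [mul_comm]; exact hv)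
  have hvu : IsUnit v := IsUnit.of_mul_eq_one _ hv
  obtain ⟨σ, hσ⟩ := h.lift (Polynomial.eval₂RingHom (ι.comp Polynomial.C) (ι Polynomial.X * ι (Polynomial.C w))) (by
    have := (h1.1.mul hwu).mul h1.2
    simpa only [Polynomial.coe_eval₂RingHom, Polynomial.eval₂_mul, Polynomial.eval₂_X, Polynomial.eval₂_C, RingHom.comp_apply] using this)
  obtain ⟨τ, hτ⟩ := h.lift (Polynomial.eval₂RingHom (ι.comp Polynomial.C) (ι Polynomial.X * v)) (by
    have := (h1.1.mul hvu).mul h1.2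
    simpa only [Polynomial.coe_eval₂RingHom, Polynomial.eval₂_mul, Polynomial.eval₂_X, Polynomial.eval₂_C, RingHom.comp_apply] using this)
  have hσC : ∀ k, σ (ι (Polynomial.C k)) = ι (Polynomial.C k) := fun k => by
    have := RingHom.congr_fun hσ (Polynomial.C k); simpa using this
  have hτC : ∀ k, τ (ι (Polynomial.C k)) = ι (Polynomial.C k) := fun k => by
    have := RingHom.congr_fun hτ (Polynomial.C k); simpa using this
  have hσX : σ (ι Polynomial.X) = ι Polynomial.X * ι (Polynomial.C w) := by
    have := RingHom.congr_fun hσ Polynomial.X; simpa using this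
  have hτX : τ (ι Polynomial.X) = ι Polynomial.X * v := by
    have := RingHom.congr_fun hτ Polynomial.X; simpa using this
  have fixv : ∀ ρ : A →+* A, ρ (ι (Polynomial.C w)) = ι (Polynomial.C w) → ρ v = v := by
    intro ρ hρ
    have := congrArg ρ hv
    rw [map_mul, hρ, map_one] at this
    linear_combination v * this - ρ v * hv
  rw [← hσ]
  refine h.twist σ τ ?_ ?_
  · apply Polynomial.ringHom_ext
    · intro a; simp [hσC, hτC]
    · simp only [RingHom.comp_apply, hσX, hτX, fixv σ (hσC w), map_mul]
      linear_combination ι Polynomial.X * hv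
  · apply Polynomial.ringHom_ext
    · intro a; simp [hσC, hτC]
    · simp only [RingHom.comp_apply, hσX, hτX, hτC w, map_mul]
      linear_combination ι Polynomial.X * hv

/-- common computation -/
theorem zscale {A : Type*} [CommRing A] (η : K →+* A) (f : K) (ψ : Polynomial K) (l : K) (j N : ℕ) (hN : j + 1 ≤ N)
    (hl : ψ.leadingCoeff = f ^ j * l) (x y : A) (hxy : η f ^ N * x = y) :
    η f ^ j * (η l * y ^ ψ.natDegree + ∑ i ∈ Finset.range ψ.natDegree,
      η (ψ.coeff i * f ^ (N * (ψ.natDegree - i) - j)) * y ^ i) = η f ^ (N * ψ.natDegree) * ψ.eval₂ η x := by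
  rw [Polynomial.eval₂_eq_sum_range, Finset.sum_range_succ, mul_add, mul_add, add_comm]
  have h1 : η f ^ j * (η l * y ^ ψ.natDegree) = η f ^ (N * ψ.natDegree) * (η (ψ.coeff ψ.natDegree) * x ^ ψ.natDegree) := by
    have : ψ.coeff ψ.natDegree = f ^ j * l := hl
    rw [this, ← hxy, map_mul, map_pow, mul_pow, ← pow_mul]
    ring
  rw [h1]
  congr 1
  rw [Finset.mul_sum, Finset.mul_sum]
  refine Finset.sum_congr rfl fun i hi => ?_
  rw [Finset.mem_range] at hi
  have h2 : N * ψ.natDegree = j + (N * (ψ.natDegree - i) - j) + N * i := by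
    have h3 : N * (ψ.natDegree - i) + N * i = N * ψ.natDegree := by
      rw [← mul_add]; congr 1; omega
    have h4 : N ≤ N * (ψ.natDegree - i) := Nat.le_mul_of_pos_right _ (by omega)
    omega
  rw [h2, ← hxy, map_mul, map_pow, mul_pow, ← pow_mul, pow_add, pow_add]
  ring

theorem zscale_mem {D : Type*} [CommRing D] (η : K →+* D) (f : K) (ψ : Polynomial K) (l : K) (j N : ℕ) (hN : j + 1 ≤ N) (y : D)
    (Q : Ideal D) (hf : η f ∈ Q)
    (h : η l * y ^ ψ.natDegree + ∑ i ∈ Finset.range ψ.natDegree,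
      η (ψ.coeff i * f ^ (N * (ψ.natDegree - i) - j)) * y ^ i ∈ Q) : η l * y ^ ψ.natDegree ∈ Q := by
  refine (Ideal.add_mem_iff_left _ (Ideal.sum_mem _ fun i hi => ?_)).1 h
  rw [Finset.mem_range] at hi
  have h4 : N ≤ N * (ψ.natDegree - i) := Nat.le_mul_of_pos_right _ (by omega)
  rw [map_mul, map_pow]
  exact Q.mul_mem_right _ (Q.mul_mem_left _ (Ideal.pow_mem_of_mem _ hf _ (by omega)))

theorem zcoreN [IsNoetherianRing K] (c : Ideal K) (r : ℕ) (f : K) (J0 : Ideal (Polynomial K))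
    (hK : ∀ P : Ideal K, P.IsPrime → ¬ c ≤ P → P.height ≤ r)
    (hmin : ∀ P ∈ J0.minimalPrimes, ¬ c ≤ P.comap Polynomial.C → (r : ℕ∞) ≤ P.height) :
    ∃ N : ℕ, ∃ T : Set K, Ideal.span T = c ∧ ∀ x ∈ T, 
      ∃ (k : ℕ) (l b : K) (j : ℕ) (ψ : Polynomial K), ψ ∈ J0 ∧ x ^ k = l + f * b ∧ ψ.leadingCoeff = f ^ j * l ∧ j + 1 ≤ N := by
  obtain ⟨T, hT⟩ := (isNoetherianRing_iff_ideal_fg K).1 inferInstance c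
  have : ∀ x : T, ∃ (j k : ℕ) (l b : K) (ψ : Polynomial K), ψ ∈ J0 ∧ (x : K) ^ k = l + f * b ∧ ψ.leadingCoeff = f ^ j * l := by
    intro x
    obtain ⟨k, l, b, j, ψ, h⟩ := zcore c r f J0 hK hmin x (hT ▸ Ideal.subset_span x.2)
    exact ⟨j, k, l, b, ψ, h⟩
  choose j hj using this
  refine ⟨Finset.univ.sup j + 1, T, hT, fun x hx => ?_⟩
  obtain ⟨k, l, b, ψ, h1, h2, h3⟩ := hj ⟨x, hx⟩
  exact ⟨k, l, b, _, ψ, h1, h2, h3, Nat.succ_le_succ (Finset.le_sup (Finset.mem_univ _))⟩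

theorem ZA.good_min {P A : Type*} [CommRing P] [CommRing A] {ι : P →+* A} {F : P} (h : ZA ι F) (c : Ideal P) (r : ℕ)
    (J : Ideal A) (hG : ZGood (c.map ι) r J) : ∀ Q ∈ (J.comap ι).minimalPrimes, ¬ c ≤ Q → (r : ℕ∞) ≤ Q.height := by
  intro Q hQ hc
  have hF := h.minimal J Q hQ
  obtain ⟨p1, p2, p3⟩ := h.prime Q hQ.1.1 hF
  rw [← p3]
  refine hG.1 _ p1 ?_ ?_
  · rw [← h.map_comap J]; exact Ideal.map_mono hQ.1.2
  · intro hle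
    rw [Ideal.map_le_iff_le_comap, p2] at hle
    exact hc hle

theorem zlemP [IsNoetherianRing K] {A A'' : Type*} [CommRing A] [CommRing A''] (c : Ideal K) (r : ℕ) (f : K)
    (hK : ∀ P : Ideal K, P.IsPrime → ¬ c ≤ P → P.height ≤ r)
    (ι : Polynomial K →+* A'') (h : ZA ι (Polynomial.C f)) (J : Ideal A'')
    (hG : ZGood ((c.map Polynomial.C).map ι) r J)
    (H : ∀ J0 : Ideal (Polynomial K), ZGood (c.map Polynomial.C) r J0 → ZSG A (c.map Polynomial.C) r J0) :
    ZSG A ((c.map Polynomial.C).map ι) r J := by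
  obtain ⟨N, T, hT, hN⟩ := zcoreN c r f (J.comap ι) hK (fun P hP hc => h.good_min _ r J hG P hP (by
    rwa [Ideal.map_le_iff_le_comap]))
  obtain ⟨v, hv⟩ := (h.1.pow N).exists_left_inv
  have hv' : v * ι (Polynomial.C (f ^ N)) = 1 := by rw [map_pow, map_pow, hv]
  have h' := ztwist_add h v (f ^ N) hv'
  set ι' := Polynomial.eval₂RingHom (ι.comp Polynomial.C) (ι Polynomial.X + v) with hι'
  have hC : ∀ k, ι' (Polynomial.C k) = ι (Polynomial.C k) := fun k => by simp [hι']
  have hX : ι' Polynomial.X = ι Polynomial.X + v := by simp [hι']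
  have hc : (c.map Polynomial.C).map ι = (c.map Polynomial.C).map ι' := by
    rw [Ideal.map_map, Ideal.map_map]
    congr 1
    ext k; simp [hC]
  rw [hc] at hG ⊢
  refine zdescent h' _ r J ?_ hG (H _)
  intro Q hQ hJQ hfQ
  rw [Ideal.map_le_iff_le_comap, ← hT, Ideal.span_le]
  intro x hx
  obtain ⟨k, l, b, j, ψ, hψ, hxk, hlc, hjN⟩ := hN x hx
  have e := zscale (ι'.comp Polynomial.C) f ψ l j N hjN hlc (ι Polynomial.X)
    (ι' (Polynomial.C (f ^ N) * Polynomial.X - 1)) (by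
      simp only [RingHom.comp_apply, map_sub, map_mul, hX, map_one, hC]
      rw [← map_pow, ← map_pow]
      linear_combination - hv')
  have e2 : ψ.eval₂ (ι'.comp Polynomial.C) (ι Polynomial.X) = ι ψ := by
    have : Polynomial.eval₂RingHom (ι'.comp Polynomial.C) (ι Polynomial.X) = ι := by
      apply Polynomial.ringHom_ext
      · intro a; simp [hC]
      · simp
    exact RingHom.congr_fun this ψ
  have hmem : Polynomial.C l * (Polynomial.C (f ^ N) * Polynomial.X - 1) ^ ψ.natDegree +
      ∑ i ∈ Finset.range ψ.natDegree, Polynomial.C (ψ.coeff i * f ^ (N * (ψ.natDegree - i) - j)) *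
        (Polynomial.C (f ^ N) * Polynomial.X - 1) ^ i ∈ Q := by
    apply hJQ
    rw [Ideal.mem_comap, ← h'.unit_mem J j]
    rw [e2] at e
    have := J.mul_mem_left ((ι'.comp Polynomial.C) f ^ (N * ψ.natDegree)) hψ
    rw [← e] at this
    convert this using 2
    all_goals simp only [map_add, map_mul, map_sum, map_pow, map_sub, map_one, RingHom.comp_apply]
  have h3 := zscale_mem Polynomial.C f ψ l j N hjN _ Q hfQ hmem
  have h4 : Polynomial.C l ∈ Q := by
    refine (hQ.mem_or_mem h3).resolve_right fun h5 => ?_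
    have h5 := hQ.mem_of_pow_mem _ h5
    have h6 : Polynomial.C (f ^ N) * Polynomial.X ∈ Q := by
      rw [map_pow]
      exact Q.mul_mem_right _ (Ideal.pow_mem_of_mem _ hfQ _ (by omega))
    have h7 := Q.sub_mem h6 h5
    rw [sub_sub_cancel] at h7
    exact hQ.ne_top ((Ideal.eq_top_iff_one _).2 h7)
  refine hQ.mem_of_pow_mem k ?_
  rw [← map_pow, hxk, map_add, map_mul]
  exact Q.add_mem h4 (Q.mul_mem_right _ hfQ)

theorem zlemL [IsNoetherianRing K] {A A'' A1 : Type*} [CommRing A] [CommRing A''] [CommRing A1] (c : Ideal K) (r : ℕ) (f : K)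
    (hK : ∀ P : Ideal K, P.IsPrime → ¬ c ≤ P → P.height ≤ r)
    (ι : Polynomial K →+* A'') (h : ZA ι (Polynomial.X * Polynomial.C f)) (J : Ideal A'')
    (κ : Polynomial K →+* A1) (hκ : ZA κ Polynomial.X)
    (hG : ZGood ((c.map Polynomial.C).map ι) r J)
    (H : ∀ J0 : Ideal A1, ZGood ((c.map Polynomial.C).map κ) r J0 → ZSG A ((c.map Polynomial.C).map κ) r J0) :
    ZSG A ((c.map Polynomial.C).map ι) r J := by
  obtain ⟨N, T, hT, hN⟩ := zcoreN c r f (J.comap ι) hK (fun P hP hc => h.good_min _ r J hG P hP (by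
    rwa [Ideal.map_le_iff_le_comap]))
  have hu := h.1
  rw [map_mul, IsUnit.mul_iff] at hu
  obtain ⟨v, hv⟩ := (hu.2.pow N).exists_left_inv
  have hv' : v * ι (Polynomial.C (f ^ N)) = 1 := by rw [map_pow, map_pow, hv]
  have h' := ztwist_mul h v (f ^ N) hv'
  set ι' := Polynomial.eval₂RingHom (ι.comp Polynomial.C) (ι Polynomial.X * ι (Polynomial.C (f ^ N))) with hι'
  have hC : ∀ k, ι' (Polynomial.C k) = ι (Polynomial.C k) := fun k => by simp [hι']
  have hX : ι' Polynomial.X = ι Polynomial.X * ι (Polynomial.C (f ^ N)) := by simp [hι']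
  have hu' := h'.1
  rw [map_mul, IsUnit.mul_iff] at hu'
  obtain ⟨ι1, hι1⟩ := hκ.lift ι' hu'.1
  have hι1' : ∀ p, ι1 (κ p) = ι' p := fun p => by rw [← hι1]; rfl
  have h1 : ZA ι1 (κ (Polynomial.C f)) := by
    have := ZA.step (s := Polynomial.C f) (κ := Polynomial.X) hκ (by rw [mul_comm]; exact h') ι1 hι1
    exact ⟨by rw [hι1']; exact hu'.2, this.1, this.2⟩
  have hc : (c.map Polynomial.C).map ι = ((c.map Polynomial.C).map κ).map ι1 := by
    rw [Ideal.map_map, Ideal.map_map, Ideal.map_map]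
    congr 1
    ext k; simp [hC, hι1']
  rw [hc] at hG ⊢
  refine zdescent h1 _ r J ?_ hG (H _)
  intro Q hQ hJQ hfQ
  rw [Ideal.map_map, Ideal.map_le_iff_le_comap, ← hT, Ideal.span_le]
  intro x hx
  obtain ⟨k, l, b, j, ψ, hψ, hxk, hlc, hjN⟩ := hN x hx
  have e := zscale (ι'.comp Polynomial.C) f ψ l j N hjN hlc (ι Polynomial.X)
    (ι' Polynomial.X) (by
      simp only [RingHom.comp_apply, hX, hC]
      rw [← map_pow, ← map_pow, mul_comm])
  have e2 : ψ.eval₂ (ι'.comp Polynomial.C) (ι Polynomial.X) = ι ψ := by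
    have : Polynomial.eval₂RingHom (ι'.comp Polynomial.C) (ι Polynomial.X) = ι := by
      apply Polynomial.ringHom_ext
      · intro a; simp [hC]
      · simp
    exact RingHom.congr_fun this ψ
  have hmem : (κ.comp Polynomial.C) l * (κ Polynomial.X) ^ ψ.natDegree +
      ∑ i ∈ Finset.range ψ.natDegree, (κ.comp Polynomial.C) (ψ.coeff i * f ^ (N * (ψ.natDegree - i) - j)) *
        (κ Polynomial.X) ^ i ∈ Q := by
    apply hJQ
    rw [Ideal.mem_comap, ← h1.unit_mem J j]
    rw [e2] at e
    have := J.mul_mem_left ((ι'.comp Polynomial.C) f ^ (N * ψ.natDegree)) hψ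
    rw [← e] at this
    convert this using 2
    · simp [hι1']
    · simp only [map_add, map_mul, map_sum, map_pow, map_sub, map_one, RingHom.comp_apply, hι1']
  have h3 := zscale_mem (κ.comp Polynomial.C) f ψ l j N hjN _ Q hfQ hmem
  have h4 : (κ.comp Polynomial.C) l ∈ Q := by
    refine (hQ.mem_or_mem h3).resolve_right fun h5 => ?_
    exact hQ.ne_top (Ideal.eq_top_of_isUnit_mem _ (hQ.mem_of_pow_mem _ h5) hκ.1)
  refine hQ.mem_of_pow_mem k ?_
  rw [← map_pow, hxk, map_add, map_mul]
  exact Q.add_mem h4 (Q.mul_mem_right _ hfQ)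

end lemP

section last
variable {E : Type*} [CommRing E]

theorem zLL [IsNoetherianRing E] (c : Ideal E) (r : ℕ)
    (h1 : ∀ p : Ideal E, p.IsPrime → ¬ c ≤ p → p.height + 1 ≤ r)
    (J0 : Ideal (Polynomial (Polynomial E)))
    (h2 : ∀ Q : Ideal (Polynomial (Polynomial E)), Q.IsPrime → J0 ≤ Q → ¬ (c.map Polynomial.C).map Polynomial.C ≤ Q → (r : ℕ∞) ≤ Q.height)
    (x : E) (hx : x ∈ c) : ∃ (k : ℕ) (φ : Polynomial (Polynomial E)), φ ∈ J0 ∧ φ.leadingCoeff.leadingCoeff = x ^ k := by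
  have hcl : c ≤ (J0.leadingCoeff.leadingCoeff).radical := by
    rw [Ideal.radical_eq_sInf]
    refine le_sInf ?_
    rintro p ⟨hP, hp⟩
    by_contra hcp
    obtain ⟨P, hP1, hP2, hP3⟩ := zHL J0.leadingCoeff p hP
    have := hP1.1.1
    obtain ⟨Q, hQ1, hQ2, hQ3⟩ := zHL J0 P hP1.1.2
    have a1 := h2 Q hQ1.1.1 hQ1.1.2 (by
      rw [Ideal.map_le_iff_le_comap, Ideal.map_le_iff_le_comap]
      exact fun hle => hcp (hle.trans ((Ideal.comap_mono hQ2).trans hP2)))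
    have a2 := h1 p hp hcp
    have : (r : ℕ∞) + 1 ≤ r := (add_le_add_left (a1.trans (hQ3.trans hP3)) 1).trans a2
    norm_cast at this
    omega
  obtain ⟨k, hk⟩ := hcl hx
  obtain ⟨p, hp, hpl⟩ := (Ideal.mem_leadingCoeff _ _).1 hk
  obtain ⟨φ, hφ, hφl⟩ := (Ideal.mem_leadingCoeff _ _).1 hp
  exact ⟨k, φ, hφ, by rw [hφl, hpl]⟩

theorem zchoose [IsNoetherianRing E] (c : Ideal E) (k : ℕ) : ∃ l : Fin k → E, (∀ i, l i ∈ c) ∧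
    ∀ p : Ideal E, p.IsPrime → (∀ i, l i ∈ p) → ¬ c ≤ p → (k : ℕ∞) ≤ p.height := by
  induction k with
  | zero => exact ⟨Fin.elim0, fun i => i.elim0, fun p _ _ _ => by simp⟩
  | succ k ih =>
    obtain ⟨l, hl, hl2⟩ := ih
    let T := {Q ∈ (Ideal.span (Set.range l)).minimalPrimes | ¬ c ≤ Q}
    obtain ⟨F, hF, hF2⟩ := zz_avoid_ideal T ((Ideal.finite_minimalPrimes_of_isNoetherianRing _ _).subset fun Q hQ => hQ.1)
      (fun Q hQ => hQ.1.1.1) c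
    obtain ⟨y, hy, hy2⟩ := hF2 0 (fun Q hQ => Or.inr hQ.2)
    refine ⟨Fin.cons y l, ?_, ?_⟩
    · intro i
      refine Fin.cases ?_ (fun i => ?_) i
      · exact hF y hy
      · exact hl i
    · intro p hp hlp hcp
      have hlp' : Ideal.span (Set.range l) ≤ p := by
        rw [Ideal.span_le]
        rintro _ ⟨i, rfl⟩
        have := hlp i.succ
        rwa [Fin.cons_succ] at this
      obtain ⟨Q, hQ, hQp⟩ := Ideal.exists_minimalPrimes_le hlp'
      have pQ := hQ.1.1
      have hcQ : ¬ c ≤ Q := fun h => hcp (h.trans hQp)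
      have a1 := hl2 Q hQ.1.1 (fun i => hQ.1.2 (Ideal.subset_span ⟨i, rfl⟩)) hcQ
      have h0 := hlp 0
      rw [Fin.cons_zero] at h0
      have a2 := hy2 Q ⟨hQ, hcQ⟩
      rw [zero_add] at a2
      have lt : Q < p := lt_of_le_of_ne hQp fun h => a2 (h ▸ h0)
      have a3 := Ideal.height_add_one_le_of_lt_of_isPrime lt
      push_cast
      exact (add_le_add_left a1 1).trans a3

/-- `E[Z][W] ≃ E[W][Z]`, `W ↦ W + Z^M`. -/
def ztau (E : Type*) [CommRing E] (M : ℕ) : Polynomial (Polynomial E) ≃+* Polynomial (Polynomial E) :=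
  RingEquiv.ofRingHom
    (Polynomial.eval₂RingHom (Polynomial.mapRingHom Polynomial.C) (Polynomial.C Polynomial.X + Polynomial.X ^ M))
    (Polynomial.eval₂RingHom (Polynomial.eval₂RingHom (Polynomial.C.comp Polynomial.C) (Polynomial.X - Polynomial.C (Polynomial.X ^ M))) 
      (Polynomial.C Polynomial.X))
    (by
      apply Polynomial.ringHom_ext'
      · apply Polynomial.ringHom_ext'
        · ext a; simp
        · simp [Polynomial.eval₂_pow]
      · simp)
    (by
      apply Polynomial.ringHom_ext'
      · apply Polynomial.ringHom_ext'
        · ext a; simp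
        · simp
      · simp)

theorem ztau_apply (M : ℕ) (φ : Polynomial (Polynomial E)) : ztau E M φ =
    φ.eval₂ (Polynomial.mapRingHom Polynomial.C) (Polynomial.C Polynomial.X + Polynomial.X ^ M) := rfl

theorem ztau_CC (M : ℕ) (a : E) : ztau E M (Polynomial.C (Polynomial.C a)) = Polynomial.C (Polynomial.C a) := by
  simp [ztau_apply]

theorem ztau_coeff (M : ℕ) (φ : Polynomial (Polynomial E)) (hM : ∀ i, (φ.coeff i).natDegree < M) (lam : E)
    (hφ : φ.leadingCoeff.leadingCoeff = lam) : ∃ N, (ztau E M φ).natDegree ≤ N ∧ (ztau E M φ).coeff N = Polynomial.C lam := by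
  have hb : (Polynomial.C Polynomial.X + Polynomial.X ^ M : Polynomial (Polynomial E)).natDegree ≤ M := by
    refine Polynomial.natDegree_add_le_of_degree_le (by simp) (Polynomial.natDegree_X_pow_le _)
  have hbc : (Polynomial.C Polynomial.X + Polynomial.X ^ M : Polynomial (Polynomial E)).coeff M = 1 := by
    have : 0 < M := lt_of_le_of_lt (Nat.zero_le _) (hM 0)
    rw [Polynomial.coeff_add, Polynomial.coeff_C_of_ne_zero (by omega), Polynomial.coeff_X_pow_self, zero_add]
  set b := (Polynomial.C Polynomial.X + Polynomial.X ^ M : Polynomial (Polynomial E)) with hbdef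
  have hterm : ∀ i, ((Polynomial.mapRingHom Polynomial.C (φ.coeff i)) * b ^ i).natDegree ≤ (φ.coeff i).natDegree + i * M := by
    intro i
    refine Polynomial.natDegree_mul_le_of_le (Polynomial.natDegree_map_le) ?_
    exact Polynomial.natDegree_pow_le_of_le i hb
  let n := φ.natDegree
  let m := φ.leadingCoeff.natDegree
  have hm : m < M := hM _
  have hlow : (∑ i ∈ Finset.range n, (Polynomial.mapRingHom Polynomial.C (φ.coeff i)) * b ^ i).natDegree ≤ n * M - 1 := by
    refine Polynomial.natDegree_sum_le_of_forall_le _ _ fun i hi => ?_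
    rw [Finset.mem_range] at hi
    refine (hterm i).trans ?_
    have h1 := hM i
    have h2 : (i + 1) * M ≤ n * M := Nat.mul_le_mul_right _ hi
    rw [add_mul] at h2
    omega
  refine ⟨m + n * M, ?_, ?_⟩
  · rw [ztau_apply, Polynomial.eval₂_eq_sum_range, Finset.sum_range_succ]
    refine Polynomial.natDegree_add_le_of_degree_le (hlow.trans (by omega)) (hterm _)
  · rw [ztau_apply, Polynomial.eval₂_eq_sum_range, Finset.sum_range_succ, Polynomial.coeff_add]
    have hz : (∑ i ∈ Finset.range n, (Polynomial.mapRingHom Polynomial.C (φ.coeff i)) * b ^ i).coeff (m + n * M) = 0 := by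
      rcases Nat.eq_zero_or_pos n with h0 | h0
      · rw [h0]; simp
      · apply Polynomial.coeff_eq_zero_of_natDegree_lt
        have : 0 < n * M := Nat.mul_pos h0 (by omega)
        omega
    change (∑ i ∈ Finset.range n, (Polynomial.mapRingHom Polynomial.C (φ.coeff i)) * b ^ i).coeff (m + n * M) + _ = _
    rw [hz, zero_add]
    have hp : (b ^ n).natDegree ≤ n * M := Polynomial.natDegree_pow_le_of_le n hb
    have h3 : (Polynomial.mapRingHom (Polynomial.C : E →+* Polynomial E) (φ.coeff φ.natDegree)).natDegree ≤ m := Polynomial.natDegree_map_le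
    rw [Polynomial.coeff_mul_add_eq_of_natDegree_le h3 hp, mul_comm n M, mul_comm M n]
    have h4 : (b ^ n).coeff (n * M) = 1 := by
      rw [Polynomial.coeff_pow_of_natDegree_le hb, hbc, one_pow]
    rw [h4, mul_one, Polynomial.coe_mapRingHom, Polynomial.coeff_map, ← hφ]
    rfl

theorem ztau_exists (E : Type*) [CommRing E] (M : ℕ) : ∃ σ : Polynomial (Polynomial E) ≃+* Polynomial (Polynomial E),
    (∀ a, σ (Polynomial.C (Polynomial.C a)) = Polynomial.C (Polynomial.C a)) ∧
    ∀ φ : Polynomial (Polynomial E), (∀ i, (φ.coeff i).natDegree < M) → 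
      ∃ N, (σ φ).natDegree ≤ N ∧ (σ φ).coeff N = Polynomial.C φ.leadingCoeff.leadingCoeff :=
  ⟨ztau E M, ztau_CC M, fun φ h => ztau_coeff M φ h _ rfl⟩

theorem zmapcc {E P Q : Type*} [CommRing E] [CommRing P] [CommRing Q] (c : Ideal E) (e : E →+* P) (e' : E →+* Q)
   (σ : P →+* Q) (h : ∀ a, σ (e a) = e' a) : (c.map e).map σ = c.map e' := by
  rw [Ideal.map_map]
  congr 1
  ext1 a
  exact h a

def zswap (E : Type*) [CommRing E] : Polynomial (Polynomial E) ≃+* Polynomial (Polynomial E) :=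
  RingEquiv.ofRingHom
    (Polynomial.eval₂RingHom (Polynomial.mapRingHom Polynomial.C) (Polynomial.C Polynomial.X))
    (Polynomial.eval₂RingHom (Polynomial.mapRingHom Polynomial.C) (Polynomial.C Polynomial.X))
    (by
      apply Polynomial.ringHom_ext'
      · apply Polynomial.ringHom_ext'
        · ext a; simp
        · simp
      · simp)
    (by
      apply Polynomial.ringHom_ext'
      · apply Polynomial.ringHom_ext'
        · ext a; simp
        · simp
      · simp)

theorem zswap_exists (E : Type*) [CommRing E] : ∃ σ : Polynomial (Polynomial E) ≃+* Polynomial (Polynomial E),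
    (∀ a, σ (Polynomial.C (Polynomial.C a)) = Polynomial.C (Polynomial.C a)) ∧
    σ Polynomial.X = Polynomial.C Polynomial.X ∧ σ (Polynomial.C Polynomial.X) = Polynomial.X ∧
    (∀ p, σ (p.map Polynomial.C) = Polynomial.C p) ∧ ∀ p, σ (Polynomial.C p) = p.map Polynomial.C := by
  have h : ∀ p : Polynomial E, zswap E (p.map Polynomial.C) = Polynomial.C p := by
    intro p
    have : ((zswap E : Polynomial (Polynomial E) →+* Polynomial (Polynomial E)).comp (Polynomial.mapRingHom Polynomial.C)) = Polynomial.C := by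
      apply Polynomial.ringHom_ext'
      · ext a; simp [zswap]
      · simp [zswap]
    exact RingHom.congr_fun this p
  refine ⟨zswap E, ?_, ?_, ?_, h, ?_⟩
  all_goals simp [zswap]

theorem zlast [IsNoetherianRing E] {A : Type*} [CommRing A] (c : Ideal E) (r : ℕ) (hr : 3 ≤ r)
    (h1 : ∀ p : Ideal E, p.IsPrime → ¬ c ≤ p → p.height + 1 ≤ r)
    (J0 : Ideal (Polynomial (Polynomial E)))
    (hG : ZGood ((c.map Polynomial.C).map Polynomial.C) r J0) : ZSG A ((c.map Polynomial.C).map Polynomial.C) r J0 := by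
  obtain ⟨l, hl, hl2⟩ := zchoose c r
  have hl3 : ∀ p : Ideal E, p.IsPrime → ¬ c ≤ p → ∃ i, l i ∉ p := by
    intro p hp hcp
    by_contra hcon
    push Not at hcon
    have a1 := hl2 p hp hcon hcp
    have : (r : ℕ∞) + 1 ≤ r := (add_le_add_left a1 1).trans (h1 p hp hcp)
    norm_cast at this
    omega
  have := fun i => zLL c r h1 J0 hG.1 (l i) (hl i)
  choose k φ hφ hφl using this
  let M := Finset.univ.sup (fun i => (φ i).support.sup fun n => ((φ i).coeff n).natDegree) + 1
  have hM : ∀ i n, ((φ i).coeff n).natDegree < M := by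
    intro i n
    refine Nat.lt_succ_of_le (le_trans ?_ (Finset.le_sup (Finset.mem_univ i)))
    by_cases hn : n ∈ (φ i).support
    · exact Finset.le_sup (f := fun n => ((φ i).coeff n).natDegree) hn
    · rw [Polynomial.notMem_support_iff.1 hn]; simp
  obtain ⟨σ, hσC, hσ⟩ := ztau_exists E M
  have := fun i => hσ (φ i) (hM i)
  choose N hN1 hN2 using this
  simp only [hφl] at hN2
  refine zSG_equiv σ _ r J0 ?_
  have hG' := zgood_equiv σ _ r J0 hG
  have hc : ((c.map Polynomial.C).map Polynomial.C).map (σ : Polynomial (Polynomial E) →+* Polynomial (Polynomial E))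
      = (c.map Polynomial.C).map Polynomial.C := by
    rw [Ideal.map_map (I := c)]
    exact zmapcc c _ _ _ hσC
  rw [hc] at hG' ⊢
  obtain ⟨G1, g, hg, G2⟩ := hG'
  intro j hj
  refine zMP (c.map Polynomial.C) r hr _ ?_ ?_ g hg ?_ (fun i => σ (φ i)) ?_ ?_ j hj
  · intro t ht hct
    rw [Ideal.map_le_iff_le_comap] at hct
    exact (zht_le_add_one t).trans (h1 _ inferInstance hct)
  · intro Q hQ hJQ hcQ
    exact G1 Q hQ hJQ (by rwa [Ideal.map_le_iff_le_comap])
  · intro Q hQ hJQ hcQ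
    exact G2 Q hQ hJQ (by rwa [Ideal.map_le_iff_le_comap])
  · intro i
    exact Ideal.mem_map_of_mem (σ : Polynomial (Polynomial E) →+* Polynomial (Polynomial E)) (hφ i)
  · intro t ht hct
    rw [Ideal.map_le_iff_le_comap] at hct
    obtain ⟨i, hi⟩ := hl3 _ inferInstance hct
    refine ⟨i, fun hmem => hi ?_⟩
    by_cases h0 : (Polynomial.C (l i ^ k i) : Polynomial E) = 0
    · rw [Ideal.mem_comap]
      refine ht.mem_of_pow_mem (k i) ?_
      rw [← map_pow, h0]; exact t.zero_mem
    · have : (σ (φ i)).natDegree = N i := le_antisymm (hN1 i)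
        (Polynomial.le_natDegree_of_ne_zero (by rw [hN2]; exact h0))
      rw [Polynomial.leadingCoeff, this, hN2, map_pow] at hmem
      exact ht.mem_of_pow_mem _ hmem

theorem zmain0 [IsNoetherianRing E] {A : Type*} [CommRing A] (c : Ideal E) (r : ℕ) (hr : 3 ≤ r)
    (h1 : ∀ p : Ideal E, p.IsPrime → ¬ c ≤ p → p.height + 1 ≤ r) (f : Polynomial E)
    (ι : Polynomial (Polynomial E) →+* A) (h : ZA ι (Polynomial.C f)) (J : Ideal A)
    (hG : ZGood (((c.map Polynomial.C).map Polynomial.C).map ι) r J) :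
    ZSG A (((c.map Polynomial.C).map Polynomial.C).map ι) r J := by
  refine zlemP (c.map Polynomial.C) r f ?_ ι h J hG (zlast c r hr h1)
  intro t ht hct
  rw [Ideal.map_le_iff_le_comap] at hct
  exact (zht_le_add_one t).trans (h1 _ inferInstance hct)

theorem zmain1 [IsNoetherianRing E] {A : Type*} [CommRing A] (c : Ideal E) (r : ℕ) (hr : 3 ≤ r)
    (h1 : ∀ p : Ideal E, p.IsPrime → ¬ c ≤ p → p.height + 1 ≤ r) (f : Polynomial E)
    (ι : Polynomial (Polynomial E) →+* A) (h : ZA ι (Polynomial.X * Polynomial.C f)) (J : Ideal A)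
    (hG : ZGood (((c.map Polynomial.C).map Polynomial.C).map ι) r J) :
    ZSG A (((c.map Polynomial.C).map Polynomial.C).map ι) r J := by
  have hK : ∀ t : Ideal (Polynomial E), t.IsPrime → ¬ c.map Polynomial.C ≤ t → t.height ≤ r := by
    intro t ht hct
    rw [Ideal.map_le_iff_le_comap] at hct
    exact (zht_le_add_one t).trans (h1 _ inferInstance hct)
  let A1 := Localization.Away (Polynomial.X : Polynomial (Polynomial E))
  let κ := algebraMap (Polynomial (Polynomial E)) A1
  have hκ : ZA κ Polynomial.X := ZA.of_away A1 _
  refine zlemL (c.map Polynomial.C) r f hK ι h J κ hκ hG ?_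
  intro J1 hJ1
  obtain ⟨σ, hσC, hσX, hσCX, -⟩ := zswap_exists E
  have hs := hκ.equiv_left σ
  have e : σ.symm Polynomial.X = Polynomial.C Polynomial.X := by rw [RingEquiv.symm_apply_eq, hσCX]
  rw [e] at hs
  have hc : ((c.map Polynomial.C).map Polynomial.C).map κ = ((c.map Polynomial.C).map Polynomial.C).map
      (κ.comp (σ : Polynomial (Polynomial E) →+* Polynomial (Polynomial E))) := by
    rw [← Ideal.map_map (I := (c.map Polynomial.C).map Polynomial.C), Ideal.map_map (I := c)]
    congr 1
    exact (zmapcc c _ _ _ hσC).symm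
  rw [hc] at hJ1 ⊢
  exact zlemP (c.map Polynomial.C) r Polynomial.X hK _ hs J1 hJ1 (zlast c r hr h1)
end last

theorem ZA.noeth {P A : Type*} [CommRing P] [CommRing A] [IsNoetherianRing P] {ι : P →+* A} {F : P} (h : ZA ι F) :
    IsNoetherianRing A := by
  letI := ι.toAlgebra
  haveI := h.toAway
  exact IsLocalization.isNoetherianRing (Submonoid.powers F) A inferInstance

section h1
variable {E : Type*} [CommRing E]

theorem zdim {A : Type*} [CommRing A] (k : ℕ) (hA : ringKrullDim A ≤ k) (Q : Ideal A) [Q.IsPrime] : Q.height ≤ k := by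
  have := (Ideal.height_le_ringKrullDim_of_isPrime (I := Q)).trans hA
  exact_mod_cast this

/-- dimension of `A` is large -/
theorem zh1 [IsNoetherianRing E] {A : Type*} [CommRing A] (f : Polynomial E) (F : Polynomial (Polynomial E)) 
    (hF : F.eval 1 = f) (ι : Polynomial (Polynomial E) →+* A) (h : ZA ι F) (p : Ideal E) [hp : p.IsPrime]
    (hfp : ∃ i, f.coeff i ∉ p) (k : ℕ) (hA : ringKrullDim A ≤ k) : p.height + 2 ≤ k := by
  let mkp := Polynomial.mapRingHom (Ideal.Quotient.mk p)
  let π : Polynomial (Polynomial E) →+* Polynomial (E ⧸ p) := mkp.comp (Polynomial.evalRingHom 1)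
  let fb := mkp f
  have hfb : fb ≠ 0 := by
    obtain ⟨i, hi⟩ := hfp
    intro h0
    apply hi
    have : fb.coeff i = 0 := by rw [h0, Polynomial.coeff_zero]
    simpa [fb, mkp, Ideal.Quotient.eq_zero_iff_mem] using this
  have hdeg : (1 + Polynomial.X * fb).natDegree = fb.natDegree + 1 := by
    rw [add_comm, ← Polynomial.C_1, Polynomial.natDegree_add_C, Polynomial.natDegree_X_mul hfb]
  have hnu : ¬ IsUnit (1 + Polynomial.X * fb) := by
    intro hu
    have := Polynomial.natDegree_eq_zero_of_isUnit hu
    omega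
  have hn0 : (1 + Polynomial.X * fb) ≠ 0 := by
    intro h0
    rw [h0] at hdeg
    simp at hdeg
  obtain ⟨m, hm, hm1⟩ := exists_max_ideal_of_mem_nonunits hnu
  have hmp := hm.isPrime
  let p' : Ideal (Polynomial (Polynomial E)) := (p.map Polynomial.C).map Polynomial.C
  have hp1 : (p.map (Polynomial.C : E →+* Polynomial E)).IsPrime := inferInstance
  have hp' : p'.IsPrime := inferInstance
  let q1 := RingHom.ker π
  have hq1 : q1.IsPrime := RingHom.ker_isPrime π
  let q2 := m.comap π
  have hq2 : q2.IsPrime := inferInstance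
  have l1 : p' < q1 := by
    refine lt_of_le_of_ne ?_ ?_
    · rw [Ideal.map_le_iff_le_comap, Ideal.map_le_iff_le_comap]
      intro a ha
      change π (Polynomial.C (Polynomial.C a)) = 0
      simp [π, mkp, Ideal.Quotient.eq_zero_iff_mem, ha]
    · intro heq
      have : (Polynomial.X - 1 : Polynomial (Polynomial E)) ∈ p' := by
        rw [heq]
        change π _ = 0
        simp [π]
      have := Ideal.mem_map_C_iff.1 this 1
      apply hp1.ne_top
      rw [Ideal.eq_top_iff_one]
      simpa [Polynomial.coeff_one] using this
  have hπC : π (Polynomial.C (1 + Polynomial.X * f)) = 1 + Polynomial.X * fb := by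
    simp [π, mkp, fb]
  have l2 : q1 < q2 := by
    refine lt_of_le_of_ne ?_ ?_
    · exact Ideal.ker_le_comap π
    · intro heq
      have : Polynomial.C (1 + Polynomial.X * f) ∈ q2 := by
        change π _ ∈ m
        rw [hπC]; exact hm1
      rw [← heq] at this
      change π _ = 0 at this
      rw [hπC] at this
      exact hn0 this
  have hFq : F ∉ q2 := by
    intro hF2
    change π F ∈ m at hF2
    have e : π F = fb := by simp [π, fb, hF]
    rw [e] at hF2
    apply hm.ne_top
    rw [Ideal.eq_top_iff_one]
    have := m.sub_mem hm1 (m.mul_mem_left Polynomial.X hF2)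
    simpa using this
  obtain ⟨z1, z2, z3⟩ := h.prime q2 hq2 hFq
  have b := zdim k hA (q2.map ι)
  rw [z3] at b
  have a1 := Ideal.height_add_one_le_of_lt_of_isPrime l1
  have a2 := Ideal.height_add_one_le_of_lt_of_isPrime l2
  have a3 : p'.height = p.height := by rw [zht_map_C, zht_map_C]
  rw [a3] at a1
  calc p.height + 2 = p.height + 1 + 1 := by rw [add_assoc]; rfl
    _ ≤ q1.height + 1 := by gcongr
    _ ≤ q2.height := a2
    _ ≤ k := b

theorem zcontent (f : Polynomial E) : ∃ c : Ideal E, f ∈ c.map Polynomial.C ∧ ∀ p : Ideal E, ¬ c ≤ p → ∃ i, f.coeff i ∉ p := by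
  refine ⟨Ideal.span (Set.range f.coeff), ?_, ?_⟩
  · rw [Ideal.mem_map_C_iff]
    exact fun n => Ideal.subset_span ⟨n, rfl⟩
  · intro p hp
    by_contra hcon
    push Not at hcon
    apply hp
    rw [Ideal.span_le]
    rintro _ ⟨i, rfl⟩
    exact hcon i

theorem zR3 [IsNoetherianRing E] {A : Type*} [CommRing A] (a : Bool) (f : Polynomial E) 
    (ι : Polynomial (Polynomial E) →+* A) (h : ZA ι (bif a then Polynomial.X * Polynomial.C f else Polynomial.C f))
    (I : Ideal A) (s : ℕ) (hs : 1 ≤ s) 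
    (hgen : ∀ (Q : Ideal A) (_ : Q.IsPrime), I ≤ Q → ∃ a : Fin (s + 2) → Localization.AtPrime Q,
      Ideal.span (Set.range a) = I.map (algebraMap A (Localization.AtPrime Q)))
    (hht : ∀ Q : Ideal A, Q.IsPrime → I ≤ Q → ((s + 2 : ℕ) : ℕ∞) ≤ Q.height)
    (hA : ringKrullDim A ≤ (s + 3 : ℕ)) (hd : ringKrullDim (A ⧸ I) ≤ 1) :
    ∃ G : Fin (s + 2) → A, I.radical = (Ideal.span (Set.range G)).radical := by
  have hN : IsNoetherianRing A := h.noeth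
  obtain ⟨c, hfc, hc⟩ := zcontent f
  have h1 : ∀ p : Ideal E, p.IsPrime → ¬ c ≤ p → p.height + 1 ≤ (s + 2 : ℕ) := by
    intro p hp hcp
    have := zh1 f _ (by cases a <;> simp) ι h p (hc p hcp) _ hA
    have e : p.height + 1 + 1 ≤ ((s + 2 : ℕ) : ℕ∞) + 1 := by
      rw [add_assoc]
      refine le_trans this (le_of_eq ?_)
      push_cast; ring_nf
    exact (ENat.add_le_add_iff_right (by simp)).1 e
  have hctop : ((c.map Polynomial.C).map Polynomial.C).map ι = ⊤ := by
    refine Ideal.eq_top_of_isUnit_mem _ (Ideal.mem_map_of_mem ι ?_) h.1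
    cases a
    · exact Ideal.mem_map_of_mem _ hfc
    · exact Ideal.mul_mem_left _ _ (Ideal.mem_map_of_mem _ hfc)
  obtain ⟨g, hg, u, hu, hux⟩ := zFS_A I s (fun Q hQ hIQ => hgen Q hQ hIQ) (fun Q hQ hIQ => hht Q hQ hIQ) hd
  let J := Ideal.span (Set.range g) ⊔ I ^ 2
  have hgI : Ideal.span (Set.range g) ≤ I := Ideal.span_le.2 (by rintro _ ⟨i, rfl⟩; exact hg i)
  have hJI : J ≤ I := sup_le hgI (Ideal.pow_le_self two_ne_zero)
  have hIJ : I ≤ J.radical := fun x hx => ⟨2, Ideal.mem_sup_right (Ideal.pow_mem_pow hx 2)⟩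
  have hrad : J.radical = I.radical := le_antisymm (Ideal.radical_mono hJI) (by
    rw [Ideal.radical_le_radical_iff]; exact hIJ)
  have hIQ : ∀ Q : Ideal A, Q.IsPrime → J ≤ Q → I ≤ Q := fun Q hQ hJQ => hIJ.trans (hQ.radical_le_iff.2 hJQ)
  have hG : ZGood (((c.map Polynomial.C).map Polynomial.C).map ι) (s + 2) J := by
    refine ⟨fun Q hQ hJQ _ => hht Q hQ (hIQ Q hQ hJQ), g, fun i => Ideal.mem_sup_left (Ideal.subset_span ⟨i, rfl⟩), ?_⟩
    intro Q hQ hJQ _ x hx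
    refine ⟨1 - u, ?_, ?_⟩
    · intro hmem
      exact hQ.ne_top ((Ideal.eq_top_iff_one _).2 (by simpa using Q.add_mem hmem (hIQ Q hQ hJQ hu)))
    · obtain ⟨y, hy, z, hz, rfl⟩ := Submodule.mem_sup.1 hx
      rw [mul_add]
      exact Ideal.add_mem _ (Ideal.mul_mem_left _ _ hy) (hux z hz)
  have hSG : ZSG A (((c.map Polynomial.C).map Polynomial.C).map ι) (s + 2) J := by
    cases a
    · exact zmain0 c (s + 2) (by omega) h1 f ι h J hG
    · exact zmain1 c (s + 2) (by omega) h1 f ι h J hG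
  obtain ⟨G, hGr⟩ := hSG (RingHom.id A) (by rw [hctop, Ideal.map_top])
  refine ⟨G, ?_⟩
  rw [← hGr, Ideal.map_id, hrad]
end h1

section r2

/-- ideals in `D[X]` are generically principal -/
theorem zpr {D : Type*} [CommRing D] [IsDomain D] (J : Ideal (Polynomial D)) :
    ∃ a ∈ J, ∀ p ∈ J, ∃ d : D, d ≠ 0 ∧ Polynomial.C d * p ∈ Ideal.span {a} := by
  classical
  by_cases hJ : ∃ a ∈ J, a ≠ 0
  swap
  · push Not at hJ
    refine ⟨0, J.zero_mem, fun p hp => ⟨1, one_ne_zero, ?_⟩⟩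
    rw [hJ p hp]; simp
  have hex : ∃ k : ℕ, ∃ a ∈ J, a ≠ 0 ∧ a.natDegree = k := by
    obtain ⟨a, ha, h0⟩ := hJ
    exact ⟨_, a, ha, h0, rfl⟩
  obtain ⟨a, ha, ha0, hak⟩ := Nat.find_spec hex
  have hmin : ∀ p ∈ J, p ≠ 0 → a.natDegree ≤ p.natDegree := by
    intro p hp hp0
    rw [hak]
    exact Nat.find_min' hex ⟨p, hp, hp0, rfl⟩
  refine ⟨a, ha, ?_⟩
  have key : ∀ (k : ℕ) (p : Polynomial D), p ∈ J → p.natDegree < k →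
      ∃ d : D, d ≠ 0 ∧ Polynomial.C d * p ∈ Ideal.span {a} := by
    intro k
    induction k with
    | zero => intro p _ h; omega
    | succ k ih =>
      intro p hp hpk
      by_cases hp0 : p = 0
      · exact ⟨1, one_ne_zero, by rw [hp0]; simp⟩
      have hle := hmin p hp hp0
      let q := Polynomial.C p.leadingCoeff * Polynomial.X ^ (p.natDegree - a.natDegree) * a
      let p' := Polynomial.C a.leadingCoeff * p - q
      have hq : q ∈ J := J.mul_mem_left _ ha
      have hqs : q ∈ Ideal.span {a} := Ideal.mul_mem_left _ _ (Ideal.mem_span_singleton_self a)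
      have hp' : p' ∈ J := J.sub_mem (J.mul_mem_left _ hp) hq
      have hla : a.leadingCoeff ≠ 0 := by simpa using ha0
      have hlp : p.leadingCoeff ≠ 0 := by simpa using hp0
      have fin : ∀ d : D, d ≠ 0 → Polynomial.C d * p' ∈ Ideal.span {a} →
          ∃ d : D, d ≠ 0 ∧ Polynomial.C d * p ∈ Ideal.span {a} := by
        intro d hd hdm
        refine ⟨d * a.leadingCoeff, mul_ne_zero hd hla, ?_⟩
        have e : Polynomial.C (d * a.leadingCoeff) * p = Polynomial.C d * p' + Polynomial.C d * q := by
          simp only [p', map_mul]; ring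
        rw [e]
        exact Ideal.add_mem _ hdm (Ideal.mul_mem_left _ _ hqs)
      by_cases hp'0 : p' = 0
      · exact fin 1 one_ne_zero (by rw [hp'0]; simp)
      have hdeg : p'.degree < (Polynomial.C a.leadingCoeff * p).degree := by
        apply Polynomial.degree_sub_lt
        · simp only [q]
          rw [mul_assoc, Polynomial.degree_C_mul hla, Polynomial.degree_C_mul hlp, Polynomial.degree_mul,
            Polynomial.degree_X_pow, Polynomial.degree_eq_natDegree hp0, Polynomial.degree_eq_natDegree ha0]
          norm_cast
          omega
        · exact mul_ne_zero (by simpa using ha0) hp0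
        · simp only [q]
          rw [Polynomial.leadingCoeff_mul, Polynomial.leadingCoeff_mul, Polynomial.leadingCoeff_mul,
            Polynomial.leadingCoeff_C, Polynomial.leadingCoeff_C, Polynomial.leadingCoeff_X_pow, mul_one, mul_comm]
      rw [Polynomial.degree_C_mul hla] at hdeg
      have hnd := Polynomial.natDegree_lt_natDegree hp'0 hdeg
      obtain ⟨d, hd, hdm⟩ := ih p' hp' (by omega)
      exact fin d hd hdm
  exact fun p hp => key _ p hp (Nat.lt_succ_self _)

theorem zR2 {K : Type*} [CommRing K] [IsNoetherianRing K] {A : Type*} [CommRing A] (f : K) (F : Polynomial K)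
    (hF : F.eval 1 = f) (ι : Polynomial K →+* A) (h : ZA ι F) (hfu : IsUnit (ι (Polynomial.C f)))
    (I : Ideal A) (hht : ∀ Q : Ideal A, Q.IsPrime → I ≤ Q → ((2 : ℕ) : ℕ∞) ≤ Q.height)
    (hA : ringKrullDim A ≤ (2 : ℕ)) :
    ∃ G : Fin 2 → A, I.radical = (Ideal.span (Set.range G)).radical := by
  classical
  have hN : IsNoetherianRing A := h.noeth
  let κ : K →+* A := ι.comp Polynomial.C
  have hi : ∀ P : Ideal K, P.IsPrime → f ∉ P → P.height ≤ 1 := by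
    intro P hP hfP
    let Q := P.comap (Polynomial.evalRingHom (1 : K))
    have hQ : Q.IsPrime := inferInstance
    have hPC : (P.map (Polynomial.C : K →+* Polynomial K)).IsPrime := inferInstance
    have hlt : P.map Polynomial.C < Q := by
      refine lt_of_le_of_ne ?_ ?_
      · rw [Ideal.map_le_iff_le_comap]
        intro a ha
        change Polynomial.eval 1 (Polynomial.C a) ∈ P
        simpa using ha
      · intro heq
        have : (Polynomial.X - 1 : Polynomial K) ∈ P.map Polynomial.C := by
          rw [heq]
          change Polynomial.eval 1 _ ∈ P
          simp
        have := Ideal.mem_map_C_iff.1 this 1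
        apply hP.ne_top
        rw [Ideal.eq_top_iff_one]
        simpa [Polynomial.coeff_one] using this
    have hFQ : F ∉ Q := by
      intro hh
      change Polynomial.eval 1 F ∈ P at hh
      rw [hF] at hh
      exact hfP hh
    obtain ⟨z1, z2, z3⟩ := h.prime Q hQ hFQ
    have b := zdim 2 hA (Q.map ι)
    rw [z3] at b
    have a1 := Ideal.height_add_one_le_of_lt_of_isPrime hlt
    rw [zht_map_C] at a1
    have a2 : P.height + 1 ≤ 1 + 1 := a1.trans (b.trans (by norm_num))
    exact (ENat.add_le_add_iff_right (by simp)).1 a2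
  have hii : ∀ Q : Ideal A, Q.IsPrime → I ≤ Q → 1 ≤ (Q.comap κ).height := by
    intro Q hQ hIQ
    have a1 := hht Q hQ hIQ
    rw [← h.height_comap Q] at a1
    have a2 := a1.trans (zht_le_add_one (Q.comap ι))
    rw [Ideal.comap_comap] at a2
    have a3 : (1 : ℕ∞) + 1 ≤ (Q.comap κ).height + 1 := le_trans (by norm_num) a2
    exact (ENat.add_le_add_iff_right (by simp)).1 a3
  have hmin : ∀ Q : Ideal A, Q.IsPrime → I ≤ Q → Q ∈ I.minimalPrimes := by
    intro Q hQ hIQ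
    obtain ⟨Q', hQ', hle⟩ := Ideal.exists_minimalPrimes_le hIQ
    rcases hle.eq_or_lt with rfl | hlt
    · exact hQ'
    · exfalso
      have := hQ'.1.1
      have a1 := Ideal.height_add_one_le_of_lt_of_isPrime hlt
      have a2 := hht Q' hQ'.1.1 hQ'.1.2
      have a3 := zdim 2 hA Q
      have : ((2 : ℕ) : ℕ∞) + 1 ≤ ((2 : ℕ) : ℕ∞) := le_trans (by gcongr) (a1.trans a3)
      norm_cast at this
  have hfin : I.minimalPrimes.Finite := Ideal.finite_minimalPrimes_of_isNoetherianRing _ _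
  let M' : Ideal K := hfin.toFinset.inf (fun Q => Q.comap κ)
  let S' : Set (Ideal K) := {P | P ∈ (⊥ : Ideal K).minimalPrimes ∧ f ∉ P}
  have hS' : S'.Finite := (Ideal.finite_minimalPrimes_of_isNoetherianRing K ⊥).subset (fun P hP => hP.1)
  obtain ⟨Fs, hFs, hav⟩ := zz_avoid_ideal S' hS' (fun P hP => hP.1.1.1) M'
  obtain ⟨t, htF, ht⟩ := hav 0 (by
    intro P hP
    right
    intro hle
    have hPp := hP.1.1.1
    obtain ⟨Q, hQ, hQP⟩ := hPp.inf_le'.1 hle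
    rw [Set.Finite.mem_toFinset] at hQ
    have a1 := hii Q hQ.1.1 hQ.1.2
    have a2 := a1.trans (Ideal.height_mono hQP)
    have a3 : P.height = 0 := by
      rw [Ideal.height_eq_zero_iff]
      exact hP.1
    rw [a3] at a2
    exact absurd a2 (by simp))
  simp only [zero_add] at ht
  have htM := hFs t htF
  have htQ : ∀ Q : Ideal A, Q.IsPrime → I ≤ Q → κ t ∈ Q := by
    intro Q hQ hIQ
    have : M' ≤ Q.comap κ := Finset.inf_le (by rw [Set.Finite.mem_toFinset]; exact hmin Q hQ hIQ)
    exact this htM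
  let N : Set (Ideal K) := {n | n.IsPrime ∧ t ∈ n ∧ f ∉ n}
  have hN1 : ∀ n ∈ N, 1 ≤ n.height := by
    intro n hn
    have hnp := hn.1
    by_contra hlt
    have h0 : n.height = 0 := by
      rw [not_le] at hlt
      exact Order.lt_one_iff.1 hlt
    rw [Ideal.height_eq_zero_iff] at h0
    exact ht n ⟨h0, hn.2.2⟩ hn.2.1
  have hNeq : ∀ n ∈ N, ∀ n' : Ideal K, n'.IsPrime → n ≤ n' → f ∉ n' → n = n' := by
    intro n hn n' hn' hle hf
    by_contra hne
    have hnp := hn.1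
    have a1 := Ideal.height_add_one_le_of_lt_of_isPrime (lt_of_le_of_ne hle hne)
    have a2 := a1.trans (hi n' hn' hf)
    have a3 : (1 : ℕ∞) + 1 ≤ 1 := le_trans (by gcongr; exact hN1 n hn) a2
    norm_num at a3
  have hNfin : N.Finite := by
    refine (Ideal.finite_minimalPrimes_of_isNoetherianRing K (Ideal.span {t})).subset ?_
    intro n hn
    have hnp := hn.1
    obtain ⟨n', hn', hle⟩ := Ideal.exists_minimalPrimes_le (I := Ideal.span {t}) (J := n)
      (by rw [Ideal.span_singleton_le_iff_mem]; exact hn.2.1)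
    have hn'N : n' ∈ N := ⟨hn'.1.1, (Ideal.span_singleton_le_iff_mem _).1 hn'.1.2, fun hf => hn.2.2 (hle hf)⟩
    rw [← hNeq n' hn'N n hn.1 hle hn.2.2]
    exact hn'
  have hfQ : ∀ Q : Ideal A, Q.IsPrime → f ∉ Q.comap κ := by
    intro Q hQ hf
    exact hQ.ne_top (Ideal.eq_top_of_isUnit_mem _ hf hfu)
  have hpc : ∀ n : Ideal K, ∃ a : A, n ∈ N → a ∈ I ⊔ n.map κ ∧
      ∀ Q : Ideal A, Q.IsPrime → n.map κ ≤ Q → a ∈ Q → I ≤ Q := by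
    intro n
    by_cases hn : n ∈ N
    swap
    · exact ⟨0, fun h => absurd h hn⟩
    have hnp := hn.1
    let π : Polynomial K →+* Polynomial (K ⧸ n) := Polynomial.mapRingHom (Ideal.Quotient.mk n)
    have hπ : Function.Surjective π := Polynomial.map_surjective _ Ideal.Quotient.mk_surjective
    have hker : ∀ p, π p = 0 → ι p ∈ n.map κ := by
      intro p hp
      have : p ∈ n.map Polynomial.C := by
        rw [Ideal.mem_map_C_iff]
        intro i
        have := congrArg (fun q => Polynomial.coeff q i) hp
        simpa [π, Ideal.Quotient.eq_zero_iff_mem] using this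
      have := Ideal.mem_map_of_mem ι this
      rwa [Ideal.map_map] at this
    let J := (I ⊔ n.map κ).comap ι
    obtain ⟨a', ha', hpr⟩ := zpr (J.map π)
    obtain ⟨a, haJ, rfl⟩ := (Ideal.mem_map_iff_of_surjective π hπ).1 ha'
    refine ⟨ι a, fun _ => ⟨haJ, ?_⟩⟩
    intro Q hQ hnQ haQ
    have hnQ' : n = Q.comap κ := hNeq n hn _ inferInstance (Ideal.map_le_iff_le_comap.1 hnQ) (hfQ Q hQ)
    intro x hx
    obtain ⟨k, p, hp⟩ := h.2.1 x
    have hpJ : p ∈ J := by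
      change ι p ∈ I ⊔ n.map κ
      rw [← hp]
      exact Ideal.mul_mem_left _ _ (Ideal.mem_sup_left hx)
    obtain ⟨d', hd', hdm⟩ := hpr (π p) (Ideal.mem_map_of_mem _ hpJ)
    obtain ⟨d, rfl⟩ := Ideal.Quotient.mk_surjective d'
    obtain ⟨q', hq'⟩ := Ideal.mem_span_singleton'.1 hdm
    obtain ⟨q, rfl⟩ := hπ q'
    have e : π (Polynomial.C d * p - q * a) = 0 := by
      rw [map_sub, map_mul, map_mul, hq']
      simp [π]
    have e1 := hnQ (hker _ e)
    rw [map_sub, map_mul, map_mul] at e1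
    have e2 : ι (Polynomial.C d) * ι p ∈ Q := by
      have := Q.add_mem e1 (Q.mul_mem_left (ι q) haQ)
      simpa using this
    have hdQ : ι (Polynomial.C d) ∉ Q := by
      intro hd
      apply hd'
      rw [Ideal.Quotient.eq_zero_iff_mem, hnQ']
      exact hd
    have e3 := (hQ.mem_or_mem e2).resolve_left hdQ
    rw [← hp] at e3
    exact (h.unit_mem Q k x).1 e3
  choose a ha using hpc
  have hcop : ∀ n ∈ N, ∀ n' ∈ N, n ≠ n' → IsCoprime (n.map κ) (n'.map κ) := by
    intro n hn n' hn' hne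
    rw [Ideal.isCoprime_iff_sup_eq]
    by_contra hcon
    obtain ⟨Q, hQ, hle⟩ := Ideal.exists_le_maximal _ hcon
    have hQp := hQ.isPrime
    apply hne
    rw [hNeq n hn (Q.comap κ) inferInstance (Ideal.map_le_iff_le_comap.1 (le_sup_left.trans hle)) (hfQ Q hQp),
      hNeq n' hn' (Q.comap κ) inferInstance (Ideal.map_le_iff_le_comap.1 (le_sup_right.trans hle)) (hfQ Q hQp)]
  obtain ⟨g, hg⟩ : ∃ g : A, ∀ n ∈ N, g - a n ∈ n.map κ := by
    have : Finite N := hNfin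
    obtain ⟨g, hg⟩ := Ideal.exists_forall_sub_mem_ideal (I := fun n : N => n.1.map κ)
      (by
        intro n n' hne
        exact hcop n.1 n.2 n'.1 n'.2 (fun h => hne (Subtype.ext h))) (fun n => a n.1)
    exact ⟨g, fun n hn => hg ⟨n, hn⟩⟩
  refine ⟨![κ t, g], ?_⟩
  have hiff : ∀ Q : Ideal A, Q.IsPrime → (I ≤ Q ↔ Ideal.span (Set.range ![κ t, g]) ≤ Q) := by
    intro Q hQ
    rw [Ideal.span_le]
    constructor
    · intro hIQ
      have htq := htQ Q hQ hIQ
      have hnN : Q.comap κ ∈ N := ⟨inferInstance, htq, hfQ Q hQ⟩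
      have h1 : (Q.comap κ).map κ ≤ Q := Ideal.map_comap_le
      have h2 := (ha _ hnN).1
      have h3 : a (Q.comap κ) ∈ Q := (sup_le hIQ h1) h2
      have h4 := Q.add_mem (h1 (hg _ hnN)) h3
      rw [sub_add_cancel] at h4
      rintro _ ⟨i, rfl⟩
      fin_cases i
      · exact htq
      · exact h4
    · intro hle
      have htq : κ t ∈ Q := hle ⟨0, rfl⟩
      have hgq : g ∈ Q := hle ⟨1, rfl⟩
      have hnN : Q.comap κ ∈ N := ⟨inferInstance, htq, hfQ Q hQ⟩
      have h1 : (Q.comap κ).map κ ≤ Q := Ideal.map_comap_le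
      refine (ha _ hnN).2 Q hQ h1 ?_
      have := Q.sub_mem hgq (h1 (hg _ hnN))
      rwa [sub_sub_cancel] at this
  rw [Ideal.radical_eq_sInf, Ideal.radical_eq_sInf]
  congr 1
  ext Q
  constructor
  · rintro ⟨h1, h2⟩; exact ⟨(hiff Q h2).1 h1, h2⟩
  · rintro ⟨h1, h2⟩; exact ⟨(hiff Q h2).2 h1, h2⟩
end r2

section bridge

theorem ZA.poly {M B A : Type*} [CommRing M] [CommRing B] [CommRing A] {β : M →+* B} {y : M} (h : ZA β y)
    {α : Polynomial B →+* A} {g : Polynomial M} (h' : ZA α (g.map β)) :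
    ZA (α.comp (Polynomial.mapRingHom β)) (Polynomial.C y * g) := by
  have hy : IsUnit (α (Polynomial.C (β y))) := (h.1.map Polynomial.C).map α
  refine ⟨?_, ?_, ?_⟩
  · simpa using ⟨hy, h'.1⟩
  · intro a
    obtain ⟨n, p, hp⟩ := h'.2.1 a
    obtain ⟨k, q, hq⟩ := zlift_poly β y h.2.1 p
    refine ⟨n + k, Polynomial.C y ^ n * g ^ k * q, ?_⟩
    simp only [map_mul, map_pow, RingHom.comp_apply, Polynomial.coe_mapRingHom, Polynomial.map_C, hq] at *
    rw [← hp]; ring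
  · intro p hp
    obtain ⟨n, hn⟩ := h'.2.2 (p.map β) hp
    obtain ⟨k, hk⟩ := zkill_poly β y h.2.2 (g ^ n * p) (by simpa using hn)
    refine ⟨n + k, ?_⟩
    have : (Polynomial.C y * g) ^ (n + k) * p
        = Polynomial.C y ^ n * g ^ k * (Polynomial.C (y ^ k) * (g ^ n * p)) := by
      rw [map_pow]; ring
    rw [this, hk, mul_zero]

theorem ZA.of_dvd {M B : Type*} [CommRing M] [CommRing B] [Algebra M B] (S : Submonoid M) [IsLocalization S B]
    (y : M) (hy : y ∈ S) (hS : ∀ s ∈ S, ∃ k : ℕ, s ∣ y ^ k) : ZA (algebraMap M B) y := by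
  refine ⟨IsLocalization.map_units B ⟨y, hy⟩, ?_, ?_⟩
  · intro a
    obtain ⟨⟨p, s⟩, hp⟩ := IsLocalization.surj S a
    obtain ⟨k, c, hc⟩ := hS s s.2
    refine ⟨k, c * p, ?_⟩
    rw [← map_pow, hc, map_mul, map_mul]
    simp only at hp
    rw [← hp]; ring
  · intro p hp
    have : algebraMap M B p = algebraMap M B 0 := by simpa using hp
    obtain ⟨s, hs⟩ := (IsLocalization.eq_iff_exists S B).1 this
    obtain ⟨k, c, hc⟩ := hS s s.2
    refine ⟨k, ?_⟩
    rw [hc, mul_comm (s : M), mul_assoc, hs]; simp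

theorem ZA.congr {P A : Type*} [CommRing P] [CommRing A] {ι : P →+* A} {F F' : P} (h : ZA ι F) (e : F = F') :
    ZA ι F' := e ▸ h

theorem zY (R : Type*) [CommRing R] (m n : ℕ) (B : Type*) [CommRing B] [Algebra (MvPolynomial (Fin m ⊕ Fin n) R) B]
    [IsLocalization (Ymonoid R m n) B] :
    ZA (algebraMap (MvPolynomial (Fin m ⊕ Fin n) R) B) (∏ j : Fin n, X (Sum.inr j)) := by
  refine ZA.of_dvd (Ymonoid R m n) _ ?_ ?_
  · exact Submonoid.prod_mem _ (fun j _ => Submonoid.subset_closure ⟨j, rfl⟩)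
  · intro s hs
    unfold Ymonoid at hs
    refine Submonoid.closure_induction (motive := fun s _ => ∃ k : ℕ, s ∣ (∏ j : Fin n, X (Sum.inr j)) ^ k) ?_ ?_ ?_ hs
    · rintro _ ⟨j, rfl⟩
      exact ⟨1, by rw [pow_one]; exact Finset.dvd_prod_of_mem _ (Finset.mem_univ j)⟩
    · exact ⟨0, by simp⟩
    · rintro x y _ _ ⟨k, hk⟩ ⟨l, hl⟩
      exact ⟨k + l, by rw [pow_add]; exact mul_dvd_mul hk hl⟩

/-- singling out one variable -/
theorem zvar (R : Type*) [CommRing R] {σ : Type*} [DecidableEq σ] (i0 : σ) :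
    ∃ e : MvPolynomial σ R ≃+* Polynomial (MvPolynomial {i // i ≠ i0} R),
      e (X i0) = Polynomial.X ∧ (∀ i (hi : i ≠ i0), e (X i) = Polynomial.C (X ⟨i, hi⟩)) ∧
      ∀ a, e (C a) = Polynomial.C (C a) := by
  refine ⟨((renameEquiv R (Equiv.optionSubtypeNe i0).symm).trans (optionEquivLeft R _)).toRingEquiv, ?_, ?_, ?_⟩
  · change optionEquivLeft R _ (rename _ (X i0)) = _
    rw [rename_X, Equiv.optionSubtypeNe_symm_self, optionEquivLeft_X_none]
  · intro i hi
    change optionEquivLeft R _ (rename _ (X i)) = _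
    rw [rename_X, Equiv.optionSubtypeNe_symm_of_ne hi, optionEquivLeft_X_some]
  · intro a
    change optionEquivLeft R _ (rename _ (C a)) = _
    rw [rename_C, optionEquivLeft_C]

theorem zbridge (R : Type*) [CommRing R] (m n : ℕ) (hmn : 1 ≤ m + n) (f : Polynomial R)
    (A : Type*) [CommRing A] 
    (θ : Polynomial (MvPolynomial (Fin m ⊕ Fin n) R) →+* A)
    (h : ZA θ (Polynomial.C (∏ j : Fin n, X (Sum.inr j)) * f.map C)) :
    ∃ (i0 : Fin m ⊕ Fin n) (a : Bool) (f' : Polynomial (MvPolynomial {i // i ≠ i0} R))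
      (ι : Polynomial (Polynomial (MvPolynomial {i // i ≠ i0} R)) →+* A),
      ZA ι (bif a then Polynomial.X * Polynomial.C f' else Polynomial.C f') := by
  have main : ∃ (i0 : Fin m ⊕ Fin n) (a : Bool) (y' : MvPolynomial {i // i ≠ i0} R), 
      ∀ e : MvPolynomial (Fin m ⊕ Fin n) R ≃+* Polynomial (MvPolynomial {i // i ≠ i0} R), 
      e (X i0) = Polynomial.X → (∀ i (hi : i ≠ i0), e (X i) = Polynomial.C (X ⟨i, hi⟩)) →
      e (∏ j : Fin n, X (Sum.inr j)) = (bif a then Polynomial.X else 1) * Polynomial.C y' := by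
    by_cases hm : m = 0
    · have hn : 0 < n := by omega
      refine ⟨Sum.inr ⟨0, hn⟩, true, ∏ j ∈ (Finset.univ.erase (⟨0, hn⟩ : Fin n)).attach, X ⟨Sum.inr j.1, ?_⟩, ?_⟩
      · intro hh
        exact (Finset.mem_erase.1 j.2).1 (Sum.inr.inj hh)
      · intro e h1 h2
        rw [← Finset.mul_prod_erase Finset.univ _ (Finset.mem_univ (⟨0, hn⟩ : Fin n)), map_mul, h1, map_prod, map_prod,
          ← Finset.prod_attach]
        simp only [cond_true]
        congr 1
        refine Finset.prod_congr rfl (fun j _ => ?_)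
        exact h2 _ _
    · have hm' : 0 < m := by omega
      refine ⟨Sum.inl ⟨0, hm'⟩, false, ∏ j : Fin n, X ⟨Sum.inr j, by simp⟩, ?_⟩
      intro e h1 h2
      rw [map_prod, map_prod]
      simp only [cond_false, one_mul]
      exact Finset.prod_congr rfl (fun j _ => h2 _ _)
  obtain ⟨i0, a, y', hy'⟩ := main
  obtain ⟨e, e1, e2, e3⟩ := zvar R i0
  obtain ⟨σ, s1, s2, s3, s4, s5⟩ := zswap_exists (MvPolynomial {i // i ≠ i0} R)
  let τ := (Polynomial.mapEquiv e).trans σ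
  refine ⟨i0, a, Polynomial.C y' * f.map C, θ.comp (τ.symm : _ →+* _), ?_⟩
  refine (h.equiv_left τ.symm).congr ?_
  change σ (Polynomial.mapEquiv e _) = _
  have hc : Polynomial.mapEquiv e (f.map C) = (f.map C).map Polynomial.C := by
    change Polynomial.map (RingHomClass.toRingHom e) _ = _
    rw [Polynomial.map_map, Polynomial.map_map]
    congr 1
    ext a : 1
    exact e3 a
  have hc2 : Polynomial.mapEquiv e (Polynomial.C (∏ j : Fin n, X (Sum.inr j))) =
      Polynomial.C ((bif a then Polynomial.X else 1) * Polynomial.C y') := by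
    rw [← hy' e e1 e2]
    change Polynomial.map (RingHomClass.toRingHom e) _ = _
    rw [Polynomial.map_C]; rfl
  rw [map_mul, map_mul, hc, hc2, s4, s5]
  cases a
  · simp only [cond_false, one_mul, Polynomial.map_C, map_mul]
  · simp only [cond_true, Polynomial.map_mul, Polynomial.map_X, Polynomial.map_C, map_mul, mul_assoc]
end bridge

/-- **Theorem.** Let `R` be Noetherian of finite Krull dimension `d`,
`B = R[X_1,…,X_m,Y_1^{±1},…,Y_n^{±1}]` with `m + n ≥ 1`, `f ∈ R[Y]` any polynomial and
`A = B[Y, f⁻¹]`.  Let `I ⊆ A` be a locally complete intersection ideal of height `r` with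
`r ≥ max {dim A − 1, dim A − r + 2}` (expressed as `dim A ≤ r + 1` and
`dim A + 2 ≤ 2r`) and `dim (A/I) ≤ 1`.  Then `I` is set-theoretically generated by `r`
elements. -/
theorem lci_ideal_set_theoretic_generation
    (R : Type*) [CommRing R] [IsNoetherianRing R] (d : ℕ) (hdim : ringKrullDim R = d)
    (m n : ℕ) (hmn : 1 ≤ m + n)
    (B : Type*) [CommRing B] [Algebra R B] [Algebra (MvPolynomial (Fin m ⊕ Fin n) R) B]
    [IsScalarTower R (MvPolynomial (Fin m ⊕ Fin n) R) B]
    [IsLocalization (Ymonoid R m n) B]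
    (f : Polynomial R)
    (A : Type*) [CommRing A] [Algebra (Polynomial B) A]
    [IsLocalization.Away (f.map (algebraMap R B)) A]
    (I : Ideal A) (r : ℕ)
    (hlci : IsLocallyCompleteIntersection I r)
    (hr1 : ringKrullDim A ≤ (r : ℕ) + 1)
    (hr2 : ringKrullDim A + 2 ≤ (2 * r : ℕ))
    (hdimq : ringKrullDim (A ⧸ I) ≤ 1) :
    ∃ G : Fin r → A, I.radical = (Ideal.span (Set.range G)).radical := by
  have hZ := (zY R m n B).poly (g := f.map C) (α := algebraMap (Polynomial B) A) (by
    refine (ZA.of_away A (f.map (algebraMap R B))).congr ?_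
    rw [Polynomial.map_map]
    congr 1
    rw [IsScalarTower.algebraMap_eq R (MvPolynomial (Fin m ⊕ Fin n) R) B]
    rfl)
  obtain ⟨i0, a, f', ι, h⟩ := zbridge R m n hmn f A _ hZ
  have hN : IsNoetherianRing A := h.noeth
  have hfu : IsUnit (ι (Polynomial.C f')) := by
    have := h.1
    cases a
    · exact this
    · rw [cond_true, map_mul] at this
      exact isUnit_of_mul_isUnit_right this
  have hev : Polynomial.eval 1 (bif a then Polynomial.X * Polynomial.C f' else Polynomial.C f') = f' := by
    cases a <;> simp
  have hht : ∀ Q : Ideal A, Q.IsPrime → I ≤ Q → (r : ℕ∞) ≤ Q.height := by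
    intro Q hQ hIQ
    rw [← hlci.1, idealHeight]
    refine (iInf₂_le (⟨Q, hQ⟩ : PrimeSpectrum A) hIQ).trans ?_
    rw [← PrimeSpectrum.height_eq_orderHeight]
  have hItop : I ≠ ⊤ := by
    intro hI
    have hh := hlci.1
    have : idealHeight I = ⊤ := by
      rw [idealHeight, iInf₂_eq_top]
      intro p hp
      exact absurd (top_le_iff.1 (hI ▸ hp)) p.isPrime.ne_top
    rw [this] at hh
    exact absurd hh (by simp)
  obtain ⟨Q, hQm, hIQ⟩ := Ideal.exists_le_maximal I hItop
  have hQ := hQm.isPrime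
  have hnt : Nontrivial A := ⟨⟨0, 1, fun h01 => hQ.ne_top ((Ideal.eq_top_iff_one _).2 (h01 ▸ Q.zero_mem))⟩⟩
  obtain ⟨D, hD⟩ : ∃ D : ℕ, ringKrullDim A = D := by
    have hb : ringKrullDim A ≠ ⊥ := by
      intro hb
      exact absurd (ringKrullDim_nonneg_of_nontrivial (R := A)) (by rw [hb]; simp)
    obtain ⟨x, hx⟩ := WithBot.ne_bot_iff_exists.1 hb
    rw [← hx] at hr1
    have hx1 : x ≤ (r : ℕ∞) + 1 := by exact_mod_cast hr1
    have hxt : x ≠ ⊤ := by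
      rintro rfl
      exact absurd (top_le_iff.1 hx1) (by norm_cast)
    obtain ⟨D, rfl⟩ := ENat.ne_top_iff_exists.1 hxt
    exact ⟨D, hx.symm⟩
  have hD2 : 2 ≤ D := by
    let κ := (ι.comp Polynomial.C).comp Polynomial.C
    have hcoef : ∃ i, f'.coeff i ∉ Q.comap κ := by
      by_contra hcon
      push Not at hcon
      have h1 : f' ∈ (Q.comap κ).map Polynomial.C := Ideal.mem_map_C_iff.2 hcon
      have h2 : (Q.comap κ).map Polynomial.C ≤ Q.comap (ι.comp Polynomial.C) := by
        rw [Ideal.map_le_iff_le_comap, Ideal.comap_comap]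
      exact hQ.ne_top (Ideal.eq_top_of_isUnit_mem _ (h2 h1) hfu)
    have := zh1 f' _ hev ι h (Q.comap κ) hcoef D hD.le
    have h2 : ((2 : ℕ) : ℕ∞) ≤ D := le_trans le_add_self this
    exact_mod_cast h2
  have hr1' : D ≤ r + 1 := by
    rw [hD] at hr1
    exact_mod_cast hr1
  have hr2' : D + 2 ≤ 2 * r := by
    rw [hD] at hr2
    exact_mod_cast hr2
  rcases Nat.lt_or_ge 2 r with hr | hr
  · obtain ⟨s, rfl⟩ : ∃ s, r = s + 2 := ⟨r - 2, by omega⟩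
    refine zR3 a f' ι h I s (by omega) ?_ hht ?_ hdimq
    · intro Q hQ hIQ
      obtain ⟨a, -, ha⟩ := hlci.2 ⟨Q, hQ⟩ hIQ
      exact ⟨a, ha⟩
    · rw [hD]
      exact_mod_cast hr1'
  · obtain rfl : r = 2 := by omega
    refine zR2 f' _ hev ι h hfu I hht ?_
    rw [hD]
    exact_mod_cast (by omega : D ≤ 2)
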